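/- Let A_S be an Artin group of large type. Then the set of parabolic subgroups of A_S, partially ordered by inclusion, is a lattice: for any two parabolic subgroups P₁ and P₂ of A_S, the intersection P₁ ∩ P₂ is a parabolic subgroup contained in both and containing every parabolic subgroup contained in both P₁ and P₂, and there exists a parabolic subgroup R containing both P₁ and P₂ such that R is contained in every parabolic subgroup containing both P₁ and P₂. -/

import Mathlib

/-- The alternating word `sts⋯` of length `k` in the free group on `S`. -/
def braidWord {S : Type*} (k : ℕ) (s t : S) : FreeGroup S :=
  ((List.range k).map fun i => FreeGroup.of (if i % 2 = 0 then s else t)).prod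

/-- The braid relations of the Artin group with Coxeter-type matrix `M`
(`M s t = ⊤` means no relation). -/
def artinRels {S : Type*} (M : S → S → ℕ∞) : Set (FreeGroup S) :=
  { r | ∃ s t : S, s ≠ t ∧ ∃ k : ℕ, M s t = (k : ℕ∞) ∧
      r = braidWord k s t * (braidWord k t s)⁻¹ }

/-- The Artin group associated to the matrix `M`. -/
abbrev ArtinGroup {S : Type*} (M : S → S → ℕ∞) : Type _ := PresentedGroup (artinRels M)

/-- The standard parabolic subgroup `A_X` generated by the images of elements of `X ⊆ S`. -/
def StandardParabolic {S : Type*} (M : S → S → ℕ∞) (X : Set S) : Subgroup (ArtinGroup M) :=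
  Subgroup.closure ((fun s => (PresentedGroup.of s : ArtinGroup M)) '' X)

/-- The conjugate `g H g⁻¹` of a subgroup. -/
def conjSubgroup {G : Type*} [Group G] (g : G) (H : Subgroup G) : Subgroup G :=
  H.map (MulAut.conj g).toMonoidHom

/-- A parabolic subgroup: a conjugate of a standard parabolic subgroup. -/
def IsParabolic {S : Type*} (M : S → S → ℕ∞) (P : Subgroup (ArtinGroup M)) : Prop :=
  ∃ (g : ArtinGroup M) (X : Set S), P = conjSubgroup g (StandardParabolic M X)

universe u

namespace LargeArtin

/-- A two-dimensional simplicial complex, given by its edges and its triangles. -/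
structure TriComplex (V : Type u) where
  Adj : V → V → Prop
  Tri : V → V → V → Prop
  adj_symm : ∀ {x y}, Adj x y → Adj y x
  adj_ne : ∀ {x y}, Adj x y → x ≠ y
  tri_swap : ∀ {x y z}, Tri x y z → Tri y x z
  tri_rot : ∀ {x y z}, Tri x y z → Tri y z x
  tri_adj : ∀ {x y z}, Tri x y z → Adj x y

namespace TriComplex

variable {V : Type u} (X : TriComplex V)

/-- All vertex links are flag and have no induced cycles of length `4` or `5`. -/
structure LocallyLarge : Prop where
  link_flag : ∀ {v x y z}, X.Tri v x y → X.Tri v y z → X.Tri v x z → X.Tri x y z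
  link_four : ∀ {v a b c d}, X.Tri v a b → X.Tri v b c → X.Tri v c d → X.Tri v d a →
    a = c ∨ b = d ∨ X.Tri v a c ∨ X.Tri v b d
  link_five : ∀ {v a b c d f}, X.Tri v a b → X.Tri v b c → X.Tri v c d → X.Tri v d f →
    X.Tri v f a → X.Tri v a c ∨ X.Tri v b d ∨ X.Tri v c f ∨ X.Tri v d a ∨ X.Tri v f b

/-- Two consecutive spheres `B` and `A` in the simply connected development of a locally large
complex. `D p q` says that `q` is a neighbour of `p` in the previous sphere, and `LB` is adjacency
inside the previous sphere. -/
structure Stage where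
  A : Type u
  B : Type u
  eA : A → V
  eB : B → V
  D : A → B → Prop
  LB : B → B → Prop
  adj_of_D : ∀ {p q}, D p q → X.Adj (eB q) (eA p)
  ext_D : ∀ {p p' q}, D p q → D p' q → eA p = eA p' → p = p'
  tri_of_D : ∀ {p q q'}, D p q → D p q' → q ≠ q' → X.Tri (eB q) (eB q') (eA p) ∧ LB q q'
  D_of_tri : ∀ {p q q'}, D p q → LB q q' → X.Tri (eB q) (eB q') (eA p) → D p q'
  LB_symm : ∀ {q q'}, LB q q' → LB q' q
  ne_of_LB : ∀ {p q q'}, D p q → LB q q' → eB q' ≠ eA p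
  exists_of_tri : ∀ {p q w}, D p q → X.Tri (eB q) (eA p) w →
    (∃ q', D p q' ∧ eB q' = w) ∨ ∃ p', D p' q ∧ eA p' = w

namespace Stage

variable {X} (St : X.Stage)

/-- Adjacency inside the current sphere. -/
def LA (p p' : St.A) : Prop := ∃ q, St.D p q ∧ St.D p' q ∧ X.Tri (St.eB q) (St.eA p) (St.eA p')

/-- `w` is a neighbour of `p` that lies in the next sphere. -/
def Up (p : St.A) (w : V) : Prop :=
  X.Adj (St.eA p) w ∧ ∀ q, St.D p q → St.eB q ≠ w ∧ ¬ X.Tri (St.eB q) (St.eA p) w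

theorem LA_symm {St : X.Stage} {p p' : St.A} (h : St.LA p p') : St.LA p' p := by
  obtain ⟨q, h1, h2, h3⟩ := h
  exact ⟨q, h2, h1, X.tri_swap (X.tri_rot (X.tri_rot h3))⟩

variable (hX : X.LocallyLarge)
include hX

theorem Up.of_LA {St : X.Stage} {p p' : St.A} {w : V} (hp : St.Up p w) (hL : St.LA p p')
    (ht : X.Tri (St.eA p) (St.eA p') w) : St.Up p' w := by
  obtain ⟨r, hr, hr', hT⟩ := hL
  have flag := @hX.link_flag
  have swap := @X.tri_swap
  have rot := @X.tri_rot
  refine ⟨X.tri_adj (rot ht), fun r' hD => ?_⟩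
  by_cases hrr : r = r'
  · subst hrr
    refine ⟨(hp.2 r hr).1, fun h => (hp.2 r hr).2 ?_⟩
    grind
  · obtain ⟨hT2, hLB⟩ := St.tri_of_D hr' hD hrr
    have key : ¬ X.Tri (St.eA p') w (St.eB r) := fun h => (hp.2 r hr).2 (by grind)
    refine ⟨fun h => key (by grind), fun h => ?_⟩
    rcases hX.link_four (v := St.eA p') (a := w) (b := St.eA p) (c := St.eB r) (d := St.eB r')
      (by grind) (by grind) (by grind) (by grind) with h1 | h1 | h1 | h1
    · exact (hp.2 r hr).1 h1.symm
    · exact St.ne_of_LB hr hLB h1.symm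
    · exact key h1
    · have h2 : X.Tri (St.eB r) (St.eB r') (St.eA p) := by grind
      have h3 := St.D_of_tri hr hLB h2
      exact (hp.2 r' h3).2 (by grind)

/-- Two elements of a sphere define the same element of the next one. -/
def Rel (x y : {x : St.A × V // St.Up x.1 x.2}) : Prop :=
  x.1.2 = y.1.2 ∧ (x.1.1 = y.1.1 ∨
    (St.LA x.1.1 y.1.1 ∧ X.Tri (St.eA x.1.1) (St.eA y.1.1) x.1.2))

theorem rel_trans_aux {St : X.Stage} {p₁ p₂ p₃ : St.A} {w : V} {r : St.B}
    (h₁ : St.Up p₁ w) (h₂ : St.Up p₂ w)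
    (hD₁ : St.D p₁ r) (hD₂ : St.D p₂ r) (hD₃ : St.D p₃ r)
    (a₁ : X.Tri (St.eB r) (St.eA p₁) (St.eA p₂)) (a₃ : X.Tri (St.eB r) (St.eA p₂) (St.eA p₃))
    (b₁ : X.Tri (St.eA p₁) (St.eA p₂) w) (b₃ : X.Tri (St.eA p₂) (St.eA p₃) w) :
    p₁ = p₃ ∨ (St.LA p₁ p₃ ∧ X.Tri (St.eA p₁) (St.eA p₃) w) := by
  have flag := @hX.link_flag
  have swap := @X.tri_swap
  have rot := @X.tri_rot
  rcases hX.link_four (v := St.eA p₂) (a := w) (b := St.eA p₁) (c := St.eB r) (d := St.eA p₃)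
    (by grind) (by grind) (by grind) (by grind) with h | h | h | h
  · exact ((h₁.2 r hD₁).1 h.symm).elim
  · exact Or.inl (St.ext_D hD₁ hD₃ h)
  · exact ((h₂.2 r hD₂).2 (by grind)).elim
  · exact Or.inr ⟨⟨r, hD₁, hD₃, by grind⟩, by grind⟩

theorem rel_trans {St : X.Stage} {p₁ p₂ p₃ : St.A} {w : V}
    (h₁ : St.Up p₁ w) (h₂ : St.Up p₂ w)
    (L₁ : St.LA p₁ p₂) (L₃ : St.LA p₂ p₃)
    (b₁ : X.Tri (St.eA p₁) (St.eA p₂) w) (b₃ : X.Tri (St.eA p₂) (St.eA p₃) w) :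
    p₁ = p₃ ∨ (St.LA p₁ p₃ ∧ X.Tri (St.eA p₁) (St.eA p₃) w) := by
  obtain ⟨r, hr1, hr2, a₁⟩ := L₁
  obtain ⟨t, ht2, ht3, a₃⟩ := L₃
  have flag := @hX.link_flag
  have swap := @X.tri_swap
  have rot := @X.tri_rot
  by_cases hrt : r = t
  · subst hrt
    exact rel_trans_aux hX h₁ h₂ hr1 hr2 ht3 a₁ a₃ b₁ b₃
  obtain ⟨hT, hLB⟩ := St.tri_of_D hr2 ht2 hrt
  have k1 : X.Tri (St.eA p₂) (St.eA p₁) (St.eB t) →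
      p₁ = p₃ ∨ (St.LA p₁ p₃ ∧ X.Tri (St.eA p₁) (St.eA p₃) w) := fun h => by
    have h2 : X.Tri (St.eB r) (St.eB t) (St.eA p₁) := by grind
    have h3 := St.D_of_tri hr1 hLB h2
    exact rel_trans_aux hX h₁ h₂ h3 ht2 ht3 (by grind) a₃ b₁ b₃
  have k3 : X.Tri (St.eA p₂) (St.eA p₃) (St.eB r) →
      p₁ = p₃ ∨ (St.LA p₁ p₃ ∧ X.Tri (St.eA p₁) (St.eA p₃) w) := fun h => by
    have h2 : X.Tri (St.eB t) (St.eB r) (St.eA p₃) := by grind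
    have h3 := St.D_of_tri ht3 (St.LB_symm hLB) h2
    exact rel_trans_aux hX h₁ h₂ hr1 hr2 h3 a₁ (by grind) b₁ b₃
  rcases hX.link_five (v := St.eA p₂) (a := w) (b := St.eA p₁) (c := St.eB r) (d := St.eB t)
    (f := St.eA p₃) (by grind) (by grind) (by grind) (by grind) (by grind) with h | h | h | h | h
  · exact ((h₂.2 r hr2).2 (by grind)).elim
  · exact k1 h
  · exact k3 (by grind)
  · exact ((h₂.2 t ht2).2 (by grind)).elim
  · rcases hX.link_four (v := St.eA p₂) (a := St.eA p₁) (b := St.eB r) (c := St.eB t)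
      (d := St.eA p₃) (by grind) (by grind) (by grind) (by grind) with h' | h' | h' | h'
    · exact (St.ne_of_LB hr1 hLB h'.symm).elim
    · exact (St.ne_of_LB ht3 (St.LB_symm hLB) h').elim
    · exact k1 h'
    · exact k3 (by grind)

/-- The setoid whose classes form the next sphere. -/
def setoid : Setoid {x : St.A × V // St.Up x.1 x.2} where
  r := St.Rel
  iseqv := by
    have swap := @X.tri_swap
    have rot := @X.tri_rot
    refine ⟨fun x => ⟨rfl, Or.inl rfl⟩, ?_, ?_⟩
    · rintro ⟨⟨p, w⟩, hp⟩ ⟨⟨p', w'⟩, hp'⟩ ⟨h1, h2⟩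
      obtain rfl : w = w' := h1
      refine ⟨rfl, ?_⟩
      rcases h2 with h2 | ⟨h2, h3⟩
      · exact Or.inl h2.symm
      · exact Or.inr ⟨LA_symm h2, swap h3⟩
    · rintro ⟨⟨p, w⟩, hp⟩ ⟨⟨p', w'⟩, hp'⟩ ⟨⟨p'', w''⟩, hp''⟩ ⟨h1, h2⟩ ⟨h3, h4⟩
      obtain rfl : w = w' := h1
      obtain rfl : w = w'' := h3
      refine ⟨rfl, ?_⟩
      dsimp only at *
      rcases h2 with rfl | ⟨h2, h2'⟩
      · exact h4
      rcases h4 with rfl | ⟨h4, h4'⟩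
      · exact Or.inr ⟨h2, h2'⟩
      exact rel_trans hX hp hp' h2 h4 h2' h4'

/-- The pair formed by the current sphere and the next one. -/
def next : X.Stage where
  A := Quotient (St.setoid hX)
  B := St.A
  eA := Quotient.lift (fun x => x.1.2) (fun _ _ h => h.1)
  eB := St.eA
  D P p := ∃ w, ∃ h : St.Up p w, P = Quotient.mk (St.setoid hX) ⟨(p, w), h⟩
  LB := St.LA
  adj_of_D := by
    rintro P p ⟨w, h, rfl⟩
    exact h.1
  ext_D := by
    rintro P P' p ⟨w, h, rfl⟩ ⟨w', h', rfl⟩ (hw : w = w')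
    subst hw; rfl
  tri_of_D := by
    rintro P p p' ⟨w, h, rfl⟩ ⟨w', h', e⟩ hne
    have := Quotient.exact e
    obtain ⟨h1, h2 | h2⟩ := this
    · exact (hne h2).elim
    · exact ⟨h2.2, h2.1⟩
  D_of_tri := by
    rintro P p p' ⟨w, h, rfl⟩ hL hT
    exact ⟨w, h.of_LA hX hL hT, Quotient.sound ⟨rfl, Or.inr ⟨hL, hT⟩⟩⟩
  LB_symm := LA_symm
  ne_of_LB := by
    rintro P p p' ⟨w, h, rfl⟩ ⟨q, h1, h2, h3⟩ (e : St.eA p' = w)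
    exact (h.2 q h1).2 (e ▸ h3)
  exists_of_tri := by
    rintro P p w ⟨w', h, rfl⟩ (hT : X.Tri (St.eA p) w' w)
    by_cases hU : St.Up p w
    · exact Or.inr ⟨_, ⟨w, hU, rfl⟩, rfl⟩
    left
    have flag := @hX.link_flag
    have swap := @X.tri_swap
    have rot := @X.tri_rot
    have hA : X.Adj (St.eA p) w := X.tri_adj (swap (rot (rot hT)))
    simp only [Up, hA, true_and, not_forall, not_and, not_not] at hU
    obtain ⟨q, hq, hq2⟩ := hU
    have hnd : ∀ q, St.D p q → St.eB q ≠ w := by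
      rintro q hq rfl
      exact (h.2 q hq).2 (rot (rot hT))
    have hq3 := hq2 (hnd q hq)
    rcases St.exists_of_tri hq hq3 with ⟨q', hq', e⟩ | ⟨p', hp', e⟩
    · exact (hnd q' hq' e).elim
    · subst e
      have hL : St.LA p p' := ⟨q, hq, hp', hq3⟩
      have hT' : X.Tri (St.eA p) (St.eA p') w' := by grind
      exact ⟨p', ⟨w', h.of_LA hX hL hT', Quotient.sound ⟨rfl, Or.inr ⟨hL, hT'⟩⟩⟩, rfl⟩

theorem next_D_surj (P : (St.next hX).A) : ∃ p, (St.next hX).D P p := by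
  induction P using Quotient.inductionOn with
  | h x => exact ⟨x.1.1, x.1.2, x.2, rfl⟩

end Stage
end TriComplex

namespace TriComplex
variable {V : Type u} {X : TriComplex V}

namespace Stage
variable {St : X.Stage} {p p' p'' : St.A} {q q' : St.B} {w : V}

theorem down_down_unique (h : St.D p q) (h' : St.D p q') (e : St.eB q = St.eB q') : q = q' := by
  by_contra hne
  exact X.adj_ne (X.tri_adj (St.tri_of_D h h' hne).1) e

theorem down_level_ne (h : St.D p q) (h' : St.LA p p') : St.eB q ≠ St.eA p' := by
  obtain ⟨r, h1, h2, h3⟩ := h'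
  by_cases hr : r = q
  · subst hr
    exact X.adj_ne (X.tri_adj (X.tri_rot (X.tri_swap h3)))
  · exact St.ne_of_LB h2 (St.tri_of_D h1 h hr).2

theorem level_up_ne (h : St.LA p p') (h' : St.Up p w) : St.eA p' ≠ w := by
  obtain ⟨r, h1, h2, h3⟩ := h
  rintro rfl
  exact (h'.2 r h1).2 h3

theorem exists_nbr (h : X.Adj (St.eA p) w) :
    (∃ q, St.D p q ∧ St.eB q = w) ∨ (∃ p', St.LA p p' ∧ St.eA p' = w) ∨ St.Up p w := by
  by_cases hU : St.Up p w
  · exact Or.inr (Or.inr hU)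
  simp only [Up, h, true_and, not_forall, not_and, not_not] at hU
  obtain ⟨q, hq, hq2⟩ := hU
  by_cases hw : St.eB q = w
  · exact Or.inl ⟨q, hq, hw⟩
  have hT := hq2 hw
  rcases St.exists_of_tri hq hT with h | ⟨p', hp', rfl⟩
  · exact Or.inl h
  · exact Or.inr (Or.inl ⟨p', ⟨q, hq, hp', hT⟩, rfl⟩)

variable (hX : X.LocallyLarge)
include hX

theorem D_of_LA_of_tri (h : St.D p q) (h' : St.LA p p')
    (hT : X.Tri (St.eA p) (St.eB q) (St.eA p')) : St.D p' q := by
  obtain ⟨r, h1, h2, h3⟩ := h'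
  have flag := @hX.link_flag
  have swap := @X.tri_swap
  have rot := @X.tri_rot
  by_cases hr : r = q
  · exact hr ▸ h2
  · obtain ⟨k1, k2⟩ := St.tri_of_D h1 h hr
    exact St.D_of_tri h2 k2 (by grind)

theorem level_level_unique (h : St.LA p p') (h' : St.LA p p'') (e : St.eA p' = St.eA p'') :
    p' = p'' := by
  obtain ⟨r, h1, h2, h3⟩ := h'
  refine St.ext_D (D_of_LA_of_tri hX h1 h ?_) h2 e
  rw [e]
  exact X.tri_swap h3

theorem LA_of_tri (h : St.LA p p') (h' : St.LA p p'')
    (hT : X.Tri (St.eA p) (St.eA p') (St.eA p'')) : St.LA p' p'' := by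
  obtain ⟨r, h1, h2, h3⟩ := h
  obtain ⟨t, k1, k2, k3⟩ := h'
  have flag := @hX.link_flag
  have swap := @X.tri_swap
  have rot := @X.tri_rot
  have key : ∀ r, St.D p r → St.D p' r → St.D p'' r → X.Tri (St.eB r) (St.eA p) (St.eA p') →
      X.Tri (St.eB r) (St.eA p) (St.eA p'') → St.LA p' p'' := fun r a1 a2 a3 a4 a5 =>
    ⟨r, a2, a3, by grind⟩
  by_cases hr : r = t
  · subst hr
    exact key r h1 h2 k2 h3 k3
  obtain ⟨c1, c2⟩ := St.tri_of_D h1 k1 hr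
  rcases hX.link_four (v := St.eA p) (a := St.eA p') (b := St.eB r) (c := St.eB t)
    (d := St.eA p'') (by grind) (by grind) (by grind) (by grind) with h | h | h | h
  · exact (St.ne_of_LB h2 c2 h.symm).elim
  · exact (St.ne_of_LB k2 (St.LB_symm c2) h).elim
  · have : X.Tri (St.eB r) (St.eB t) (St.eA p') := by grind
    exact key t k1 (St.D_of_tri h2 c2 this) k2 (by grind) k3
  · have : X.Tri (St.eB t) (St.eB r) (St.eA p'') := by grind
    exact key r h1 h2 (St.D_of_tri k2 (St.LB_symm c2) this) h3 (by grind)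

end Stage

/-- The stage consisting of a single vertex. -/
def baseStage (X : TriComplex V) (o : V) : X.Stage where
  A := PUnit
  B := PEmpty
  eA _ := o
  eB := PEmpty.elim
  D _ _ := False
  LB _ _ := False
  adj_of_D h := h.elim
  ext_D h := h.elim
  tri_of_D h := h.elim
  D_of_tri h := h.elim
  LB_symm h := h
  ne_of_LB h := h.elim
  exists_of_tri h := h.elim

section Dev
variable (hX : X.LocallyLarge) (o : V)

/-- The successive spheres of the development based at `o`. -/
def stage : ℕ → X.Stage
  | 0 => X.baseStage o
  | k + 1 => (stage k).next hX

/-- The vertices of the development based at `o`. -/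
def Dev : Type u := Σ k, (stage hX o k).A

/-- The projection of the development. -/
def Dev.e (x : Dev hX o) : V := (stage hX o x.1).eA x.2

/-- The base vertex of the development. -/
def Dev.base : Dev hX o := ⟨0, PUnit.unit⟩

/-- `P` of level `k + 1` lies directly above `p`. -/
def Dev.Below {k : ℕ} (P : (stage hX o (k + 1)).A) (p : (stage hX o k).A) : Prop :=
  ((stage hX o k).next hX).D P p

inductive Dev.Adj : Dev hX o → Dev hX o → Prop
  | level {k : ℕ} {p p' : (stage hX o k).A} : (stage hX o k).LA p p' → Dev.Adj ⟨k, p⟩ ⟨k, p'⟩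
  | down {k : ℕ} {P : (stage hX o (k + 1)).A} {p : (stage hX o k).A} :
      Dev.Below hX o P p → Dev.Adj ⟨k + 1, P⟩ ⟨k, p⟩
  | up {k : ℕ} {P : (stage hX o (k + 1)).A} {p : (stage hX o k).A} :
      Dev.Below hX o P p → Dev.Adj ⟨k, p⟩ ⟨k + 1, P⟩

variable {hX o}

theorem Dev.Adj.symm {x y : Dev hX o} (h : Dev.Adj hX o x y) : Dev.Adj hX o y x := by
  cases h with
  | level h => exact .level (Stage.LA_symm h)
  | down h => exact .up h
  | up h => exact .down h

theorem Dev.Below.up {k : ℕ} {P : (stage hX o (k + 1)).A} {p : (stage hX o k).A}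
    (h : Dev.Below hX o P p) : (stage hX o k).Up p (Dev.e hX o ⟨k + 1, P⟩) := by
  obtain ⟨w, h, rfl⟩ := h
  exact h

theorem Dev.Adj.adj {x y : Dev hX o} (h : Dev.Adj hX o x y) : X.Adj (x.e hX o) (y.e hX o) := by
  cases h with
  | level h =>
    obtain ⟨q, h1, h2, h3⟩ := h
    exact X.tri_adj (X.tri_rot h3)
  | down h => exact X.adj_symm h.up.1
  | up h => exact h.up.1

theorem Dev.Adj.unique {x y z : Dev hX o} (h : Dev.Adj hX o x y) (h' : Dev.Adj hX o x z)
    (e : y.e hX o = z.e hX o) : y = z := by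
  cases h with
  | level h =>
    cases h' with
    | level h' => rw [Stage.level_level_unique hX h h' e]
    | down h' => exact (Stage.down_level_ne (St := (stage hX o _).next hX) h' h e.symm).elim
    | up h' => exact (Stage.level_up_ne h h'.up e).elim
  | down h =>
    cases h' with
    | level h' => exact (Stage.down_level_ne (St := (stage hX o _).next hX) h h' e).elim
    | down h' =>
      have := Stage.down_down_unique (St := (stage hX o _).next hX) h h' e
      rw [this]
    | up h' => exact ((h'.up.2 _ h).1 e).elim
  | up h =>
    cases h' with
    | level h' => exact (Stage.level_up_ne h' h.up e.symm).elim
    | down h' => exact ((h.up.2 _ h').1 e.symm).elim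
    | up h' =>
      have := ((stage hX o _).next hX).ext_D h h' e
      rw [this]

theorem Dev.exists_adj {x : Dev hX o} {w : V} (h : X.Adj (x.e hX o) w) :
    ∃ y, Dev.Adj hX o x y ∧ y.e hX o = w := by
  obtain ⟨k, p⟩ := x
  rcases Stage.exists_nbr h with ⟨q, h1, h2⟩ | ⟨p', h1, h2⟩ | h1
  · cases k with
    | zero => exact h1.elim
    | succ k => exact ⟨⟨k, q⟩, .down h1, h2⟩
  · exact ⟨⟨k, p'⟩, .level h1, h2⟩
  · exact ⟨⟨k + 1, Quotient.mk _ ⟨(p, w), h1⟩⟩, .up ⟨w, h1, rfl⟩, rfl⟩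

theorem Dev.Adj.tri {x y z : Dev hX o} (h : Dev.Adj hX o x y) (h' : Dev.Adj hX o x z)
    (hT : X.Tri (x.e hX o) (y.e hX o) (z.e hX o)) : Dev.Adj hX o y z := by
  have swap := @X.tri_swap
  have rot := @X.tri_rot
  cases h with
  | level h =>
    cases h' with
    | level h' => exact .level (Stage.LA_of_tri hX h h' hT)
    | down h' =>
      refine .down (Stage.D_of_LA_of_tri (St := (stage hX o _).next hX) hX h' h ?_)
      exact rot (swap hT)
    | up h' =>
      exact .up (((stage hX o _).next hX).D_of_tri h' h hT)
  | down h =>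
    cases h' with
    | level h' =>
      exact .up (Stage.D_of_LA_of_tri (St := (stage hX o _).next hX) hX h h' hT)
    | down h' =>
      refine .level (((stage hX o _).next hX).tri_of_D h h' ?_).2
      rintro rfl
      exact X.adj_ne (X.tri_adj (rot hT)) rfl
    | up h' => exact ((h'.up.2 _ h).2 (swap hT)).elim
  | up h =>
    cases h' with
    | level h' => exact .down (((stage hX o _).next hX).D_of_tri h h' (swap (rot (rot hT))))
    | down h' => exact ((h.up.2 _ h').2 (rot (rot hT))).elim
    | up h' =>
      rename_i k P p P'
      exact Dev.Adj.level (k := k + 1) ⟨p, h, h', hT⟩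

end Dev
end TriComplex
namespace TriComplex
variable {V : Type u} {X : TriComplex V}

/-- Simple connectedness, in the form of triviality of coverings: a path lifting function `tr`
for `e` that is compatible with the triangles admits a section. -/
def SimplyConn (X : TriComplex V) : Prop :=
  ∀ (N : Type u) (e : N → V) (tr : N → V → N),
    (∀ p w, X.Adj (e p) w → e (tr p w) = w ∧ tr (tr p w) (e p) = p) →
    (∀ p w x, X.Tri (e p) w x → tr (tr p w) x = tr p x) →
    ∀ p₀, ∃ σ : V → N, (∀ v, e (σ v) = v) ∧ σ (e p₀) = p₀ ∧
      ∀ v w, X.Adj v w → σ w = tr (σ v) w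

/-- A flag complex without induced cycles of length `4` or `5`. -/
structure Large (X : TriComplex V) : Prop where
  flag : ∀ {x y z}, X.Adj x y → X.Adj y z → X.Adj x z → X.Tri x y z
  four : ∀ {a b c d}, X.Adj a b → X.Adj b c → X.Adj c d → X.Adj d a →
    a = c ∨ b = d ∨ X.Adj a c ∨ X.Adj b d
  five : ∀ {a b c d f}, X.Adj a b → X.Adj b c → X.Adj c d → X.Adj d f → X.Adj f a →
    X.Adj a c ∨ X.Adj b d ∨ X.Adj c f ∨ X.Adj d a ∨ X.Adj f b

theorem exists_section (hX : X.LocallyLarge) (hS : X.SimplyConn) (o : V) :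
    ∃ σ : V → Dev hX o, (∀ v, (σ v).e hX o = v) ∧ σ o = Dev.base hX o ∧
      ∀ v w, X.Adj v w → Dev.Adj hX o (σ v) (σ w) := by
  classical
  have hex : ∀ (p : Dev hX o) (w : V), ∃ y, X.Adj (p.e hX o) w →
      Dev.Adj hX o p y ∧ y.e hX o = w := fun p w => by
    by_cases h : X.Adj (p.e hX o) w
    · obtain ⟨y, hy⟩ := Dev.exists_adj h
      exact ⟨y, fun _ => hy⟩
    · exact ⟨p, fun h' => (h h').elim⟩
  choose tr htr using hex
  have hback : ∀ p w, X.Adj (Dev.e hX o p) w →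
      (tr p w).e hX o = w ∧ tr (tr p w) (p.e hX o) = p := by
    intro p w h
    have h1 := htr p w h
    have h2 := htr (tr p w) (p.e hX o) (by rw [h1.2]; exact X.adj_symm h)
    exact ⟨h1.2, h2.1.unique h1.1.symm h2.2⟩
  have htri : ∀ p w x, X.Tri (Dev.e hX o p) w x → tr (tr p w) x = tr p x := by
    intro p w x h
    have h1 := htr p w (X.tri_adj h)
    have h2 := htr p x (X.tri_adj (X.tri_swap (X.tri_rot (X.tri_rot h))))
    have h3 := htr (tr p w) x (by rw [h1.2]; exact X.tri_adj (X.tri_rot h))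
    refine h3.1.unique (h1.1.tri h2.1 (by rwa [h1.2, h2.2])) (by rw [h3.2, h2.2])
  obtain ⟨σ, h1, h2, h3⟩ := hS (Dev hX o) (Dev.e hX o) tr hback htri (Dev.base hX o)
  refine ⟨σ, h1, h2, fun v w h => ?_⟩
  rw [h3 v w h]
  exact (htr _ _ (by rwa [h1])).1

section
variable {hX : X.LocallyLarge} {o : V}

theorem Dev.adj_zero {p : (stage hX o 0).A} {y : Dev hX o} (h : Dev.Adj hX o ⟨0, p⟩ y) :
    ∃ P : (stage hX o 1).A, y = ⟨1, P⟩ ∧ Dev.Below hX o P p := by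
  cases h with
  | level h => exact h.elim fun q hq => hq.1.elim
  | up h => exact ⟨_, rfl, h⟩

theorem Dev.adj_one {p : (stage hX o 1).A} {y : Dev hX o} (h : Dev.Adj hX o ⟨1, p⟩ y) :
    y = Dev.base hX o ∨
    (∃ P : (stage hX o 1).A, y = ⟨1, P⟩ ∧ X.Tri o (Dev.e hX o ⟨1, p⟩) (Dev.e hX o ⟨1, P⟩)) ∨
    (∃ P : (stage hX o 2).A, y = ⟨2, P⟩ ∧ Dev.Below hX o P p) := by
  cases h with
  | level h =>
    obtain ⟨q, h1, h2, h3⟩ := h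
    exact Or.inr (Or.inl ⟨_, rfl, h3⟩)
  | down h => exact Or.inl rfl
  | up h => exact Or.inr (Or.inr ⟨_, rfl, h⟩)

theorem Dev.adj_base_one (P : (stage hX o 1).A) : X.Adj o (Dev.e hX o ⟨1, P⟩) := by
  obtain ⟨p, hp⟩ := Stage.next_D_surj _ hX P
  exact Dev.Adj.adj (x := ⟨0, p⟩) (y := ⟨1, P⟩) (.up hp)

theorem Dev.Below.tri {k : ℕ} {P : (stage hX o (k + 1)).A} {p p' : (stage hX o k).A}
    (h : Dev.Below hX o P p) (h' : Dev.Below hX o P p') (hne : p ≠ p') :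
    X.Tri (Dev.e hX o ⟨k, p⟩) (Dev.e hX o ⟨k, p'⟩) (Dev.e hX o ⟨k + 1, P⟩) ∧
      (stage hX o k).LA p p' :=
  ((stage hX o k).next hX).tri_of_D h h' hne

theorem Dev.adj_two {p p' : (stage hX o 2).A} (h : Dev.Adj hX o ⟨2, p⟩ ⟨2, p'⟩) :
    ∃ r : (stage hX o 1).A, Dev.Below hX o p r ∧ Dev.Below hX o p' r ∧
      X.Tri (Dev.e hX o ⟨1, r⟩) (Dev.e hX o ⟨2, p⟩) (Dev.e hX o ⟨2, p'⟩) := by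
  cases h with
  | level h => exact h

theorem Dev.LA_one {p p' : (stage hX o 1).A} (h : (stage hX o 1).LA p p') :
    X.Tri o (Dev.e hX o ⟨1, p⟩) (Dev.e hX o ⟨1, p'⟩) := by
  obtain ⟨q, h1, h2, h3⟩ := h
  exact h3

end

/-- A locally large, simply connected complex is large. -/
theorem large_of_locallyLarge (hX : X.LocallyLarge) (hS : X.SimplyConn) : X.Large := by
  have swap := @X.tri_swap
  have rot := @X.tri_rot
  have tadj := @X.tri_adj
  have asymm := @X.adj_symm
  refine ⟨fun {x y z} h1 h2 h3 => ?_, fun {a b c d} h1 h2 h3 h4 => ?_,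
    fun {a b c d f} h1 h2 h3 h4 h5 => ?_⟩
  · obtain ⟨σ, hσ, hb, ha⟩ := exists_section hX hS x
    have k1 := ha _ _ h1
    have k2 := ha _ _ h2
    have k3 := ha _ _ h3
    rw [hb] at k1 k3
    obtain ⟨Y, hY, -⟩ := Dev.adj_zero k1
    obtain ⟨Z, hZ, -⟩ := Dev.adj_zero k3
    rw [hY, hZ] at k2
    have hy := hσ y
    have hz := hσ z
    rw [hY] at hy
    rw [hZ] at hz
    rcases Dev.adj_one k2 with h | ⟨P, h, hT⟩ | ⟨P, h, -⟩
    · cases h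
    · cases h
      rwa [hy, hz] at hT
    · cases h
  · obtain ⟨σ, hσ, hb, ha⟩ := exists_section hX hS a
    have k1 := ha _ _ h1
    have k2 := ha _ _ h2
    have k3 := ha _ _ (X.adj_symm h3)
    have k4 := ha _ _ (X.adj_symm h4)
    rw [hb] at k1 k4
    obtain ⟨B, hB, -⟩ := Dev.adj_zero k1
    obtain ⟨D, hD, -⟩ := Dev.adj_zero k4
    have hb' := hσ b
    have hd' := hσ d
    have hc' := hσ c
    rw [hB] at k2 hb'
    rw [hD] at k3 hd'
    rcases Dev.adj_one k2 with h | ⟨P, h, hT⟩ | ⟨P, h, hP⟩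
    · left
      rw [h] at hc'
      exact hc'
    · right; right; left
      rw [h] at hc'
      rw [← hc']
      exact Dev.adj_base_one P
    · rw [h] at k3 hc'
      rcases Dev.adj_one k3 with h | ⟨P', h, hT⟩ | ⟨P', h, hP'⟩
      · cases h
      · cases h
      · cases h
        by_cases hBD : B = D
        · right; left
          rw [← hb', ← hd', hBD]
        · right; right; right
          have := tadj (hP.tri hP' hBD).1
          rwa [hb', hd'] at this
  · obtain ⟨σ, hσ, hb, ha⟩ := exists_section hX hS a
    have k1 := ha _ _ h1
    have k2 := ha _ _ h2
    have k3 := ha _ _ h3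
    have k4 := ha _ _ (X.adj_symm h4)
    have k5 := ha _ _ (X.adj_symm h5)
    rw [hb] at k1 k5
    obtain ⟨B, hB, -⟩ := Dev.adj_zero k1
    obtain ⟨F, hF, -⟩ := Dev.adj_zero k5
    have hb' := hσ b
    have hc' := hσ c
    have hd' := hσ d
    have hf' := hσ f
    rw [hB] at k2 hb'
    rw [hF] at k4 hf'
    rcases Dev.adj_one k2 with h | ⟨C, h, hT⟩ | ⟨C, hC, hCB⟩
    · rw [h] at hc'
      have : a = c := hc'
      subst this
      exact Or.inr (Or.inr (Or.inr (Or.inl (X.adj_symm h3))))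
    · left
      rw [h] at hc'
      rw [← hc']
      exact Dev.adj_base_one C
    rcases Dev.adj_one k4 with h | ⟨D, h, hT⟩ | ⟨D, hD, hDF⟩
    · rw [h] at hd'
      have : a = d := hd'
      subst this
      exact Or.inl (X.adj_symm h3)
    · right; right; right; left
      rw [h] at hd'
      rw [← hd']
      exact X.adj_symm (Dev.adj_base_one D)
    rw [hC] at hc'
    rw [hD] at hd'
    rw [hC, hD] at k3
    obtain ⟨r, hr1, hr2, hr3⟩ := Dev.adj_two k3
    by_cases hrB : r = B
    · subst hrB
      have := (Dev.Adj.up hr2).adj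
      rw [hb', hd'] at this
      exact Or.inr (Or.inl this)
    by_cases hrF : r = F
    · subst hrF
      have := (Dev.Adj.down hr1).adj
      rw [hc', hf'] at this
      exact Or.inr (Or.inr (Or.inl this))
    obtain ⟨m1, m2⟩ := hr1.tri hCB hrB
    obtain ⟨n1, n2⟩ := hr2.tri hDF hrF
    replace m2 := Dev.LA_one m2
    replace n2 := Dev.LA_one n2
    rw [hb', hc'] at m1
    rw [hb'] at m2
    rw [hf'] at n2
    rw [hf', hd'] at n1
    rw [hc', hd'] at hr3
    rcases hX.link_five (v := Dev.e hX a ⟨1, r⟩) (a := b) (b := c) (c := d) (d := f) (f := a)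
      (by grind) hr3 (by grind) (by grind) (by grind) with h | h | h | h | h
    · exact Or.inr (Or.inl (by grind))
    · exact Or.inr (Or.inr (Or.inl (by grind)))
    · exact Or.inr (Or.inr (Or.inr (Or.inl (by grind))))
    · exact Or.inr (Or.inr (Or.inr (Or.inr (by grind))))
    · exact Or.inl (by grind)

/-- In a locally large, simply connected complex, there is a level function such that the
vertices below a given one are pairwise adjacent. -/
theorem exists_level (hX : X.LocallyLarge) (hS : X.SimplyConn) (o : V) :
    ∃ lev : V → ℕ, (∀ v, lev v = 0 → v = o) ∧
      (∀ v, lev v ≠ 0 → ∃ w, X.Adj v w ∧ lev w + 1 = lev v) ∧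
      (∀ v w w', X.Adj v w → X.Adj v w' → lev w + 1 = lev v → lev w' + 1 = lev v → w ≠ w' →
        X.Adj w w') ∧
      (∀ φ : Equiv.Perm V, (∀ x y, X.Adj x y → X.Adj (φ x) (φ y)) →
        (∀ x y, X.Adj x y → X.Adj (φ.symm x) (φ.symm y)) → φ o = o → ∀ v, lev (φ v) = lev v) := by
  obtain ⟨σ, hσ, hb, ha⟩ := exists_section hX hS o
  have h0 : ∀ v, (σ v).1 = 0 → v = o := fun v hv => by
    have h := hσ v
    generalize σ v = x at *
    obtain ⟨k, p⟩ := x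
    obtain rfl : k = 0 := hv
    exact h.symm
  have hlow : ∀ v, (σ v).1 ≠ 0 → ∃ w, X.Adj v w ∧ (σ w).1 + 1 = (σ v).1 := fun v hv => by
    obtain ⟨y, hy, hyl⟩ : ∃ y, Dev.Adj hX o (σ v) y ∧ y.1 + 1 = (σ v).1 := by
      generalize σ v = x at *
      obtain ⟨k, p⟩ := x
      cases k with
      | zero => exact (hv rfl).elim
      | succ k =>
        obtain ⟨q, hq⟩ := Stage.next_D_surj _ hX p
        exact ⟨⟨k, q⟩, .down hq, rfl⟩
    have hadj := hy.adj
    rw [hσ] at hadj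
    refine ⟨_, hadj, ?_⟩
    rw [(ha _ _ hadj).unique hy (hσ _), hyl]
  have hstep : ∀ v w, X.Adj v w → (σ w).1 ≤ (σ v).1 + 1 := fun v w h => by
    have := ha _ _ h
    generalize σ v = x at *
    generalize σ w = y at *
    cases this <;> (simp; try omega)
  have hmono : ∀ φ : Equiv.Perm V, (∀ x y, X.Adj x y → X.Adj (φ x) (φ y)) → φ o = o →
      ∀ n v, (σ v).1 = n → (σ (φ v)).1 ≤ n := fun φ h1 h2 n => by
    induction n with
    | zero =>
      intro v hv
      rw [h0 v hv, h2, hb]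
      exact le_rfl
    | succ n ih =>
      intro v hv
      obtain ⟨w, hw, hwl⟩ := hlow v (by omega)
      have := ih w (by omega)
      have := hstep _ _ (h1 _ _ (X.adj_symm hw))
      omega
  refine ⟨fun v => (σ v).1, h0, hlow, fun v w w' h h' hl hl' hne => ?_,
    fun φ h1 h2 h3 v => ?_⟩
  · have k := ha _ _ h
    have k' := ha _ _ h'
    have e := hσ w
    have e' := hσ w'
    dsimp only at hl hl'
    generalize σ v = x at *
    generalize σ w = y at *
    generalize σ w' = y' at *
    cases k with
    | level k => simp at hl
    | up k => simp at hl; omega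
    | down k =>
      cases k' with
      | level k' => simp at hl'
      | up k' => simp at hl'; omega
      | down k' =>
        have := X.tri_adj (k.tri k' (by rintro rfl; exact hne (e.symm.trans e'))).1
        rwa [e, e'] at this
  · refine le_antisymm (hmono φ h1 h3 _ v rfl) ?_
    have := hmono φ.symm h2 (by rw [Equiv.symm_apply_eq, h3]) _ (φ v) rfl
    simpa using this

end TriComplex

/-- Twice the cosine of `π / m`. -/
noncomputable def coxCos (m : ℕ∞) : ℝ := if m = ⊤ then 2 else 2 * Real.cos (Real.pi / m.toNat)

/-- The Chebyshev sequence `0, 1, c, c ^ 2 - 1, …`. -/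
noncomputable def cheb (c : ℝ) : ℕ → ℝ
  | 0 => 0
  | 1 => 1
  | k + 2 => c * cheb c (k + 1) - cheb c k

theorem coxCos_natCast (m : ℕ) : coxCos m = 2 * Real.cos (Real.pi / m) := by
  simp [coxCos]

theorem cheb_mul_sin (θ : ℝ) (k : ℕ) :
    cheb (2 * Real.cos θ) k * Real.sin θ = Real.sin (k * θ) := by
  induction k using Nat.twoStepInduction with
  | zero => simp [cheb]
  | one => simp [cheb]
  | more k ih1 ih2 =>
    rw [cheb, sub_mul, mul_assoc, ih1, ih2]
    have h1 : ((k + 2 : ℕ) : ℝ) * θ = (k + 1 : ℕ) * θ + θ := by push_cast; ring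
    have h2 : (k : ℝ) * θ = (k + 1 : ℕ) * θ - θ := by push_cast; ring
    rw [h1, h2, Real.sin_add, Real.sin_sub]
    ring

theorem cheb_two (k : ℕ) : cheb 2 k = k := by
  induction k using Nat.twoStepInduction with
  | zero => simp [cheb]
  | one => simp [cheb]
  | more k ih1 ih2 =>
    rw [cheb, ih1, ih2]
    push_cast
    ring

theorem angle_pos {m : ℕ} (hm : 2 ≤ m) :
    0 < Real.pi / m ∧ Real.pi / m < Real.pi ∧ 0 < Real.sin (Real.pi / m) := by
  have h0 : (2 : ℝ) ≤ m := by exact_mod_cast hm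
  have h1 : 0 < Real.pi / m := by positivity
  have h2 : Real.pi / m < Real.pi := by
    rw [div_lt_iff₀ (by linarith)]
    nlinarith [Real.pi_pos]
  exact ⟨h1, h2, Real.sin_pos_of_pos_of_lt_pi h1 h2⟩

theorem cheb_pos {m : ℕ∞} (hm : 2 ≤ m) {k : ℕ} (hk : 0 < k) (hkm : (k : ℕ∞) < m) :
    0 < cheb (coxCos m) k := by
  cases m with
  | top => simpa [coxCos, cheb_two] using hk
  | coe m =>
    have hm : 2 ≤ m := by exact_mod_cast hm
    have hkm : k < m := by exact_mod_cast hkm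
    obtain ⟨h1, h2, h3⟩ := angle_pos hm
    have h4 := cheb_mul_sin (Real.pi / m) k
    have h5 : 0 < Real.sin (k * (Real.pi / m)) := by
      apply Real.sin_pos_of_pos_of_lt_pi
      · positivity
      · have h0 : (0 : ℝ) < m := by exact_mod_cast (by omega : 0 < m)
        rw [mul_div_assoc', div_lt_iff₀ h0, mul_comm]
        exact mul_lt_mul_of_pos_left (by exact_mod_cast hkm) Real.pi_pos
    rw [coxCos_natCast]
    rw [← h4] at h5
    exact pos_of_mul_pos_left h5 h3.le

theorem cheb_symm {m : ℕ} (hm : 2 ≤ m) {i j : ℕ} (h : i + j = m) :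
    cheb (coxCos m) i = cheb (coxCos m) j := by
  obtain ⟨h1, h2, h3⟩ := angle_pos hm
  apply mul_right_cancel₀ h3.ne'
  rw [coxCos_natCast, cheb_mul_sin, cheb_mul_sin]
  have h0 : (m : ℝ) ≠ 0 := by exact_mod_cast (by omega : m ≠ 0)
  have : (i : ℝ) * (Real.pi / m) = Real.pi - j * (Real.pi / m) := by
    have : (i : ℝ) = m - j := by rw [← h]; push_cast; ring
    rw [this]
    field_simp
  rw [this, Real.sin_pi_sub]

theorem cheb_self {m : ℕ} (hm : 2 ≤ m) : cheb (coxCos m) m = 0 := by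
  rw [cheb_symm hm (Nat.add_zero m)]
  rfl

theorem cheb_pred {n : ℕ} (hm : 2 ≤ n + 1) : cheb (coxCos (n + 1 : ℕ)) n = 1 := by
  rw [cheb_symm hm rfl]
  rfl

theorem coxCos_sq_ne {m : ℕ} (hm : 2 ≤ m) : coxCos m ^ 2 ≠ 4 := by
  obtain ⟨h1, h2, h3⟩ := angle_pos hm
  rw [coxCos_natCast]
  have := Real.sin_sq_add_cos_sq (Real.pi / m)
  nlinarith [sq_pos_of_pos h3]

theorem coxCos_pos {m : ℕ∞} (hm : 3 ≤ m) : 0 < coxCos m := by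
  have := cheb_pos (k := 2) (le_trans (by norm_num) hm) (by norm_num)
    (lt_of_lt_of_le (by norm_num) hm)
  simpa [cheb] using this

theorem coxCos_inj {m n : ℕ∞} (hm : 2 ≤ m) (hn : 2 ≤ n) (h : coxCos m = coxCos n) : m = n := by
  have key : ∀ {m : ℕ}, 2 ≤ m → coxCos m ≠ 2 := fun hm h =>
    coxCos_sq_ne hm (by rw [h]; norm_num)
  cases m with
  | top =>
    cases n with
    | top => rfl
    | coe n =>
      exact (key (by exact_mod_cast hn) (by rw [← h]; simp [coxCos])).elim
  | coe m =>
    cases n with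
    | top => exact (key (by exact_mod_cast hm) (by rw [h]; simp [coxCos])).elim
    | coe n =>
      have hm : 2 ≤ m := by exact_mod_cast hm
      have hn : 2 ≤ n := by exact_mod_cast hn
      obtain ⟨h1, h2, -⟩ := angle_pos hm
      obtain ⟨k1, k2, -⟩ := angle_pos hn
      rw [coxCos_natCast, coxCos_natCast] at h
      have h' := Real.injOn_cos ⟨h1.le, h2.le⟩ ⟨k1.le, k2.le⟩ (mul_left_cancel₀ two_ne_zero h)
      have a1 : (m : ℝ) ≠ 0 := by exact_mod_cast (by omega : m ≠ 0)
      have a2 : (n : ℝ) ≠ 0 := by exact_mod_cast (by omega : n ≠ 0)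
      rw [div_eq_div_iff a1 a2] at h'
      have := mul_left_cancel₀ Real.pi_ne_zero h'
      exact_mod_cast this.symm


section Alternating
variable {S G : Type*} [Monoid G]

/-- The product of the alternating word of length `n` whose first letter is `s`. -/
def altProd (f : S → G) : S → S → ℕ → G
  | _, _, 0 => 1
  | s, t, n + 1 => f s * altProd f t s n

/-- The product of the alternating word of length `n` whose last letter is `s`. -/
def altProd' (f : S → G) : S → S → ℕ → G
  | _, _, 0 => 1
  | s, t, n + 1 => altProd' f t s n * f s

/-- The `n`-th letter of the alternating word starting with `s`. -/
def altNth : S → S → ℕ → S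
  | s, _, 0 => s
  | s, t, n + 1 => altNth t s n

theorem altProd_succ' (f : S → G) (s t : S) (n : ℕ) :
    altProd f s t (n + 1) = altProd f s t n * f (altNth s t n) := by
  induction n generalizing s t with
  | zero => simp [altProd, altNth]
  | succ n ih => rw [altProd, ih, ← mul_assoc]; rfl

theorem altNth_even (s t : S) (n : ℕ) : altNth s t (2 * n) = s ∧ altNth s t (2 * n + 1) = t := by
  induction n generalizing s t with
  | zero => simp [altNth]
  | succ n ih => exact ih s t

theorem altProd_eq_altProd' (f : S → G) (s t : S) (n : ℕ) :
    (altProd f s t n = altProd' f s t n ∧ altProd f t s n = altProd' f t s n) ∨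
      (altProd f s t n = altProd' f t s n ∧ altProd f t s n = altProd' f s t n) := by
  have key : ∀ n, ∀ s t, altProd f s t (2 * n) = altProd' f t s (2 * n) ∧
      altProd f s t (2 * n + 1) = altProd' f s t (2 * n + 1) := fun n => by
    induction n with
    | zero => simp [altProd, altProd']
    | succ n ih =>
      intro s t
      have h : altProd f s t (2 * (n + 1)) = altProd' f t s (2 * (n + 1)) := by
        rw [show 2 * (n + 1) = (2 * n + 1) + 1 by ring, altProd_succ', (ih s t).2,
          (altNth_even s t n).2]
        rfl
      refine ⟨h, ?_⟩
      rw [altProd_succ', h, (altNth_even s t (n + 1)).1]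
      rfl
  obtain ⟨k, h | h⟩ := n.even_or_odd'
  · subst h
    exact Or.inr ⟨(key k _ _).1, (key k _ _).1⟩
  · subst h
    exact Or.inl ⟨(key k _ _).2, (key k _ _).2⟩

theorem altProd_comm_iff (f : S → G) (s t : S) (n : ℕ) :
    altProd f s t n = altProd f t s n ↔ altProd' f s t n = altProd' f t s n := by
  rcases altProd_eq_altProd' f s t n with ⟨h1, h2⟩ | ⟨h1, h2⟩
  · rw [h1, h2]
  · rw [h1, h2, eq_comm]

theorem map_altProd {H : Type*} [Monoid H] (φ : G →* H) (f : S → G) (s t : S) (n : ℕ) :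
    φ (altProd f s t n) = altProd (fun x => φ (f x)) s t n := by
  induction n generalizing s t with
  | zero => simp [altProd]
  | succ n ih => simp [altProd, ih]

end Alternating

section Geometric
variable {S : Type*} [DecidableEq S] (M : S → S → ℕ∞)

/-- Twice the canonical bilinear form. -/
noncomputable def form : (S →₀ ℝ) →ₗ[ℝ] (S →₀ ℝ) →ₗ[ℝ] ℝ :=
  Finsupp.linearCombination ℝ fun s =>
    Finsupp.linearCombination ℝ fun t => if s = t then (2 : ℝ) else - coxCos (M s t)

/-- The simple roots. -/
noncomputable def root (s : S) : S →₀ ℝ := Finsupp.single s 1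

theorem form_root (s t : S) :
    form M (root s) (root t) = if s = t then (2 : ℝ) else - coxCos (M s t) := by
  simp [form, root]

theorem form_root_self (s : S) : form M (root s) (root s) = 2 := by simp [form_root]

theorem form_root_ne {s t : S} (h : s ≠ t) : form M (root s) (root t) = - coxCos (M s t) := by
  simp [form_root, h]

/-- The simple reflections. -/
noncomputable def refl (s : S) : (S →₀ ℝ) ≃ₗ[ℝ] (S →₀ ℝ) :=
  Module.reflection (form_root_self M s)

theorem refl_apply (s : S) (x : S →₀ ℝ) : refl M s x = x - form M (root s) x • root s :=
  Module.reflection_apply ..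

theorem refl_mul_self (s : S) : refl M s * refl M s = 1 := by
  ext1 x
  exact Module.involutive_reflection (form_root_self M s) x

theorem refl_inv (s : S) : (refl M s)⁻¹ = refl M s :=
  inv_eq_of_mul_eq_one_left (refl_mul_self M s)

theorem refl_refl (s : S) (x : S →₀ ℝ) : refl M s (refl M s x) = x :=
  Module.involutive_reflection (form_root_self M s) x

theorem refl_root_self (s : S) : refl M s (root s) = - root s := by
  rw [refl_apply, form_root_self, two_smul]
  abel

theorem refl_apply_of_ne {s y : S} (h : y ≠ s) (x : S →₀ ℝ) : refl M s x y = x y := by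
  simp [refl_apply, root, h.symm]

variable {M}

theorem refl_root_ne {s t : S} (h : s ≠ t) :
    refl M s (root t) = root t + coxCos (M s t) • root s := by
  rw [refl_apply, form_root_ne M h, neg_smul, sub_neg_eq_add]

theorem altProd_apply_of_orth {s t : S} {x : S →₀ ℝ} (hs : form M (root s) x = 0)
    (ht : form M (root t) x = 0) (n : ℕ) : altProd (refl M) s t n x = x := by
  induction n generalizing s t with
  | zero => rfl
  | succ n ih => rw [altProd, LinearEquiv.mul_apply, ih ht hs, refl_apply, hs, zero_smul, sub_zero]

variable (hsymm : ∀ s t, M s t = M t s)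
include hsymm

theorem form_comm (x y : S →₀ ℝ) : form M x y = form M y x := by
  have : form M = (form M).flip := by
    ext s t
    change form M (root s) (root t) = form M (root t) (root s)
    rw [form_root, form_root, hsymm]
    simp [eq_comm]
  conv_lhs => rw [this]
  rfl

theorem form_refl (s : S) (x y : S →₀ ℝ) : form M (refl M s x) (refl M s y) = form M x y := by
  rw [refl_apply, refl_apply]
  simp only [map_sub, map_smul, LinearMap.sub_apply, LinearMap.smul_apply, smul_eq_mul,
    form_root_self]
  rw [form_comm hsymm x (root s)]
  ring

/-- The roots of a rank two system. -/
theorem altProd_root {s t : S} (h : s ≠ t) (n : ℕ) :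
    altProd (refl M) s t n (root (altNth s t n)) =
      cheb (coxCos (M s t)) (n + 1) • root s + cheb (coxCos (M s t)) n • root t := by
  induction n generalizing s t with
  | zero => simp [altProd, altNth, cheb]
  | succ n ih =>
    rw [altProd, altNth, LinearEquiv.mul_apply, ih h.symm, hsymm t s]
    simp only [map_add, map_smul, refl_root_self, refl_root_ne h, cheb]
    module

theorem refl_braid {s t : S} (h : s ≠ t) {m : ℕ} (hm : M s t = m) (h2 : 2 ≤ m) :
    altProd (refl M) s t m = altProd (refl M) t s m := by
  obtain ⟨n, rfl⟩ : ∃ n, m = n + 1 := ⟨m - 1, by omega⟩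
  have hts : M t s = (n + 1 : ℕ) := hsymm s t ▸ hm
  have key : ∀ {s t : S}, s ≠ t → M s t = (n + 1 : ℕ) →
      altProd (refl M) s t (n + 1) (root (altNth s t n)) = - root t ∧
      altProd (refl M) s t (n + 1) (root (altNth t s n)) = - root s := fun {s t} h hm => by
    constructor
    · rw [altProd_succ', LinearEquiv.mul_apply, refl_root_self, map_neg, altProd_root hsymm h, hm,
        cheb_self h2, cheb_pred h2]
      simp
    · have := altProd_root hsymm h (n + 1)
      rw [altNth] at this
      rw [this, hm, cheb, cheb_self h2, cheb_pred h2]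
      simp
  have k1 := key h hm
  have k2 := key h.symm hts
  set p := altProd (refl M) s t (n + 1) with hp
  set q := altProd (refl M) t s (n + 1) with hq
  have hst : p (root s) = q (root s) ∧ p (root t) = q (root t) := by
    have : ∀ k, (altNth s t k = s ∧ altNth t s k = t) ∨ (altNth s t k = t ∧ altNth t s k = s) := by
      intro k
      obtain ⟨j, rfl | rfl⟩ := k.even_or_odd'
      · simp [(altNth_even _ _ j).1]
      · simp [(altNth_even _ _ j).2]
    rcases this n with ⟨e1, e2⟩ | ⟨e1, e2⟩ <;> rw [e1, e2] at k1 k2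
    · exact ⟨k1.1.trans k2.2.symm, k1.2.trans k2.1.symm⟩
    · exact ⟨k1.2.trans k2.1.symm, k1.1.trans k2.2.symm⟩
  ext1 x
  have hc := coxCos_sq_ne h2
  set c := coxCos (n + 1 : ℕ) with hcdef
  have hd : 4 - c ^ 2 ≠ 0 := sub_ne_zero.2 hc.symm
  obtain ⟨a, b, ha, hb⟩ : ∃ a b : ℝ, form M (root s) (x - (a • root s + b • root t)) = 0 ∧
      form M (root t) (x - (a • root s + b • root t)) = 0 := by
    refine ⟨(2 * form M (root s) x + c * form M (root t) x) / (4 - c ^ 2),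
      (2 * form M (root t) x + c * form M (root s) x) / (4 - c ^ 2), ?_, ?_⟩
    · simp only [map_sub, map_add, map_smul, form_root_self, form_root_ne M h, hm, smul_eq_mul]
      rw [← hcdef]
      field_simp
      ring
    · simp only [map_sub, map_add, map_smul, form_root_self, form_root_ne M h.symm, hts,
        smul_eq_mul]
      rw [← hcdef]
      field_simp
      ring
  have hx : x = (x - (a • root s + b • root t)) + (a • root s + b • root t) := by abel
  rw [hx, map_add p, map_add q, hp, hq, altProd_apply_of_orth ha hb, altProd_apply_of_orth hb ha,
    ← hp, ← hq]
  simp [hst.1, hst.2]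

end Geometric

section
variable {S G : Type*} [Monoid G]

theorem exists_list_altProd' (f : S → G) (s t : S) (n : ℕ) :
    ∃ L : List S, L.length = n ∧ (L.map f).prod = altProd' f s t n := by
  induction n generalizing s t with
  | zero => exact ⟨[], rfl, rfl⟩
  | succ n ih =>
    obtain ⟨L, h1, h2⟩ := ih t s
    exact ⟨L ++ [s], by simp [h1], by simp [h2, altProd']⟩

theorem altProd'_add (f : S → G) (s t : S) (k m : ℕ) :
    ∃ L : List S, L.length = k ∧ altProd' f s t (k + m) = (L.map f).prod * altProd' f s t m := by
  induction m generalizing s t with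
  | zero =>
    obtain ⟨L, h1, h2⟩ := exists_list_altProd' f s t k
    exact ⟨L, h1, by simp [h2, altProd']⟩
  | succ m ih =>
    obtain ⟨L, h1, h2⟩ := ih t s
    exact ⟨L, h1, by rw [← add_assoc, altProd', h2, altProd', mul_assoc]⟩

theorem altProd'_eq_altProd (f : S → G) (s t : S) (n : ℕ) :
    (altProd' f t s n = altProd f s t n ∧ altNth s t n = s) ∨
      (altProd' f t s n = altProd f t s n ∧ altNth t s n = s) := by
  induction n generalizing s t with
  | zero => simp [altProd', altProd, altNth]
  | succ n ih =>
    rw [altProd']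
    rcases ih t s with ⟨h1, h2⟩ | ⟨h1, h2⟩
    · right
      refine ⟨?_, ?_⟩
      · rw [altProd_succ', h1, h2]
      · have := altNth_even t s
        obtain ⟨j, rfl | rfl⟩ := n.even_or_odd'
        · exact (this j).2
        · rw [altNth, h2.symm.trans (this j).2]
          exact (altNth_even _ _ _).2
    · left
      refine ⟨?_, ?_⟩
      · rw [altProd_succ', h1, h2]
      · have := altNth_even s t
        obtain ⟨j, rfl | rfl⟩ := n.even_or_odd'
        · rw [(this j).2, ← h2, (this j).1]
        · exact (this (j + 1)).1

end

section Geometric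
variable {S : Type*} [DecidableEq S] {M : S → S → ℕ∞}

/-- The linear map given by a word. -/
noncomputable def evalWord (M : S → S → ℕ∞) (L : List S) : (S →₀ ℝ) ≃ₗ[ℝ] (S →₀ ℝ) :=
  (L.map (refl M)).prod

theorem evalWord_append (L L' : List S) :
    evalWord M (L ++ L') = evalWord M L * evalWord M L' := by
  simp [evalWord]

theorem evalWord_cons (s : S) (L : List S) : evalWord M (s :: L) = refl M s * evalWord M L := by
  simp [evalWord]

theorem evalWord_singleton (s : S) : evalWord M [s] = refl M s := by
  simp [evalWord]

theorem cheb_nonneg {m : ℕ∞} (hm : 2 ≤ m) {k : ℕ} (hkm : (k : ℕ∞) ≤ m) :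
    0 ≤ cheb (coxCos m) k := by
  rcases k.eq_zero_or_pos with rfl | hk
  · simp [cheb]
  rcases hkm.lt_or_eq with h | h
  · exact (cheb_pos hm hk h).le
  · subst h
    rw [cheb_self (by exact_mod_cast hm)]

/-- The word `L` is reduced, and `s` is not a right descent of it. -/
def Ascent (M : S → S → ℕ∞) (L : List S) (s : S) : Prop :=
  (∀ L', evalWord M L' = evalWord M L → L.length ≤ L'.length) ∧
    ∀ L', evalWord M L' = evalWord M L * refl M s → L.length ≤ L'.length

theorem Ascent.eq_altProd' {s t : S} {q : List S} (hq : ∀ x ∈ q, x = s ∨ x = t)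
    (h : Ascent M q s) : evalWord M q = altProd' (refl M) t s q.length := by
  induction q using List.reverseRecOn generalizing s t with
  | nil => rfl
  | append_singleton q y ih =>
    rcases hq y (by simp) with rfl | rfl
    · have := h.2 q (by rw [evalWord_append, evalWord_singleton, mul_assoc, refl_mul_self, mul_one])
      simp at this
    · rw [evalWord_append, evalWord_singleton, List.length_append, List.length_singleton, altProd',
        ← ih (s := y) (t := s)]
      · intro x hx
        exact (hq x (by simp [hx])).symm
      · refine ⟨fun L' hL' => ?_, fun L' hL' => ?_⟩
        · have := h.1 (L' ++ [y]) (by rw [evalWord_append, evalWord_append, hL'])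
          simpa using this
        · have := h.1 L' (by rw [evalWord_append, evalWord_singleton, hL'])
          simp at this
          omega

variable (hsymm : ∀ s t, M s t = M t s) (h2 : ∀ s t, s ≠ t → 2 ≤ M s t)
include hsymm h2

theorem Ascent.exists_nonneg {s t : S} (hst : s ≠ t) {q : List S} (hq : ∀ x ∈ q, x = s ∨ x = t)
    (h : Ascent M q s) :
    ∃ x y : ℝ, 0 ≤ x ∧ 0 ≤ y ∧ evalWord M q (root s) = x • root s + y • root t := by
  have he := h.eq_altProd' hq
  have hlt : ((q.length + 1 : ℕ) : ℕ∞) ≤ M s t := by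
    by_contra! hlt
    obtain ⟨m, hm⟩ : ∃ m : ℕ, M s t = m := by
      cases hM : M s t with
      | top => simp [hM] at hlt
      | coe m => exact ⟨m, rfl⟩
    have h2' : 2 ≤ m := by
      have := h2 s t hst
      rw [hm] at this
      exact_mod_cast this
    rw [hm] at hlt
    have hlt : m < q.length + 1 := by exact_mod_cast hlt
    obtain ⟨k, hk⟩ : ∃ k, q.length = k + m := ⟨q.length - m, by omega⟩
    obtain ⟨L, hL1, hL2⟩ := altProd'_add (refl M) t s k m
    obtain ⟨n, rfl⟩ : ∃ n, m = n + 1 := ⟨m - 1, by omega⟩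
    have hb := (altProd_comm_iff _ _ _ _).1 (refl_braid hsymm hst hm h2')
    obtain ⟨L', hL'1, hL'2⟩ := exists_list_altProd' (refl M) t s n
    have := h.2 (L ++ L') (by
      rw [he, hk, hL2, ← hb, altProd', ← hL'2, mul_assoc, mul_assoc, refl_mul_self, mul_one,
        evalWord_append]
      rfl)
    simp at this
    omega
  have hp : 0 ≤ cheb (coxCos (M s t)) (q.length + 1) := cheb_nonneg (h2 s t hst) hlt
  have hp' : 0 ≤ cheb (coxCos (M s t)) q.length :=
    cheb_nonneg (h2 s t hst) (le_trans (by exact_mod_cast Nat.le_succ _) hlt)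
  rw [he]
  rcases altProd'_eq_altProd (refl M) s t q.length with ⟨h1, h3⟩ | ⟨h1, h3⟩
  · have := altProd_root hsymm hst q.length
    rw [h3] at this
    exact ⟨_, _, hp, hp', by rw [h1, this]⟩
  · have := altProd_root hsymm hst.symm q.length
    rw [h3, hsymm t s, add_comm] at this
    exact ⟨_, _, hp', hp, by rw [h1, this]⟩

theorem Ascent.root_nonneg {L : List S} {s : S} (h : Ascent M L s) :
    0 ≤ evalWord M L (root s) := by
  induction hn : L.length using Nat.strong_induction_on generalizing L s with
  | _ n ih =>
  subst hn
  rcases L.eq_nil_or_concat with rfl | ⟨L₀, t, rfl⟩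
  · simp [evalWord, root]
  simp only [List.concat_eq_append] at *
  have hst : s ≠ t := by
    rintro rfl
    have := h.2 L₀ (by rw [evalWord_append, evalWord_singleton, mul_assoc, refl_mul_self, mul_one])
    simp at this
  set L := L₀ ++ [t] with hL
  let Cand : ℕ → Prop := fun n => ∃ A q : List S, A.length = n ∧ (∀ x ∈ q, x = s ∨ x = t) ∧
    A.length + q.length ≤ L.length ∧ evalWord M A * evalWord M q = evalWord M L
  have hC : Cand L₀.length := ⟨L₀, [t], rfl, by simp, by simp [hL], by rw [hL, evalWord_append]⟩
  classical
  have hex : ∃ n, Cand n := ⟨_, hC⟩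
  have hlt : Nat.find hex < L.length := lt_of_le_of_lt (Nat.find_min' hex hC) (by simp [hL])
  obtain ⟨A, q, hA, hq, hle, he⟩ := Nat.find_spec hex
  have hmin : ∀ A' q' : List S, (∀ x ∈ q', x = s ∨ x = t) → A'.length + q'.length ≤ L.length →
      evalWord M A' * evalWord M q' = evalWord M L → A.length ≤ A'.length := fun A' q' a b c => by
    rw [hA]
    exact Nat.find_min' hex ⟨A', q', rfl, a, b, c⟩
  have hAx : ∀ x, x = s ∨ x = t → Ascent M A x := fun x hx => by
    refine ⟨fun L' hL' => ?_, fun L' hL' => ?_⟩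
    · by_contra! hcon
      exact absurd (hmin L' q hq (by omega) (by rw [hL', he])) (by omega)
    · by_contra! hcon
      refine absurd (hmin L' (x :: q) ?_ ?_ ?_) (by omega)
      · simpa [hx] using hq
      · simp; omega
      · rw [hL', evalWord_cons, mul_assoc, ← mul_assoc (refl M x), refl_mul_self, one_mul, he]
  have hs := ih _ (hA ▸ hlt) (hAx s (Or.inl rfl)) rfl
  have ht := ih _ (hA ▸ hlt) (hAx t (Or.inr rfl)) rfl
  have hqa : Ascent M q s := by
    refine ⟨fun L' hL' => ?_, fun L' hL' => ?_⟩
    · have := h.1 (A ++ L') (by rw [evalWord_append, hL', he])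
      simp at this
      omega
    · have := h.2 (A ++ L') (by rw [evalWord_append, hL', ← mul_assoc, he])
      simp at this
      omega
  obtain ⟨x, y, hx, hy, hxy⟩ := hqa.exists_nonneg hsymm h2 hst hq
  rw [← he, LinearEquiv.mul_apply, hxy, map_add, map_smul, map_smul]
  exact add_nonneg (smul_nonneg hx hs) (smul_nonneg hy ht)

/-- Every root is positive or negative. -/
theorem evalWord_root_sign (L : List S) (s : S) :
    0 ≤ evalWord M L (root s) ∨ evalWord M L (root s) ≤ 0 := by
  have hmin : ∀ w : (S →₀ ℝ) ≃ₗ[ℝ] (S →₀ ℝ), (∃ L, evalWord M L = w) →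
      ∃ L, evalWord M L = w ∧ ∀ L', evalWord M L' = w → L.length ≤ L'.length := fun w hw => by
    classical
    have hex : ∃ n, ∃ L, evalWord M L = w ∧ L.length = n := by
      obtain ⟨L, hL⟩ := hw
      exact ⟨_, L, hL, rfl⟩
    obtain ⟨L, h1, h2⟩ := Nat.find_spec hex
    exact ⟨L, h1, fun L' h => h2 ▸ Nat.find_min' hex ⟨L', h, rfl⟩⟩
  obtain ⟨A, hA, hA'⟩ := hmin (evalWord M L) ⟨L, rfl⟩
  obtain ⟨B, hB, hB'⟩ := hmin (evalWord M L * refl M s)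
    ⟨L ++ [s], by rw [evalWord_append, evalWord_singleton]⟩
  rcases le_or_gt A.length B.length with h | h
  · left
    rw [← hA]
    refine Ascent.root_nonneg hsymm h2 ⟨fun L' h' => hA' L' (h'.trans hA), fun L' h' => ?_⟩
    exact h.trans (hB' L' (by rw [h', hA]))
  · right
    have : 0 ≤ evalWord M B (root s) := by
      refine Ascent.root_nonneg hsymm h2 ⟨fun L' h' => hB' L' (h'.trans hB), fun L' h' => ?_⟩
      refine h.le.trans (hA' L' ?_)
      rw [h', hB, mul_assoc, refl_mul_self, mul_one]
    rw [hB, LinearEquiv.mul_apply, refl_root_self, map_neg] at this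
    exact neg_nonneg.1 this

end Geometric

section Cocycle
variable {S : Type*} [DecidableEq S] {M : S → S → ℕ∞}

theorem evalWord_reverse (L : List S) : evalWord M L.reverse = (evalWord M L)⁻¹ := by
  induction L with
  | nil => simp [evalWord]
  | cons s L ih =>
    rw [List.reverse_cons, evalWord_append, ih, evalWord_singleton, evalWord_cons, mul_inv_rev,
      refl_inv]

/-- The positive roots of a rank two system. -/
noncomputable def planeRoot (c : ℝ) (a b : S) (j : ℕ) : S →₀ ℝ :=
  cheb c (j + 1) • root a + cheb c j • root b

omit [DecidableEq S] in
theorem planeRoot_zero (c : ℝ) (a b : S) : planeRoot c a b 0 = root a := by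
  simp [planeRoot, cheb]

/-- The vector `v` is a combination of the simple roots of `a` and `b`. -/
def InPlane (a b : S) (v : S →₀ ℝ) : Prop := ∀ y, y ≠ a → y ≠ b → v y = 0

omit [DecidableEq S] in
theorem InPlane.swap {a b : S} {v : S →₀ ℝ} (h : InPlane a b v) : InPlane b a v :=
  fun y h1 h2 => h y h2 h1

omit [DecidableEq S] in
theorem inPlane_planeRoot (c : ℝ) (a b : S) (j : ℕ) : InPlane a b (planeRoot c a b j) := by
  intro y h1 h2
  simp [planeRoot, root, h1.symm, h2.symm]

theorem InPlane.eq {a b : S} (hab : a ≠ b) {v : S →₀ ℝ} (h : InPlane a b v) :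
    v = v a • root a + v b • root b := by
  ext y
  by_cases h1 : y = a
  · subst h1
    simp [root, hab]
  by_cases h2 : y = b
  · subst h2
    simp [root, hab]
  simp [root, h y h1 h2, Ne.symm h1, Ne.symm h2]

theorem InPlane.refl_iff {a b : S} {v : S →₀ ℝ} :
    InPlane a b (refl M a v) ↔ InPlane a b v := by
  constructor <;> intro h y h1 h2
  · rw [← h y h1 h2, refl_apply_of_ne _ h1]
  · rw [← h y h1 h2, refl_apply_of_ne _ h1]

variable (M) in
/-- Elements of the Weyl group that are minimal with respect to the parabolic subgroup of `T`. -/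
def Valid (T : Set S) (u : (S →₀ ℝ) ≃ₗ[ℝ] (S →₀ ℝ)) : Prop :=
  (∃ L, evalWord M L = u) ∧ ∀ t ∈ T, 0 ≤ u (root t)

theorem valid_one (T : Set S) : Valid M T 1 :=
  ⟨⟨[], rfl⟩, fun t _ => by simp [root]⟩

variable (hsymm : ∀ s t, M s t = M t s)
include hsymm

theorem refl_planeRoot {a b : S} (hab : a ≠ b) (j : ℕ) :
    refl M a (planeRoot (coxCos (M b a)) b a j) = planeRoot (coxCos (M a b)) a b (j + 1) := by
  rw [hsymm b a]
  simp only [planeRoot, map_add, map_smul, refl_root_self, refl_root_ne hab, cheb]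
  module

theorem form_evalWord (L : List S) (x y : S →₀ ℝ) :
    form M (evalWord M L x) (evalWord M L y) = form M x y := by
  induction L with
  | nil => rfl
  | cons s L ih => rw [evalWord_cons, LinearEquiv.mul_apply, LinearEquiv.mul_apply,
      form_refl hsymm, ih]

theorem eq_root_of_nonneg {L : List S} {t a : S} (h : 0 ≤ evalWord M L (root t))
    (h' : ∀ y, y ≠ a → evalWord M L (root t) y = 0) : evalWord M L (root t) = root a := by
  set v := evalWord M L (root t) with hv
  have h1 : v = v a • root a := by
    ext y
    by_cases hy : y = a
    · subst hy
      simp [root]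
    · simp [h' y hy, root, Ne.symm hy]
  have h2 : form M v v = 2 := by rw [hv, form_evalWord hsymm, form_root_self]
  rw [h1] at h2
  simp only [map_smul, LinearMap.smul_apply, form_root_self, smul_eq_mul] at h2
  have h3 : 0 ≤ v a := h a
  have h4 : v a = 1 := by nlinarith
  rw [h1, h4, one_smul]

theorem altProd_comm_M {K : Type*} [Group K] {f : S → K} {T : Set S}
    (hf : ∀ s ∈ T, ∀ t ∈ T, s ≠ t → ∀ m : ℕ, M s t = m → altProd f s t m = altProd f t s m)
    (h2 : ∀ s t, s ≠ t → 2 ≤ M s t)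
    {u : (S →₀ ℝ) ≃ₗ[ℝ] (S →₀ ℝ)} (hu : ∃ L, evalWord M L = u) {s t a b : S} (hab : a ≠ b)
    (hs : s ∈ T) (ht : t ∈ T) (hst : s ≠ t) (h : u (root s) = root a) (h' : u (root t) = root b)
    {m : ℕ} (hm : M a b = m) : altProd' f s t m = altProd' f t s m := by
  refine (altProd_comm_iff _ _ _ _).1 (hf s hs t ht hst m ?_)
  rw [← hm]
  refine coxCos_inj (h2 _ _ hst) (h2 _ _ hab) ?_
  obtain ⟨L, rfl⟩ := hu
  have := form_evalWord hsymm L (root s) (root t)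
  rw [h, h', form_root_ne _ hab, form_root_ne _ hst] at this
  linarith

variable (h2 : ∀ s t, s ≠ t → 2 ≤ M s t)
include h2

theorem Valid.refl_mul {T : Set S} {u : (S →₀ ℝ) ≃ₗ[ℝ] (S →₀ ℝ)} (hu : Valid M T u) {a : S}
    (ha : ∀ t ∈ T, u (root t) ≠ root a) : Valid M T (refl M a * u) := by
  obtain ⟨⟨L, rfl⟩, hL⟩ := hu
  refine ⟨⟨a :: L, evalWord_cons a L⟩, fun t ht => ?_⟩
  rw [← evalWord_cons]
  rcases evalWord_root_sign hsymm h2 (a :: L) t with h | h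
  · exact h
  refine (ha t ht (eq_root_of_nonneg hsymm (hL t ht) fun y hy => le_antisymm ?_ (hL t ht y))).elim
  have := h y
  rw [evalWord_cons, LinearEquiv.mul_apply, refl_apply_of_ne _ hy] at this
  exact this

theorem Valid.plane_aux {T : Set S} {u : (S →₀ ℝ) ≃ₗ[ℝ] (S →₀ ℝ)} (hu : Valid M T u)
    {s t a b : S} (hab : a ≠ b) (hst : s ≠ t) (hs : s ∈ T) (ht : t ∈ T)
    (h : InPlane a b (u (root s))) (h' : InPlane a b (u (root t))) :
    u (root s) a * u (root t) b - u (root t) a * u (root s) b ≠ 0 ∧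
      u (root s) b * u (root t) b = 0 := by
  obtain ⟨⟨L, rfl⟩, hL⟩ := hu
  set u := evalWord M L with hu
  have e1 := h.eq hab
  have e2 := h'.eq hab
  have n1 := hL s hs
  have n2 := hL t ht
  set p1 := u (root s) a
  set q1 := u (root s) b
  set p2 := u (root t) a
  set q2 := u (root t) b
  have hlin : ∀ x y : ℝ, u (x • root s - y • root t) = 0 → x = 0 ∧ y = 0 := fun x y hxy => by
    rw [map_eq_zero_iff _ u.injective] at hxy
    have hx := DFunLike.congr_fun hxy s
    have hy := DFunLike.congr_fun hxy t
    simp [root, hst, hst.symm] at hx hy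
    exact ⟨hx, hy⟩
  have eq1 : u (q2 • root s - q1 • root t) = (p1 * q2 - p2 * q1) • root a := by
    rw [map_sub, map_smul, map_smul, e1, e2]
    module
  have eq2 : u (p2 • root s - p1 • root t) = -(p1 * q2 - p2 * q1) • root b := by
    rw [map_sub, map_smul, map_smul, e1, e2]
    module
  have hD : p1 * q2 - p2 * q1 ≠ 0 := fun hD => by
    rw [hD, zero_smul] at eq1
    rw [hD, neg_zero, zero_smul] at eq2
    have : u (root s) = 0 := by rw [e1, (hlin _ _ eq1).2, (hlin _ _ eq2).2]; simp
    rw [map_eq_zero_iff _ u.injective] at this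
    have := DFunLike.congr_fun this s
    simp [root] at this
  refine ⟨hD, ?_⟩
  have q1n : 0 ≤ q1 := n1 b
  have q2n : 0 ≤ q2 := n2 b
  set D := p1 * q2 - p2 * q1
  set ρ := evalWord M L.reverse (root a) with hρ
  have eq3 : q2 • root s - q1 • root t = D • ρ := by
    apply u.injective
    rw [eq1, map_smul, hρ, evalWord_reverse, ← hu, ← LinearEquiv.mul_apply, mul_inv_cancel]
    rfl
  have hx := DFunLike.congr_fun eq3 s
  have hy := DFunLike.congr_fun eq3 t
  simp [root, hst, hst.symm] at hx hy
  have hpos : 0 ≤ ρ s * ρ t := by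
    rcases evalWord_root_sign hsymm h2 L.reverse a with h | h
    · exact mul_nonneg (h s) (h t)
    · exact mul_nonneg_of_nonpos_of_nonpos (h s) (h t)
  have : -(q1 * q2) = D ^ 2 * (ρ s * ρ t) := by
    rw [hx]
    linear_combination D * ρ s * hy
  have := mul_nonneg (sq_nonneg D) hpos
  have := mul_nonneg q1n q2n
  linarith

theorem Valid.plane {T : Set S} {u : (S →₀ ℝ) ≃ₗ[ℝ] (S →₀ ℝ)} (hu : Valid M T u)
    {s t a b : S} (hab : a ≠ b) (hst : s ≠ t) (hs : s ∈ T) (ht : t ∈ T)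
    (h : InPlane a b (u (root s))) (h' : InPlane a b (u (root t))) :
    (u (root s) = root a ∧ u (root t) = root b) ∨ (u (root s) = root b ∧ u (root t) = root a) := by
  obtain ⟨hD, hq⟩ := hu.plane_aux hsymm h2 hab hst hs ht h h'
  obtain ⟨-, hp⟩ := hu.plane_aux hsymm h2 hab.symm hst hs ht h.swap h'.swap
  obtain ⟨⟨L, rfl⟩, hL⟩ := hu
  have key : ∀ x ∈ T, ∀ c d : S, InPlane c d (evalWord M L (root x)) →
      evalWord M L (root x) d = 0 → evalWord M L (root x) = root c := fun x hx c d h1 h2 => by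
    refine eq_root_of_nonneg hsymm (hL x hx) fun y hy => ?_
    by_cases hyd : y = d
    · rw [hyd, h2]
    · exact h1 y hy hyd
  rcases mul_eq_zero.1 hq with h1 | h1
  · left
    refine ⟨key s hs _ _ h h1, key t ht _ _ h'.swap ?_⟩
    rw [h1, mul_zero, sub_zero] at hD
    exact (mul_eq_zero.1 hp).resolve_left (left_ne_zero_of_mul hD)
  · right
    refine ⟨key s hs _ _ h.swap ?_, key t ht _ _ h' h1⟩
    rw [h1, mul_zero, zero_sub, neg_ne_zero] at hD
    exact (mul_eq_zero.1 hp).resolve_right (left_ne_zero_of_mul hD)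

end Cocycle

section Cocycle
variable {S : Type*} [DecidableEq S] {M : S → S → ℕ∞} (hsymm : ∀ s t, M s t = M t s)
  (h2 : ∀ s t, s ≠ t → 2 ≤ M s t) {K : Type*} [Group K] (f : S → K) (T : Set S)

open Classical in
/-- The action of a generator on pairs formed by an element of `K` and a minimal element. -/
noncomputable def cocycleStep (a : S) (z : K × {u // Valid M T u}) : K × {u // Valid M T u} :=
  if h : ∃ t ∈ T, z.2.1 (root t) = root a then (f h.choose * z.1, z.2)
  else (z.1, ⟨refl M a * z.2.1, z.2.2.refl_mul hsymm h2 fun t ht e => h ⟨t, ht, e⟩⟩)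

open Classical in
/-- The inverse of `cocycleStep`. -/
noncomputable def cocycleStepInv (a : S) (z : K × {u // Valid M T u}) :
    K × {u // Valid M T u} :=
  if h : ∃ t ∈ T, z.2.1 (root t) = root a then ((f h.choose)⁻¹ * z.1, z.2)
  else (z.1, ⟨refl M a * z.2.1, z.2.2.refl_mul hsymm h2 fun t ht e => h ⟨t, ht, e⟩⟩)

theorem root_injective : Function.Injective (root : S → S →₀ ℝ) := fun s t h => by
  have := DFunLike.congr_fun h s
  by_contra hne
  simp [root, Ne.symm hne] at this

variable {T}

theorem cocycleStep_loop {a t : S} {k : K} {u : {u // Valid M T u}} (ht : t ∈ T)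
    (h : u.1 (root t) = root a) :
    cocycleStep hsymm h2 f T a (k, u) = (f t * k, u) ∧
      cocycleStepInv hsymm h2 f T a (k, u) = ((f t)⁻¹ * k, u) := by
  have hex : ∃ t ∈ T, u.1 (root t) = root a := ⟨t, ht, h⟩
  have : hex.choose = t := root_injective (u.1.injective (hex.choose_spec.2.trans h.symm))
  simp only [cocycleStep, cocycleStepInv]
  rw [dif_pos hex, dif_pos hex, this]
  exact ⟨rfl, rfl⟩

theorem cocycleStep_move {a : S} {k : K} {u : {u // Valid M T u}}
    (h : ∀ t ∈ T, u.1 (root t) ≠ root a) :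
    ∃ u' : {u // Valid M T u}, u'.1 = refl M a * u.1 ∧
      cocycleStep hsymm h2 f T a (k, u) = (k, u') ∧
      cocycleStepInv hsymm h2 f T a (k, u) = (k, u') := by
  have hex : ¬ ∃ t ∈ T, u.1 (root t) = root a := fun ⟨t, ht, e⟩ => h t ht e
  refine ⟨_, ?_, dif_neg hex, dif_neg hex⟩
  rfl

theorem not_loop_of_move {a : S} {u u' : {u // Valid M T u}} (h : u'.1 = refl M a * u.1) :
    ∀ t ∈ T, u'.1 (root t) ≠ root a := fun t ht e => by
  rw [h, LinearEquiv.mul_apply] at e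
  have h1 := u.2.2 t ht
  have h3 : u.1 (root t) = - root a := by
    rw [← refl_root_self M, ← e, refl_refl]
  rw [h3] at h1
  have := h1 a
  simp [root] at this
  linarith

variable (T) in
/-- `cocycleStep` as a permutation. -/
noncomputable def cocyclePerm (a : S) : Equiv.Perm (K × {u // Valid M T u}) where
  toFun := cocycleStep hsymm h2 f T a
  invFun := cocycleStepInv hsymm h2 f T a
  left_inv := by
    rintro ⟨k, u⟩
    by_cases h : ∃ t ∈ T, u.1 (root t) = root a
    · obtain ⟨t, ht, h⟩ := h
      rw [(cocycleStep_loop hsymm h2 f ht h).1, (cocycleStep_loop hsymm h2 f ht h).2,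
        inv_mul_cancel_left]
    · push Not at h
      obtain ⟨u', h1, h3, -⟩ := cocycleStep_move hsymm h2 f (k := k) h
      obtain ⟨u'', h1', -, h4⟩ := cocycleStep_move hsymm h2 f (k := k) (not_loop_of_move h1)
      rw [h3, h4]
      congr 1
      apply Subtype.ext
      rw [h1', h1, ← mul_assoc, refl_mul_self, one_mul]
  right_inv := by
    rintro ⟨k, u⟩
    by_cases h : ∃ t ∈ T, u.1 (root t) = root a
    · obtain ⟨t, ht, h⟩ := h
      rw [(cocycleStep_loop hsymm h2 f ht h).2, (cocycleStep_loop hsymm h2 f ht h).1,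
        mul_inv_cancel_left]
    · push Not at h
      obtain ⟨u', h1, -, h3⟩ := cocycleStep_move hsymm h2 f (k := k) h
      obtain ⟨u'', h1', h4, -⟩ := cocycleStep_move hsymm h2 f (k := k) (not_loop_of_move h1)
      rw [h3, h4]
      congr 1
      apply Subtype.ext
      rw [h1', h1, ← mul_assoc, refl_mul_self, one_mul]

theorem cocyclePerm_run_double {a b s t : S} (hs : s ∈ T) (ht : t ∈ T) {k : K}
    {u : {u // Valid M T u}} (h : u.1 (root s) = root a) (h' : u.1 (root t) = root b) (n : ℕ) :
    altProd' (cocyclePerm hsymm h2 f T) a b n (k, u) = (altProd' f s t n * k, u) := by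
  induction n generalizing s t a b k with
  | zero => simp [altProd']
  | succ n ih =>
    rw [altProd', Equiv.Perm.mul_apply]
    have : cocyclePerm hsymm h2 f T a (k, u) = (f s * k, u) :=
      (cocycleStep_loop hsymm h2 f hs h).1
    rw [this, ih ht hs h' h, altProd', mul_assoc]

theorem cocyclePerm_run_none {a b : S} (hab : a ≠ b) {k : K} {u : {u // Valid M T u}} (n : ℕ)
    (h : ∀ t ∈ T, ∀ j < n, u.1 (root t) ≠ planeRoot (coxCos (M a b)) a b j) :
    (altProd' (cocyclePerm hsymm h2 f T) a b n (k, u)).1 = k ∧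
      (altProd' (cocyclePerm hsymm h2 f T) a b n (k, u)).2.1 = altProd' (refl M) a b n * u.1 := by
  induction n generalizing a b u with
  | zero => simp [altProd']
  | succ n ih =>
    rw [altProd', Equiv.Perm.mul_apply]
    obtain ⟨u', h1, h3, -⟩ := cocycleStep_move hsymm h2 f (a := a) (k := k) (u := u)
      fun t ht => by
        have := h t ht 0 (by omega)
        rwa [planeRoot_zero] at this
    have h4 : cocyclePerm hsymm h2 f T a (k, u) = (k, u') := h3
    rw [h4, altProd', mul_assoc, ← h1]
    refine ih hab.symm fun t ht j hj e => h t ht (j + 1) (by omega) ?_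
    rw [← refl_planeRoot hsymm hab, ← e, h1, LinearEquiv.mul_apply, refl_refl]

theorem cocyclePerm_run_one {a b : S} (hab : a ≠ b) {k : K} {u : {u // Valid M T u}} (n i : ℕ)
    (hn : (n : ℕ∞) ≤ M a b) (hi : i < n)
    (hu : ∀ s ∈ T, ∀ t ∈ T, InPlane a b (u.1 (root s)) → InPlane a b (u.1 (root t)) → s = t)
    {t : S} (ht : t ∈ T) (h : u.1 (root t) = planeRoot (coxCos (M a b)) a b i) :
    (altProd' (cocyclePerm hsymm h2 f T) a b n (k, u)).1 = f t * k ∧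
      (altProd' (cocyclePerm hsymm h2 f T) a b n (k, u)).2.1 =
        altProd' (refl M) a b n * u.1 * refl M t := by
  have hne : ∀ {a b : S}, a ≠ b → ∀ {n : ℕ}, (n : ℕ∞) ≤ M a b → ∀ j, j + 1 < n →
      planeRoot (coxCos (M a b)) a b (j + 1) ≠ root a := fun {a b} hab {n} hn j hj e => by
    have h3 := cheb_pos (h2 a b hab) (k := j + 1) (by omega)
      (lt_of_lt_of_le (by exact_mod_cast hj) hn)
    have := DFunLike.congr_fun e b
    simp [planeRoot, root, hab] at this
    exact h3.ne' this
  induction n generalizing a b u i with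
  | zero => omega
  | succ n ih =>
    rw [altProd', Equiv.Perm.mul_apply]
    cases i with
    | zero =>
      rw [planeRoot_zero] at h
      have h4 : cocyclePerm hsymm h2 f T a (k, u) = (f t * k, u) :=
        (cocycleStep_loop hsymm h2 f ht h).1
      rw [h4]
      have hn' : ((n + 1 : ℕ) : ℕ∞) ≤ M b a := hsymm a b ▸ hn
      have hrun := cocyclePerm_run_none hsymm h2 f hab.symm (k := f t * k) (u := u) n
        fun t' ht' j hj e => by
          have htt : t' = t := hu t' ht' t ht
            (by rw [e]; exact (inPlane_planeRoot _ _ _ _).swap)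
            (by rw [h, ← planeRoot_zero 0 a b]; exact inPlane_planeRoot _ _ _ _)
          subst htt
          rw [h] at e
          have h3 := cheb_pos (h2 b a hab.symm) (k := j + 1) (by omega)
            (lt_of_lt_of_le (by exact_mod_cast (by omega : j + 1 < n + 1)) hn')
          have := DFunLike.congr_fun e b
          simp [planeRoot, root, hab] at this
          exact h3.ne this
      refine ⟨hrun.1, ?_⟩
      rw [hrun.2, altProd', mul_assoc, mul_assoc]
      congr 1
      ext1 x
      simp only [LinearEquiv.mul_apply]
      obtain ⟨L, hL⟩ := u.2.1
      have hf : form M (root a) (u.1 (refl M t x)) = form M (root t) (refl M t x) := by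
        rw [← h, ← hL, form_evalWord hsymm]
      rw [refl_apply M a, hf, ← h, ← map_smul, ← map_sub, ← refl_apply, refl_refl]
    | succ i =>
      obtain ⟨u', h1, h3, -⟩ := cocycleStep_move hsymm h2 f (a := a) (k := k) (u := u)
        fun t' ht' e => by
          have htt : t' = t := hu t' ht' t ht
            (by rw [e, ← planeRoot_zero 0 a b]; exact inPlane_planeRoot _ _ _ _)
            (by rw [h]; exact inPlane_planeRoot _ _ _ _)
          subst htt
          exact hne hab hn i hi (h.symm.trans e)
      have h4 : cocyclePerm hsymm h2 f T a (k, u) = (k, u') := h3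
      rw [h4, altProd', mul_assoc _ (refl M a), ← h1]
      refine ih hab.symm (i := i) ?_ (by omega) ?_ ?_
      · rw [hsymm b a]
        exact le_trans (by exact_mod_cast Nat.le_succ n) hn
      · intro s hs t ht hs' ht'
        rw [h1, LinearEquiv.mul_apply] at hs' ht'
        exact hu s hs t ht (InPlane.refl_iff.1 hs'.swap) (InPlane.refl_iff.1 ht'.swap)
      · rw [h1, LinearEquiv.mul_apply, h, ← refl_planeRoot hsymm hab, refl_refl]

omit [DecidableEq S] in
include hsymm h2 in
theorem planeRoot_symm {a b : S} (hab : a ≠ b) {m : ℕ} (hm : M a b = m) {i : ℕ} (hi : i < m) :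
    planeRoot (coxCos (M a b)) a b i = planeRoot (coxCos (M b a)) b a (m - 1 - i) := by
  have h2' : 2 ≤ m := by
    have := h2 a b hab
    rw [hm] at this
    exact_mod_cast this
  rw [hsymm b a, hm, planeRoot, planeRoot, cheb_symm h2' (i := i + 1) (j := m - 1 - i) (by omega),
    cheb_symm h2' (i := i) (j := m - 1 - i + 1) (by omega), add_comm]

theorem cocyclePerm_braid
    (hf : ∀ s ∈ T, ∀ t ∈ T, s ≠ t → ∀ m : ℕ, M s t = m → altProd f s t m = altProd f t s m)
    {a b : S} (hab : a ≠ b) {m : ℕ} (hm : M a b = m) :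
    altProd (cocyclePerm hsymm h2 f T) a b m = altProd (cocyclePerm hsymm h2 f T) b a m := by
  rw [altProd_comm_iff]
  have hm' : M b a = m := hsymm a b ▸ hm
  have h2' : 2 ≤ m := by
    have := h2 a b hab
    rw [hm] at this
    exact_mod_cast this
  have hbr := (altProd_comm_iff _ _ _ _).1 (refl_braid hsymm hab hm h2')
  ext1 ⟨k, u⟩
  by_cases hu : ∀ s ∈ T, ∀ t ∈ T, InPlane a b (u.1 (root s)) → InPlane a b (u.1 (root t)) → s = t
  · have hu' : ∀ s ∈ T, ∀ t ∈ T, InPlane b a (u.1 (root s)) → InPlane b a (u.1 (root t)) →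
        s = t := fun s hs t ht h h' => hu s hs t ht h.swap h'.swap
    by_cases hex : ∃ t ∈ T, ∃ i < m, u.1 (root t) = planeRoot (coxCos (M a b)) a b i
    · obtain ⟨t, ht, i, hi, h⟩ := hex
      have h' := h
      rw [planeRoot_symm hsymm h2 hab hm hi] at h'
      obtain ⟨e1, e2⟩ := cocyclePerm_run_one hsymm h2 f hab (k := k) m i hm.ge hi hu ht h
      obtain ⟨e3, e4⟩ := cocyclePerm_run_one hsymm h2 f hab.symm (k := k) m (m - 1 - i) hm'.ge
        (by omega) hu' ht h'
      exact Prod.ext (e1.trans e3.symm) (Subtype.ext (by rw [e2, e4, hbr]))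
    · push Not at hex
      obtain ⟨e1, e2⟩ := cocyclePerm_run_none hsymm h2 f hab (k := k) m hex
      obtain ⟨e3, e4⟩ := cocyclePerm_run_none hsymm h2 f hab.symm (k := k) (u := u) m
        fun t ht j hj e => by
          refine hex t ht (m - 1 - j) (by omega) ?_
          rw [e, planeRoot_symm hsymm h2 hab.symm hm' hj]
      exact Prod.ext (e1.trans e3.symm) (Subtype.ext (by rw [e2, e4, hbr]))
  · push Not at hu
    obtain ⟨s, hs, t, ht, h, h', hst⟩ := hu
    rcases u.2.plane hsymm h2 hab hst hs ht h h' with ⟨e1, e2⟩ | ⟨e1, e2⟩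
    · rw [cocyclePerm_run_double hsymm h2 f hs ht e1 e2,
        cocyclePerm_run_double hsymm h2 f ht hs e2 e1,
        altProd_comm_M hsymm hf h2 u.2.1 hab hs ht hst e1 e2 hm]
    · rw [cocyclePerm_run_double hsymm h2 f hs ht e1 e2,
        cocyclePerm_run_double hsymm h2 f ht hs e2 e1,
        altProd_comm_M hsymm hf h2 u.2.1 hab.symm hs ht hst e1 e2 hm']

end Cocycle

section Hom
variable {S : Type*} {K : Type*} [Group K]

theorem braidWord_succ (k : ℕ) (s t : S) :
    braidWord (k + 1) s t = FreeGroup.of s * braidWord k t s := by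
  rw [braidWord, braidWord, List.range_succ_eq_map, List.map_cons, List.prod_cons, List.map_map]
  congr 2
  refine List.map_congr_left fun i _ => ?_
  simp only [Function.comp_apply]
  rcases Nat.mod_two_eq_zero_or_one i with h | h
  · rw [if_neg (by omega), if_pos h]
  · rw [if_pos (by omega), if_neg (by omega)]

theorem lift_braidWord (f : S → K) (k : ℕ) (s t : S) :
    FreeGroup.lift f (braidWord k s t) = altProd f s t k := by
  induction k generalizing s t with
  | zero => simp [braidWord, altProd]
  | succ k ih => rw [braidWord_succ, map_mul, ih, FreeGroup.lift_apply_of, altProd]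

/-- The family `f` satisfies the braid relations between the elements of `T`. -/
def BraidOn (M : S → S → ℕ∞) (f : S → K) (T : Set S) : Prop :=
  ∀ s ∈ T, ∀ t ∈ T, s ≠ t → ∀ m : ℕ, M s t = m → altProd f s t m = altProd f t s m

variable (M : S → S → ℕ∞)

/-- The standard generators. -/
def gen (s : S) : ArtinGroup M := PresentedGroup.of s

variable {M}

theorem standardParabolic_eq (T : Set S) :
    StandardParabolic M T = Subgroup.closure (gen M '' T) := rfl

theorem gen_mem {T : Set S} {s : S} (h : s ∈ T) : gen M s ∈ StandardParabolic M T :=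
  Subgroup.subset_closure ⟨s, h, rfl⟩

theorem standardParabolic_mono {T U : Set S} (h : T ⊆ U) :
    StandardParabolic M T ≤ StandardParabolic M U :=
  Subgroup.closure_mono (Set.image_mono h)

theorem standardParabolic_univ : StandardParabolic M Set.univ = ⊤ := by
  rw [standardParabolic_eq, Set.image_univ]
  exact PresentedGroup.closure_range_of (artinRels M)

theorem standardParabolic_empty : StandardParabolic M ∅ = ⊥ := by
  rw [standardParabolic_eq, Set.image_empty, Subgroup.closure_empty]

theorem standardParabolic_induction {T : Set S} {p : ArtinGroup M → Prop}
    (hgen : ∀ s ∈ T, p (gen M s)) (hone : p 1) (hmul : ∀ g h, p g → p h → p (g * h))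
    (hinv : ∀ g, p g → p g⁻¹) {g : ArtinGroup M} (hg : g ∈ StandardParabolic M T) : p g := by
  induction hg using Subgroup.closure_induction with
  | mem x hx =>
    obtain ⟨s, hs, rfl⟩ := hx
    exact hgen s hs
  | one => exact hone
  | mul x y _ _ hx hy => exact hmul x y hx hy
  | inv x _ hx => exact hinv x hx

theorem gen_braid (T : Set S) : BraidOn M (gen M) T := by
  intro s _ t _ hst m hm
  have h : PresentedGroup.mk (artinRels M) (braidWord m s t * (braidWord m t s)⁻¹) = 1 :=
    PresentedGroup.one_of_mem ⟨s, t, hst, m, hm, rfl⟩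
  have e : PresentedGroup.mk (artinRels M) = FreeGroup.lift (gen M) := by
    ext x
    rw [FreeGroup.lift_apply_of]
    rfl
  rw [e, map_mul, map_inv, lift_braidWord, lift_braidWord] at h
  exact mul_inv_eq_one.1 h

/-- The homomorphism defined by a family satisfying all the braid relations. -/
def artinLift (f : S → K) (hf : BraidOn M f Set.univ) : ArtinGroup M →* K :=
  PresentedGroup.toGroup (f := f) (by
    rintro r ⟨s, t, hst, m, hm, rfl⟩
    rw [map_mul, map_inv, lift_braidWord, lift_braidWord,
      hf s trivial t trivial hst m hm, mul_inv_cancel])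

theorem artinLift_gen (f : S → K) (hf : BraidOn M f Set.univ) (s : S) :
    artinLift f hf (gen M s) = f s := PresentedGroup.toGroup.of _

end Hom

section Parabolic
variable {S : Type*} {M : S → S → ℕ∞} (hsymm : ∀ s t, M s t = M t s)
  (h2 : ∀ s t, s ≠ t → 2 ≤ M s t) {K : Type*} [Group K]

/-- The action of the Artin group by `cocyclePerm`. -/
noncomputable def cocycleAct [DecidableEq S] {f : S → K} {T : Set S} (hf : BraidOn M f T) :
    ArtinGroup M →* Equiv.Perm (K × {u // Valid M T u}) :=
  artinLift (cocyclePerm hsymm h2 f T) fun _ _ _ _ hst _ hm =>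
    cocyclePerm_braid hsymm h2 f hf hst hm

theorem cocycleAct_gen [DecidableEq S] {f : S → K} {T : Set S} (hf : BraidOn M f T) (t : S) :
    cocycleAct hsymm h2 hf (gen M t) = cocyclePerm hsymm h2 f T t := artinLift_gen _ _ _

theorem cocycleAct_gen_one [DecidableEq S] {f : S → K} {T : Set S} (hf : BraidOn M f T) {t : S}
    (ht : t ∈ T) (k : K) :
    cocycleAct hsymm h2 hf (gen M t) (k, ⟨1, valid_one T⟩) = (f t * k, ⟨1, valid_one T⟩) := by
  rw [cocycleAct_gen]
  exact (cocycleStep_loop hsymm h2 f ht rfl).1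

include hsymm h2

/-- A standard parabolic subgroup is an Artin group: families satisfying the braid relations
define homomorphisms. -/
theorem exists_parabolic_hom {f : S → K} {T : Set S} (hf : BraidOn M f T) :
    ∃ φ : StandardParabolic M T →* K, ∀ t (ht : t ∈ T), φ ⟨gen M t, gen_mem ht⟩ = f t := by
  classical
  have key : ∀ g ∈ StandardParabolic M T, ∃ c, ∀ k,
      cocycleAct hsymm h2 hf g (k, ⟨1, valid_one T⟩) = (c * k, ⟨1, valid_one T⟩) := by
    intro g hg
    refine standardParabolic_induction (p := fun g => ∃ c, ∀ k,
      cocycleAct hsymm h2 hf g (k, ⟨1, valid_one T⟩) = (c * k, ⟨1, valid_one T⟩)) ?_ ?_ ?_ ?_ hg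
    · exact fun s hs => ⟨f s, fun k => cocycleAct_gen_one hsymm h2 hf hs k⟩
    · exact ⟨1, fun k => by simp⟩
    · rintro g h ⟨c, hc⟩ ⟨d, hd⟩
      exact ⟨c * d, fun k => by rw [map_mul, Equiv.Perm.mul_apply, hd, hc, mul_assoc]⟩
    · rintro g ⟨c, hc⟩
      refine ⟨c⁻¹, fun k => ?_⟩
      rw [map_inv, Equiv.Perm.inv_eq_iff_eq, hc, mul_inv_cancel_left]
  choose! c hc using key
  refine ⟨MonoidHom.mk' (fun g => c g.1) fun g h => ?_, fun t ht => ?_⟩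
  · have h1 := hc (g.1 * h.1) (g * h).2 1
    rw [map_mul, Equiv.Perm.mul_apply, hc _ h.2, hc _ g.2] at h1
    simpa using (congrArg Prod.fst h1).symm
  · have h1 := hc _ (gen_mem ht) 1
    rw [cocycleAct_gen_one hsymm h2 hf ht] at h1
    simpa using (congrArg Prod.fst h1).symm

theorem standardParabolic_inf (X Y : Set S) :
    StandardParabolic M X ⊓ StandardParabolic M Y = StandardParabolic M (X ∩ Y) := by
  classical
  refine le_antisymm ?_ (le_inf (standardParabolic_mono Set.inter_subset_left)
    (standardParabolic_mono Set.inter_subset_right))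
  rintro g ⟨hX, hY⟩
  set act := cocycleAct hsymm h2 (gen_braid (M := M) Y) with hact
  have h1 : act g (1, ⟨1, valid_one Y⟩) = (g, ⟨1, valid_one Y⟩) := by
    have : ∀ k, act g (k, ⟨1, valid_one Y⟩) = (g * k, ⟨1, valid_one Y⟩) := by
      refine standardParabolic_induction (p := fun g => ∀ k,
        act g (k, ⟨1, valid_one Y⟩) = (g * k, ⟨1, valid_one Y⟩)) ?_ ?_ ?_ ?_ hY
      · exact fun s hs k => cocycleAct_gen_one hsymm h2 _ hs k
      · exact fun k => by simp
      · intro g h hg hh k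
        rw [map_mul, Equiv.Perm.mul_apply, hh, hg, mul_assoc]
      · intro g hg k
        rw [map_inv, Equiv.Perm.inv_eq_iff_eq, hg, mul_inv_cancel_left]
    simpa using this 1
  let A : Set (ArtinGroup M × {u // Valid M Y u}) :=
    {z | z.1 ∈ StandardParabolic M (X ∩ Y) ∧ ∀ v, ∀ y ∉ X, z.2.1 v y = v y}
  have hA : ∀ z ∈ A, act g z ∈ A ∧ act g⁻¹ z ∈ A := by
    refine standardParabolic_induction
      (p := fun g => ∀ z ∈ A, act g z ∈ A ∧ act g⁻¹ z ∈ A) ?_ ?_ ?_ ?_ hX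
    · rintro a ha ⟨k, u⟩ ⟨hk, hu⟩
      rw [map_inv, hact, cocycleAct_gen]
      change cocycleStep hsymm h2 (gen M) Y a (k, u) ∈ A ∧
        cocycleStepInv hsymm h2 (gen M) Y a (k, u) ∈ A
      by_cases h : ∃ t ∈ Y, u.1 (root t) = root a
      · obtain ⟨t, ht, h⟩ := h
        have htX : t ∈ X := by
          by_contra htX
          have := hu (root t) t htX
          have hat : a ≠ t := fun e => htX (e ▸ ha)
          simp only at this
          rw [h] at this
          simp [root, hat] at this
        have htm : gen M t ∈ StandardParabolic M (X ∩ Y) := gen_mem ⟨htX, ht⟩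
        rw [(cocycleStep_loop hsymm h2 (gen M) ht h).1, (cocycleStep_loop hsymm h2 (gen M) ht h).2]
        exact ⟨⟨mul_mem htm hk, hu⟩, mul_mem (inv_mem htm) hk, hu⟩
      · push Not at h
        obtain ⟨u', e1, e2, e3⟩ := cocycleStep_move hsymm h2 (gen M) (k := k) h
        have : (k, u') ∈ A := ⟨hk, fun v y hy => by
          have hya : y ≠ a := fun e => hy (e ▸ ha)
          change u'.1 v y = v y
          rw [e1, LinearEquiv.mul_apply, refl_apply_of_ne M hya]
          exact hu v y hy⟩
        rw [e2, e3]
        exact ⟨this, this⟩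
    · simp
    · intro g h hg hh z hz
      rw [mul_inv_rev, map_mul, map_mul]
      exact ⟨(hg _ (hh z hz).1).1, (hh _ (hg z hz).2).2⟩
    · intro g hg z hz
      rw [inv_inv]
      exact (hg z hz).symm
  have := (hA (1, ⟨1, valid_one Y⟩) ⟨one_mem _, fun v y _ => rfl⟩).1
  rw [h1] at this
  exact this.1

end Parabolic

section Plane
open Matrix

/-- The unipotent matrix representing a generator of a dihedral Artin group. -/
def planeA (c : ℝ) : Matrix (Fin 2) (Fin 2) ℝ := !![1, c; 0, 1]

/-- The rotation exchanging the two generators of a dihedral Artin group. -/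
def planeR : Matrix (Fin 2) (Fin 2) ℝ := !![0, -1; 1, 0]

/-- The change of basis attached to a generator. -/
def planeBase : Bool → Matrix (Fin 2) (Fin 2) ℝ
  | false => 1
  | true => planeR

/-- The underlying matrix. -/
def toMat : SpecialLinearGroup (Fin 2) ℝ →* Matrix (Fin 2) (Fin 2) ℝ where
  toFun g := g.1
  map_one' := rfl
  map_mul' _ _ := rfl

theorem toMat_injective : Function.Injective toMat := Subtype.val_injective

/-- The images of the two generators of a dihedral Artin group. -/
def planeRep (c : ℝ) : Bool → Matrix.SpecialLinearGroup (Fin 2) ℝ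
  | false => ⟨!![1, c; 0, 1], by simp⟩
  | true => ⟨!![1, 0; -c, 1], by simp⟩

theorem toMat_planeRep_false (c : ℝ) : toMat (planeRep c false) = !![1, c; 0, 1] := rfl

theorem toMat_planeRep_true (c : ℝ) : toMat (planeRep c true) = !![1, 0; -c, 1] := rfl

/-- The matrix of an alternating word. -/
noncomputable def planeRun (c : ℝ) (l : ℕ) : Matrix (Fin 2) (Fin 2) ℝ :=
  !![cheb c (l + 1), cheb c (l + 2); cheb c l, cheb c (l + 1)]

theorem planeR_sq : planeR * planeR = -1 := by
  ext i j
  fin_cases i <;> fin_cases j <;> simp [planeR, Matrix.mul_apply, Fin.sum_univ_two]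

theorem planeRep_mul_same (c : ℝ) (x : Bool) :
    toMat (planeRep c x) * planeBase x = planeBase x * planeA c := by
  cases x <;> ext i j <;> fin_cases i <;> fin_cases j <;>
    simp [toMat_planeRep_false, toMat_planeRep_true, planeBase, planeA, planeR, Matrix.mul_apply, Fin.sum_univ_two]

theorem planeRep_mul_not (c : ℝ) (x : Bool) : ∃ ε : ℝ, (ε = 1 ∨ ε = -1) ∧
    toMat (planeRep c x) * planeBase (!x) =
      ε • (planeBase x * (planeA c * planeR)) := by
  cases x
  · refine ⟨1, Or.inl rfl, ?_⟩
    ext i j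
    fin_cases i <;> fin_cases j <;>
    simp [toMat_planeRep_false, planeBase, planeA, planeR, Matrix.mul_apply, Fin.sum_univ_two]
  · refine ⟨-1, Or.inr rfl, ?_⟩
    ext i j
    fin_cases i <;> fin_cases j <;>
    simp [toMat_planeRep_true, planeBase, planeA, planeR, Matrix.mul_apply, Fin.sum_univ_two]

theorem planeRun_succ (c : ℝ) (l : ℕ) :
    planeA c * planeR * planeRun c l = planeRun c (l + 1) := by
  ext i j
  fin_cases i <;> fin_cases j <;>
    simp [planeRun, planeA, planeR, Matrix.mul_apply, Fin.sum_univ_two, cheb] <;> ring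

theorem planeRun_zero (c : ℝ) : planeRun c 0 = planeA c := by
  simp [planeRun, planeA, cheb]

theorem altProd_planeRep (c : ℝ) (x : Bool) (l : ℕ) : ∃ ε : ℝ, (ε = 1 ∨ ε = -1) ∧
    toMat (altProd (planeRep c) x (!x) (l + 1)) *
      planeBase (altNth x (!x) l) = ε • (planeBase x * planeRun c l) := by
  induction l generalizing x with
  | zero =>
    refine ⟨1, Or.inl rfl, ?_⟩
    rw [altProd, altProd, altNth, mul_one, planeRep_mul_same, planeRun_zero, one_smul]
  | succ l ih =>
    obtain ⟨ε, h1, h2⟩ := ih (!x)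
    obtain ⟨δ, h3, h4⟩ := planeRep_mul_not c x
    rw [Bool.not_not] at h2
    refine ⟨ε * δ, by rcases h1 with rfl | rfl <;> rcases h3 with rfl | rfl <;> simp, ?_⟩
    rw [altProd, altNth, map_mul, mul_assoc, h2, mul_smul_comm, ← mul_assoc, h4,
      smul_mul_assoc, smul_smul, mul_assoc, planeRun_succ]

theorem planeR_mul_planeRep (c : ℝ) (x : Bool) :
    planeR * toMat (planeRep c x) = toMat (planeRep c (!x)) * planeR := by
  cases x <;> ext i j <;> fin_cases i <;> fin_cases j <;>
    simp [toMat_planeRep_false, toMat_planeRep_true, planeR, Matrix.mul_apply, Fin.sum_univ_two]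

theorem planeR_mul_altProd (c : ℝ) (x : Bool) (l : ℕ) :
    planeR * toMat (altProd (planeRep c) x (!x) l) =
      toMat (altProd (planeRep c) (!x) x l) * planeR := by
  induction l generalizing x with
  | zero => simp [altProd]
  | succ l ih =>
    have := ih (!x)
    rw [Bool.not_not] at this
    rw [altProd, altProd, map_mul, map_mul, ← mul_assoc,
      planeR_mul_planeRep, mul_assoc, this, mul_assoc]

/-- The matrix is one of the four powers of `planeR`. -/
def IsTurn (Q : Matrix (Fin 2) (Fin 2) ℝ) : Prop :=
  ∃ ε : ℝ, (ε = 1 ∨ ε = -1) ∧ (Q = ε • 1 ∨ Q = ε • planeR)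

theorem IsTurn.mul {P Q : Matrix (Fin 2) (Fin 2) ℝ} (hP : IsTurn P) (hQ : IsTurn Q) :
    IsTurn (P * Q) := by
  obtain ⟨ε, hε, hP⟩ := hP
  obtain ⟨δ, hδ, hQ⟩ := hQ
  have h1 : ε * δ = 1 ∨ ε * δ = -1 := by
    rcases hε with rfl | rfl <;> rcases hδ with rfl | rfl <;> simp
  have h2 : -(ε * δ) = 1 ∨ -(ε * δ) = -1 := by
    rcases h1 with h | h <;> simp [h]
  rcases hP with rfl | rfl <;> rcases hQ with rfl | rfl
  · exact ⟨ε * δ, h1, Or.inl (by simp [smul_smul, mul_comm])⟩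
  · exact ⟨ε * δ, h1, Or.inr (by simp [smul_smul, mul_comm])⟩
  · exact ⟨ε * δ, h1, Or.inr (by simp [smul_smul, mul_comm])⟩
  · exact ⟨-(ε * δ), h2, Or.inl (by simp [smul_smul, mul_comm, planeR_sq])⟩

theorem IsTurn.neg {P : Matrix (Fin 2) (Fin 2) ℝ} (hP : IsTurn P) : IsTurn (-P) := by
  obtain ⟨ε, hε, hP⟩ := hP
  refine ⟨-ε, by rcases hε with rfl | rfl <;> simp, ?_⟩
  rcases hP with rfl | rfl <;> simp

theorem IsTurn.smul {P : Matrix (Fin 2) (Fin 2) ℝ} (hP : IsTurn P) {ε : ℝ}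
    (h : ε = 1 ∨ ε = -1) : IsTurn (ε • P) := by
  rcases h with rfl | rfl
  · simpa using hP
  · simpa using hP.neg

theorem isTurn_one : IsTurn 1 := ⟨1, Or.inl rfl, Or.inl (by simp)⟩

theorem isTurn_planeR : IsTurn planeR := ⟨1, Or.inl rfl, Or.inr (by simp)⟩

theorem isTurn_planeBase (x : Bool) : IsTurn (planeBase x) := by
  cases x
  exacts [isTurn_one, isTurn_planeR]

theorem IsTurn.exists_inv {P : Matrix (Fin 2) (Fin 2) ℝ} (hP : IsTurn P) :
    ∃ Q, IsTurn Q ∧ Q * P = 1 ∧ P * Q = 1 := by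
  obtain ⟨ε, hε, hP⟩ := hP
  have hε' : ε * ε = 1 := by rcases hε with rfl | rfl <;> simp
  rcases hP with rfl | rfl
  · exact ⟨ε • 1, ⟨ε, hε, Or.inl rfl⟩, by simp [smul_smul, hε'], by simp [smul_smul, hε']⟩
  · exact ⟨-(ε • planeR), IsTurn.neg ⟨ε, hε, Or.inr rfl⟩, by simp [smul_smul, hε', planeR_sq],
      by simp [smul_smul, hε', planeR_sq]⟩

theorem IsTurn.of_mul {P Q N : Matrix (Fin 2) (Fin 2) ℝ} (hP : IsTurn P) (hQ : IsTurn Q)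
    (h : IsTurn (P * N * Q)) : IsTurn N := by
  obtain ⟨P', h1, h2, -⟩ := hP.exists_inv
  obtain ⟨Q', h3, -, h4⟩ := hQ.exists_inv
  have : N = P' * (P * N * Q) * Q' := by
    rw [mul_assoc, mul_assoc, mul_assoc, h4, mul_one, ← mul_assoc, h2, one_mul]
  rw [this]
  exact (h1.mul h).mul h3

theorem isTurn_altProd {m : ℕ} (hm : 2 ≤ m) (x : Bool) :
    IsTurn (toMat (altProd (planeRep (coxCos m)) x (!x) m)) := by
  obtain ⟨l, rfl⟩ : ∃ l, m = l + 1 := ⟨m - 1, by omega⟩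
  obtain ⟨ε, h1, h2⟩ := altProd_planeRep (coxCos (l + 1 : ℕ)) x l
  have hR : planeRun (coxCos (l + 1 : ℕ)) l = planeR := by
    have e1 := cheb_self hm
    have e2 := cheb_pred hm
    simp only [planeRun, planeR, cheb, e1, e2]
    simp
  rw [hR] at h2
  obtain ⟨Q, h3, -, h4⟩ := (isTurn_planeBase (altNth x (!x) l)).exists_inv
  have := congrArg (· * Q) h2
  simp only [mul_assoc, h4, mul_one] at this
  rw [this]
  exact (((isTurn_planeBase x).mul isTurn_planeR).smul h1 |>.mul h3)

theorem planeRep_braid {m : ℕ} (hm : 2 ≤ m) (x : Bool) :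
    altProd (planeRep (coxCos m)) x (!x) m = altProd (planeRep (coxCos m)) (!x) x m := by
  apply toMat_injective
  have h1 := planeR_mul_altProd (coxCos m) x m
  have h2 : planeR * toMat (altProd (planeRep (coxCos m)) x (!x) m) =
      toMat (altProd (planeRep (coxCos m)) x (!x) m) * planeR := by
    obtain ⟨ε, -, h | h⟩ := isTurn_altProd hm x <;> rw [h] <;> simp
  have h3 := congrArg (· * (-planeR)) (h2.symm.trans h1)
  simpa [mul_assoc, planeR_sq] using h3

/-- Nonnegative matrices that are positive and nontrivial enough not to be turns. -/
def Spread (N : Matrix (Fin 2) (Fin 2) ℝ) : Prop :=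
  0 < N 0 0 ∧ 0 < N 1 1 ∧ 0 ≤ N 0 1 ∧ 0 ≤ N 1 0 ∧ 0 < N 0 1 + N 1 0

theorem Spread.mul {N P : Matrix (Fin 2) (Fin 2) ℝ} (hN : Spread N) (hP : Spread P) :
    Spread (N * P) := by
  obtain ⟨h1, h2, h3, h4, h5⟩ := hN
  obtain ⟨k1, k2, k3, k4, k5⟩ := hP
  have e1 := mul_pos h1 k1
  have e2 := mul_pos h2 k2
  have e3 := mul_nonneg h3 k4
  have e4 := mul_nonneg h4 k3
  have e5 := mul_nonneg h1.le k3
  have e6 := mul_nonneg h3 k2.le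
  have e7 := mul_nonneg h4 k1.le
  have e8 := mul_nonneg h2.le k4
  simp only [Spread, Matrix.mul_apply, Fin.sum_univ_two]
  refine ⟨by linarith, by linarith, by linarith, by linarith, ?_⟩
  rcases h3.eq_or_lt with h | h
  · have : 0 < N 1 0 := by linarith
    have := mul_pos this k1
    linarith
  · have := mul_pos h k2
    linarith

theorem Spread.not_isTurn {N : Matrix (Fin 2) (Fin 2) ℝ} (hN : Spread N) : ¬ IsTurn N := by
  rintro ⟨ε, -, rfl | rfl⟩
  · have := hN.2.2.2.2
    simp at this
  · have := hN.1
    simp [planeR] at this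

theorem spread_planeRun {m : ℕ∞} (hm3 : 3 ≤ m) {l : ℕ} (hl : ((l + 1 : ℕ) : ℕ∞) < m) :
    Spread (planeRun (coxCos m) l) := by
  have hm : 2 ≤ m := le_trans (by norm_num) hm3
  have h1 := cheb_pos hm (Nat.succ_pos l) hl
  have h2 : 0 ≤ cheb (coxCos m) (l + 2) := cheb_nonneg hm (by
    have := Order.add_one_le_of_lt hl
    exact_mod_cast this)
  have h3 : 0 ≤ cheb (coxCos m) l := cheb_nonneg hm (le_trans (by exact_mod_cast l.le_succ) hl.le)
  refine ⟨by simpa [planeRun] using h1, by simpa [planeRun] using h1, by simpa [planeRun] using h2,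
    by simpa [planeRun] using h3, ?_⟩
  simp only [planeRun, of_apply, cons_val', cons_val_zero, cons_val_one, cons_val_fin_one]
  rcases Nat.eq_zero_or_pos l with rfl | hl0
  · simpa [cheb] using coxCos_pos hm3
  · have := cheb_pos hm hl0 (lt_of_le_of_lt (by exact_mod_cast l.le_succ) hl)
    linarith

end Plane

section Dihedral
variable {G : Type*} [Group G] (g : Bool → G) (m : ℕ)

/-- Products of alternating words of length less than `m`, with matching letters at the
junctions. -/
inductive DeltaFree : Bool → G → Prop
  | single (x : Bool) (l : ℕ) (h : l + 1 < m) : DeltaFree x (altProd g x (!x) (l + 1))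
  | cons (x : Bool) (l : ℕ) (h : l + 1 < m) (z : G) (hz : DeltaFree (altNth x (!x) l) z) :
      DeltaFree x (altProd g x (!x) (l + 1) * z)

variable {g m}

theorem DeltaFree.exists_spread (hm : 3 ≤ m) {φ : G →* Matrix.SpecialLinearGroup (Fin 2) ℝ}
    (hφ : ∀ x, φ (g x) = planeRep (coxCos m) x) {x : Bool} {z : G} (hz : DeltaFree g m x z) :
    ∃ ε : ℝ, (ε = 1 ∨ ε = -1) ∧ ∃ j N, Spread N ∧
      toMat (φ z) * planeBase j = ε • (planeBase x * N) := by
  have hφ' : (fun x => φ (g x)) = planeRep (coxCos m) := funext hφ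
  have hm3 : (3 : ℕ∞) ≤ m := by exact_mod_cast hm
  induction hz with
  | single x l h =>
    obtain ⟨ε, h1, h2⟩ := altProd_planeRep (coxCos m) x l
    rw [map_altProd, hφ']
    exact ⟨ε, h1, _, _, spread_planeRun hm3 (by exact_mod_cast h), h2⟩
  | cons x l h z hz ih =>
    obtain ⟨ε, h1, h2⟩ := altProd_planeRep (coxCos m) x l
    obtain ⟨δ, h3, j, N, h4, h5⟩ := ih
    refine ⟨δ * ε, by rcases h1 with rfl | rfl <;> rcases h3 with rfl | rfl <;> simp, j,
      planeRun (coxCos m) l * N, (spread_planeRun hm3 (by exact_mod_cast h)).mul h4, ?_⟩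
    rw [map_mul, map_altProd, hφ', map_mul, mul_assoc, h5, mul_smul_comm, ← mul_assoc, h2,
      smul_mul_assoc, smul_smul, mul_assoc]

theorem DeltaFree.not_isTurn (hm : 3 ≤ m) {φ : G →* Matrix.SpecialLinearGroup (Fin 2) ℝ}
    (hφ : ∀ x, φ (g x) = planeRep (coxCos m) x) {x : Bool} {z : G} (hz : DeltaFree g m x z) :
    ¬ IsTurn (toMat (φ z)) := by
  obtain ⟨ε, h1, j, N, h2, h3⟩ := hz.exists_spread hm hφ
  intro h
  have h4 := h.mul (isTurn_planeBase j)
  rw [h3, ← smul_mul_assoc] at h4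
  exact h2.not_isTurn (((isTurn_planeBase x).smul h1).of_mul isTurn_one (by rwa [mul_one]))

theorem DeltaFree.mul (hm : 2 ≤ m) {x : Bool} {z : G} (hz : DeltaFree g m x z) (y : Bool) :
    DeltaFree g m y (g y * z) ∨ ∃ z', (z' = 1 ∨ ∃ x', DeltaFree g m x' z') ∧
      g y * z = altProd g y (!y) m * z' := by
  by_cases hxy : x = y
  · subst hxy
    left
    have := DeltaFree.cons (g := g) (m := m) x 0 (by omega) z hz
    simpa [altProd] using this
  obtain rfl : x = !y := by cases x <;> cases y <;> simp_all
  generalize hx : (!y) = x at hz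
  cases hz with
  | single _ l h =>
    subst hx
    rw [Bool.not_not, show g y * altProd g (!y) y (l + 1) = altProd g y (!y) (l + 1 + 1) from rfl]
    rcases (Nat.succ_le_of_lt h).lt_or_eq with h' | h'
    · exact Or.inl (.single y (l + 1) h')
    · exact Or.inr ⟨1, Or.inl rfl, by rw [mul_one, ← h']⟩
  | cons _ l h w hw =>
    subst hx
    rw [Bool.not_not] at hw ⊢
    rw [← mul_assoc, show g y * altProd g (!y) y (l + 1) = altProd g y (!y) (l + 1 + 1) from rfl]
    rcases (Nat.succ_le_of_lt h).lt_or_eq with h' | h'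
    · exact Or.inl (.cons y (l + 1) h' w hw)
    · exact Or.inr ⟨w, Or.inr ⟨_, hw⟩, by rw [← h']⟩

theorem altNth_bool (x : Bool) (n : ℕ) :
    altNth x (!x) n = if n % 2 = 0 then x else !x := by
  obtain ⟨k, h | h⟩ := n.even_or_odd' <;> subst h
  · rw [(altNth_even _ _ k).1, if_pos (by omega)]
  · rw [(altNth_even _ _ k).2, if_neg (by omega)]

/-- Normal forms in a dihedral Artin group. -/
theorem exists_deltaFree (hm : 2 ≤ m) {D : G} (hD : ∀ x, altProd g x (!x) m = D) {h : G}
    (hh : h ∈ Subgroup.closure (Set.range g)) :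
    ∃ n : ℤ, ∃ z, (z = 1 ∨ ∃ x, DeltaFree g m x z) ∧ h = D ^ n * z := by
  have hswap : ∀ x, g x * D = D * g (if m % 2 = 0 then x else !x) := fun x => by
    rw [← altNth_bool]
    conv_lhs => rw [← hD (!x), Bool.not_not]
    conv_rhs => rw [← hD x]
    rw [← altProd_succ', altProd]
  have hswap' : ∀ x, g x * D⁻¹ = D⁻¹ * g (if m % 2 = 0 then x else !x) := fun x => by
    have := hswap (if m % 2 = 0 then x else !x)
    have e : (if m % 2 = 0 then (if m % 2 = 0 then x else !x) else
        !(if m % 2 = 0 then x else !x)) = x := by split_ifs <;> simp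
    rw [e] at this
    rw [eq_inv_mul_iff_mul_eq, ← mul_assoc, ← this, mul_inv_cancel_right]
  have hpow : ∀ (n : ℤ) x, ∃ y, g x * D ^ n = D ^ n * g y := by
    intro n
    induction n using Int.induction_on with
    | zero => exact fun x => ⟨x, by simp⟩
    | succ n ih =>
      intro x
      obtain ⟨y, hy⟩ := ih x
      exact ⟨_, by rw [zpow_add_one, ← mul_assoc, hy, mul_assoc, hswap, ← mul_assoc]⟩
    | pred n ih =>
      intro x
      obtain ⟨y, hy⟩ := ih x
      exact ⟨_, by rw [zpow_sub_one, ← mul_assoc, hy, mul_assoc, hswap', ← mul_assoc]⟩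
  have hmul : ∀ (x : Bool) (h : G),
      (∃ n : ℤ, ∃ z, (z = 1 ∨ ∃ x, DeltaFree g m x z) ∧ h = D ^ n * z) →
      ∃ n : ℤ, ∃ z, (z = 1 ∨ ∃ x, DeltaFree g m x z) ∧ g x * h = D ^ n * z := by
    rintro x h ⟨n, z, hz, rfl⟩
    obtain ⟨y, hy⟩ := hpow n x
    rw [← mul_assoc, hy, mul_assoc]
    rcases hz with rfl | ⟨x', hz⟩
    · refine ⟨n, _, Or.inr ⟨y, ?_⟩, rfl⟩
      simpa [altProd] using DeltaFree.single (g := g) (m := m) y 0 (by omega)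
    · rcases hz.mul hm y with hz | ⟨z', hz', e⟩
      · exact ⟨n, _, Or.inr ⟨y, hz⟩, rfl⟩
      · exact ⟨n + 1, z', hz', by rw [e, hD, zpow_add_one, mul_assoc]⟩
  induction hh using Subgroup.closure_induction_left with
  | one => exact ⟨0, 1, Or.inl rfl, by simp⟩
  | mul_left x hx y _ ih =>
    obtain ⟨x, rfl⟩ := hx
    exact hmul x y ih
  | inv_mul_cancel x hx y _ ih =>
    obtain ⟨x, rfl⟩ := hx
    have hword : ∀ (k : ℕ) (x y : Bool) (h : G),
      (∃ n : ℤ, ∃ z, (z = 1 ∨ ∃ x, DeltaFree g m x z) ∧ h = D ^ n * z) →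
      ∃ n : ℤ, ∃ z, (z = 1 ∨ ∃ x, DeltaFree g m x z) ∧ altProd g x y k * h = D ^ n * z := by
      intro k
      induction k with
      | zero => exact fun x y h hh => by simpa [altProd] using hh
      | succ k ih =>
        intro x y h hh
        rw [altProd, mul_assoc]
        exact hmul x _ (ih y x h hh)
    obtain ⟨k, rfl⟩ : ∃ k, m = k + 1 := ⟨m - 1, by omega⟩
    obtain ⟨a, ha⟩ : ∃ a, altNth a (!a) k = x := by
      refine ⟨if k % 2 = 0 then x else !x, ?_⟩
      rw [altNth_bool]
      split_ifs <;> simp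
    obtain ⟨n, z, hz, e⟩ := hword k a (!a) y ih
    have hx : (g x)⁻¹ = D⁻¹ * altProd g a (!a) k := by
      rw [eq_inv_mul_iff_mul_eq, ← hD a, altProd_succ', ha, mul_inv_cancel_right]
    refine ⟨n - 1, z, hz, ?_⟩
    rw [hx, mul_assoc, e, ← mul_assoc, sub_eq_add_neg, add_comm, zpow_add, zpow_neg_one]

theorem isTurn_zpow {D : Matrix.SpecialLinearGroup (Fin 2) ℝ} (hD : IsTurn (toMat D)) (n : ℤ) :
    IsTurn (toMat (D ^ n)) := by
  have hinv : IsTurn (toMat D⁻¹) := by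
    refine hD.of_mul isTurn_one ?_
    rw [mul_one, ← map_mul, mul_inv_cancel, map_one]
    exact isTurn_one
  induction n using Int.induction_on with
  | zero => simpa using isTurn_one
  | succ n ih => rw [zpow_add_one, map_mul]; exact ih.mul hD
  | pred n ih => rw [zpow_sub_one, map_mul]; exact ih.mul hinv

/-- The plane representation of a dihedral Artin group is faithful modulo the center. -/
theorem eq_one_of_planeRep (hm : 3 ≤ m) (hg : altProd g false true m = altProd g true false m)
    {φ : G →* Matrix.SpecialLinearGroup (Fin 2) ℝ} (hφ : ∀ x, φ (g x) = planeRep (coxCos m) x)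
    {len : G →* Multiplicative ℤ} (hlen : ∀ x, len (g x) = Multiplicative.ofAdd 1)
    {h : G} (hh : h ∈ Subgroup.closure (Set.range g)) (h1 : φ h = 1) (h2 : len h = 1) : h = 1 := by
  have hD : ∀ x, altProd g x (!x) m = altProd g false true m := fun x => by
    cases x
    exacts [rfl, hg.symm]
  obtain ⟨n, z, hz, rfl⟩ := exists_deltaFree (by omega) hD hh
  have hφ' : (fun x => φ (g x)) = planeRep (coxCos m) := funext hφ
  rcases hz with rfl | ⟨x, hz⟩
  · have hl : ∀ k x y, len (altProd g x y k) = Multiplicative.ofAdd (k : ℤ) := by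
      intro k
      induction k with
      | zero => simp [altProd]
      | succ k ih =>
        intro x y
        rw [altProd, map_mul, hlen, ih, ← ofAdd_add]
        push_cast
        rw [add_comm]
    rw [mul_one, map_zpow, hl, ← ofAdd_zsmul, ofAdd_eq_one, smul_eq_mul, mul_eq_zero] at h2
    rcases h2 with rfl | h2
    · simp
    · omega
  · exfalso
    apply hz.not_isTurn hm hφ
    have hT : IsTurn (toMat (φ (altProd g false true m))) := by
      rw [map_altProd, hφ']
      exact isTurn_altProd (by omega) false
    refine (isTurn_zpow hT n).of_mul isTurn_one ?_
    rw [mul_one, ← map_zpow, ← map_mul, ← map_mul, h1, map_one]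
    exact isTurn_one

end Dihedral


section Free
variable {G : Type*} [Group G] (g : Bool → G)

/-- Alternating products of nontrivial powers. -/
inductive Reduced : Bool → G → Prop
  | single (x : Bool) (i : ℤ) (h : i ≠ 0) : Reduced x (g x ^ i)
  | cons (x : Bool) (i : ℤ) (h : i ≠ 0) (z : G) (hz : Reduced (!x) z) : Reduced x (g x ^ i * z)

variable {g}

theorem planeRep_zpow_mul (c : ℝ) (x : Bool) (i : ℤ) :
    toMat (planeRep c x ^ i) * planeBase x = planeBase x * planeA (i * c) := by
  have hA : ∀ s t, planeA s * planeA t = planeA (s + t) := fun s t => by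
    simp [planeA, add_comm]
  have h0 : planeA 0 = 1 := by
    ext i j
    fin_cases i <;> fin_cases j <;> simp [planeA]
  have hinv : toMat (planeRep c x)⁻¹ * planeBase x = planeBase x * planeA (-c) := by
    have h1 : toMat (planeRep c x)⁻¹ * (toMat (planeRep c x) * planeBase x) * planeA (-c) =
        planeBase x * planeA (-c) := by
      rw [← mul_assoc, ← map_mul, inv_mul_cancel, map_one, one_mul]
    rw [← h1, planeRep_mul_same, mul_assoc, mul_assoc, hA, add_neg_cancel, h0, mul_one]
  induction i using Int.induction_on with
  | zero => simp [h0]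
  | succ n ih =>
    rw [zpow_add_one, map_mul, mul_assoc, planeRep_mul_same, ← mul_assoc, ih, mul_assoc, hA]
    push_cast
    ring_nf
  | pred n ih =>
    rw [zpow_sub_one, map_mul, mul_assoc, hinv, ← mul_assoc, ih, mul_assoc, hA]
    push_cast
    ring_nf

theorem planeRep_false_zpow (c : ℝ) (i : ℤ) :
    toMat (planeRep c false ^ i) = !![1, i * c; 0, 1] := by
  simpa [planeBase, planeA] using planeRep_zpow_mul c false i

theorem planeRep_true_zpow (c : ℝ) (i : ℤ) :
    toMat (planeRep c true ^ i) = !![1, 0; -(i * c), 1] := by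
  have := congrArg (· * (-planeR)) (planeRep_zpow_mul c true i)
  simp only [planeBase, mul_assoc, mul_neg, planeR_sq, neg_neg, mul_one] at this
  rw [this]
  ext i j
  fin_cases i <;> fin_cases j <;> simp [planeA, planeR]

theorem toMat_planeRep_zpow (c : ℝ) (x : Bool) (k : ℤ) :
    toMat (planeRep c x ^ k) = 1 + (k : ℝ) • (toMat (planeRep c x) - 1) := by
  cases x
  · rw [planeRep_false_zpow, toMat_planeRep_false]
    ext i j
    fin_cases i <;> fin_cases j <;> simp
  · rw [planeRep_true_zpow, toMat_planeRep_true]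
    ext i j
    fin_cases i <;> fin_cases j <;> simp

theorem planeBase_not (x : Bool) : ∃ ε : ℝ, (ε = 1 ∨ ε = -1) ∧
    planeBase (!x) = ε • (planeBase x * planeR) := by
  cases x
  · exact ⟨1, Or.inl rfl, by simp [planeBase]⟩
  · exact ⟨-1, Or.inr rfl, by simp [planeBase, planeR_sq]⟩

theorem planeRep_zpow_mul_not (c : ℝ) (x : Bool) (i : ℤ) : ∃ ε : ℝ, (ε = 1 ∨ ε = -1) ∧
    toMat (planeRep c x ^ i) * planeBase (!x) =
      ε • (planeBase x * !![(i : ℝ) * c, -1; 1, 0]) := by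
  obtain ⟨ε, h1, h2⟩ := planeBase_not x
  refine ⟨ε, h1, ?_⟩
  rw [h2, mul_smul_comm, ← mul_assoc, planeRep_zpow_mul, mul_assoc]
  congr 2
  ext i j
  fin_cases i <;> fin_cases j <;> simp [planeA, planeR]

theorem Reduced.exists_steep {φ : G →* Matrix.SpecialLinearGroup (Fin 2) ℝ}
    (hφ : ∀ x, φ (g x) = planeRep 2 x) {x : Bool} {z : G} (hz : Reduced g x z) :
    ∃ ε : ℝ, (ε = 1 ∨ ε = -1) ∧ ∃ j, ∃ N : Matrix (Fin 2) (Fin 2) ℝ,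
      0 < |N 1 0| ∧ |N 1 0| < |N 0 0| ∧
      toMat (φ z) * planeBase j = ε • (planeBase x * N) := by
  have habs : ∀ i : ℤ, i ≠ 0 → (2 : ℝ) ≤ |(i : ℝ) * 2| := fun i hi => by
    have h1 : (1 : ℝ) ≤ |(i : ℝ)| := by exact_mod_cast Int.one_le_abs hi
    rw [abs_mul, abs_two]
    linarith
  induction hz with
  | single x i h =>
    obtain ⟨ε, h1, h2⟩ := planeRep_zpow_mul_not 2 x i
    rw [map_zpow, hφ]
    refine ⟨ε, h1, _, _, ?_, ?_, h2⟩
    · simp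
    · have := habs i h
      simp only [Matrix.of_apply, Matrix.cons_val', Matrix.cons_val_zero, Matrix.cons_val_one,
        Matrix.cons_val_fin_one, abs_one]
      linarith
  | cons x i h z hz ih =>
    obtain ⟨ε, h1, h2⟩ := planeRep_zpow_mul_not 2 x i
    obtain ⟨δ, h3, j, N, h4, h5, h6⟩ := ih
    refine ⟨δ * ε, by rcases h1 with rfl | rfl <;> rcases h3 with rfl | rfl <;> simp, j,
      !![(i : ℝ) * 2, -1; 1, 0] * N, ?_, ?_, ?_⟩
    · simpa [Matrix.mul_apply, Fin.sum_univ_two] using abs_pos.1 (h4.trans h5)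
    · have e1 : (!![(i : ℝ) * 2, -1; 1, 0] * N) 1 0 = N 0 0 := by
        simp [Matrix.mul_apply, Fin.sum_univ_two]
      have e2 : (!![(i : ℝ) * 2, -1; 1, 0] * N) 0 0 = (i : ℝ) * 2 * N 0 0 - N 1 0 := by
        simp [Matrix.mul_apply, Fin.sum_univ_two, sub_eq_add_neg]
      rw [e1, e2]
      have := abs_sub_abs_le_abs_sub ((i : ℝ) * 2 * N 0 0) (N 1 0)
      rw [abs_mul] at this
      have := mul_le_mul_of_nonneg_right (habs i h) (abs_nonneg (N 0 0))
      linarith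
    · rw [map_mul, map_zpow, hφ, map_mul, mul_assoc, h6, mul_smul_comm, ← mul_assoc, h2,
        smul_mul_assoc, smul_smul, mul_assoc]

theorem Reduced.not_isTurn {φ : G →* Matrix.SpecialLinearGroup (Fin 2) ℝ}
    (hφ : ∀ x, φ (g x) = planeRep 2 x) {x : Bool} {z : G} (hz : Reduced g x z) :
    ¬ IsTurn (toMat (φ z)) := by
  obtain ⟨ε, h1, j, N, h2, h3, h4⟩ := hz.exists_steep hφ
  intro h
  have h5 := h.mul (isTurn_planeBase j)
  rw [h4, ← smul_mul_assoc] at h5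
  obtain ⟨δ, -, rfl | rfl⟩ := ((isTurn_planeBase x).smul h1).of_mul (N := N) isTurn_one
    (by rwa [mul_one])
  · simp at h2
  · simp [planeR] at h3
    exact absurd h3 (not_lt.2 (abs_nonneg _))

theorem Reduced.mul {x : Bool} {z : G} (hz : Reduced g x z) (y : Bool) (i : ℤ) :
    g y ^ i * z = 1 ∨ ∃ x', Reduced g x' (g y ^ i * z) := by
  by_cases hi : i = 0
  · exact Or.inr ⟨x, by simpa [hi] using hz⟩
  by_cases hxy : x = y
  · subst hxy
    cases hz with
    | single _ k h =>
      rw [← zpow_add]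
      by_cases hk : i + k = 0
      · exact Or.inl (by simp [hk])
      · exact Or.inr ⟨x, .single x _ hk⟩
    | cons _ k h w hw =>
      rw [← mul_assoc, ← zpow_add]
      by_cases hk : i + k = 0
      · exact Or.inr ⟨_, by simpa [hk] using hw⟩
      · exact Or.inr ⟨x, .cons x _ hk w hw⟩
  · obtain rfl : x = !y := by cases x <;> cases y <;> simp_all
    exact Or.inr ⟨y, .cons y i hi z hz⟩

/-- The plane representation of a free group of rank two is faithful. -/
theorem eq_one_of_planeRep_two {φ : G →* Matrix.SpecialLinearGroup (Fin 2) ℝ}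
    (hφ : ∀ x, φ (g x) = planeRep 2 x)
    {h : G} (hh : h ∈ Subgroup.closure (Set.range g)) (h1 : φ h = 1) : h = 1 := by
  have key : h = 1 ∨ ∃ x, Reduced g x h := by
    have hmul : ∀ (x : Bool) (i : ℤ), i ≠ 0 → ∀ h : G, (h = 1 ∨ ∃ x, Reduced g x h) →
        (g x ^ i * h = 1 ∨ ∃ x', Reduced g x' (g x ^ i * h)) := by
      rintro x i hi h (rfl | ⟨y, hy⟩)
      · exact Or.inr ⟨x, by simpa using Reduced.single x i hi⟩
      · exact hy.mul x i
    clear h1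
    induction hh using Subgroup.closure_induction_left with
    | one => exact Or.inl rfl
    | mul_left x hx y _ ih =>
      obtain ⟨x, rfl⟩ := hx
      simpa using hmul x 1 (by simp) y ih
    | inv_mul_cancel x hx y _ ih =>
      obtain ⟨x, rfl⟩ := hx
      simpa using hmul x (-1) (by simp) y ih
  rcases key with h | ⟨x, hx⟩
  · exact h
  · exact absurd (by rw [h1, map_one]; exact isTurn_one) (hx.not_isTurn hφ)

end Free

section RankTwo
variable {S : Type*} {M : S → S → ℕ∞}

theorem altProd_const {K : Type*} [Monoid K] (c : K) (s t s' t' : S) (m : ℕ) :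
    altProd (fun _ : S => c) s t m = altProd (fun _ : S => c) t' s' m := by
  induction m generalizing s t s' t' with
  | zero => rfl
  | succ m ih => rw [altProd, altProd, ih t s t' s']

/-- The length homomorphism. -/
def lenHom (M : S → S → ℕ∞) : ArtinGroup M →* Multiplicative ℤ :=
  artinLift (fun _ => Multiplicative.ofAdd 1) fun s _ t _ _ m _ =>
    altProd_const _ s t s t m

theorem lenHom_gen (s : S) : lenHom M (gen M s) = Multiplicative.ofAdd 1 := artinLift_gen _ _ _

theorem lenHom_gen_zpow (s : S) (k : ℤ) : lenHom M (gen M s ^ k) = Multiplicative.ofAdd k := by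
  rw [map_zpow, lenHom_gen, ← ofAdd_zsmul]
  simp

/-- A conjugacy between powers of generators preserves the exponents. -/
theorem exponent_eq_of_conj {a b : S} {g : ArtinGroup M} {k l : ℤ}
    (h : g * gen M a ^ k * g⁻¹ = gen M b ^ l) : k = l := by
  have := congrArg (lenHom M) h
  rw [map_mul, map_mul, map_inv, mul_comm, inv_mul_cancel_left, lenHom_gen_zpow,
    lenHom_gen_zpow] at this
  exact Multiplicative.ofAdd.injective this

variable (hsymm : ∀ s t, M s t = M t s) (hlarge : ∀ s t, s ≠ t → 3 ≤ M s t)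
include hsymm hlarge

theorem exists_planeRep {a b : S} (hab : a ≠ b) :
    ∃ φ : StandardParabolic M {a, b} →* Matrix.SpecialLinearGroup (Fin 2) ℝ,
      φ ⟨gen M a, gen_mem (by simp)⟩ = planeRep (coxCos (M a b)) false ∧
      φ ⟨gen M b, gen_mem (by simp)⟩ = planeRep (coxCos (M a b)) true := by
  classical
  have h2 : ∀ s t, s ≠ t → 2 ≤ M s t := fun s t h => le_trans (by norm_num) (hlarge s t h)
  let f : S → Matrix.SpecialLinearGroup (Fin 2) ℝ :=
    fun s => planeRep (coxCos (M a b)) (decide (s ≠ a))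
  have hf : ∀ (m : ℕ) (s t : S), (s = a ∧ t = b) ∨ (s = b ∧ t = a) → altProd f s t m =
      altProd (planeRep (coxCos (M a b))) (decide (s ≠ a)) (decide (t ≠ a)) m := by
    intro m
    induction m with
    | zero => exact fun s t _ => rfl
    | succ m ih =>
      intro s t hst
      rw [altProd, altProd, ih t s (by tauto)]
  have hbr : BraidOn M f {a, b} := by
    intro s hs t ht hst m hm
    have hst' : (s = a ∧ t = b) ∨ (s = b ∧ t = a) := by
      rcases hs with rfl | hs <;> rcases ht with rfl | ht <;>
        simp only [Set.mem_singleton_iff] at * <;> grind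
    have hm' : M a b = m := by
      rcases hst' with ⟨rfl, rfl⟩ | ⟨rfl, rfl⟩
      exacts [hm, hsymm t s ▸ hm]
    have hm2 : 2 ≤ m := by
      have := h2 a b hab
      rw [hm'] at this
      exact_mod_cast this
    rw [hf m s t hst', hf m t s (by tauto), hm']
    rcases hst' with ⟨rfl, rfl⟩ | ⟨rfl, rfl⟩
    · simpa [hst.symm] using planeRep_braid hm2 false
    · simpa [hst] using planeRep_braid hm2 true
  obtain ⟨φ, hφ⟩ := exists_parabolic_hom hsymm h2 hbr
  refine ⟨φ, ?_, ?_⟩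
  · rw [hφ a (by simp)]
    simp [f]
  · rw [hφ b (by simp)]
    simp [f, hab.symm]

theorem girth_rank_two {a b : S} (hab : a ≠ b) {i j k l : ℤ}
    (h : gen M a ^ i * gen M b ^ j * gen M a ^ k * gen M b ^ l = 1) : i = 0 ∨ j = 0 := by
  obtain ⟨φ, h1, h2⟩ := exists_planeRep hsymm hlarge hab
  have hc := coxCos_pos (hlarge a b hab)
  set c := coxCos (M a b)
  have h' : (⟨gen M a, gen_mem (by simp)⟩ : StandardParabolic M {a, b}) ^ i *
      ⟨gen M b, gen_mem (by simp)⟩ ^ j * ⟨gen M a, gen_mem (by simp)⟩ ^ k *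
      ⟨gen M b, gen_mem (by simp)⟩ ^ l = 1 := Subtype.ext (by simpa using h)
  have h3 := congrArg φ h'
  simp only [map_mul, map_zpow, h1, h2, map_one] at h3
  rw [mul_assoc, mul_eq_one_iff_eq_inv, mul_inv_rev, ← zpow_neg, ← zpow_neg] at h3
  have h4 := congrArg toMat h3
  rw [map_mul, map_mul] at h4
  rw [planeRep_false_zpow, planeRep_true_zpow, planeRep_false_zpow, planeRep_true_zpow] at h4
  have h5 := congrFun (congrFun h4 0) 0
  simp [Matrix.mul_apply, Fin.sum_univ_two, hc.ne'] at h5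
  tauto

/-- In rank two, conjugacies between powers of generators are conjugacies between generators. -/
theorem conj_gen_of_conj_zpow {a b : S} (hab : a ≠ b) {s t : S} (hs : s ∈ ({a, b} : Set S))
    (ht : t ∈ ({a, b} : Set S)) {g : ArtinGroup M} (hg : g ∈ StandardParabolic M {a, b}) {k : ℤ}
    (hk : k ≠ 0) (h : g * gen M s ^ k * g⁻¹ = gen M t ^ k) : g * gen M s * g⁻¹ = gen M t := by
  obtain ⟨φ, h1, h2⟩ := exists_planeRep hsymm hlarge hab
  let γ : Bool → StandardParabolic M {a, b} := fun x =>
    cond x ⟨gen M b, gen_mem (by simp)⟩ ⟨gen M a, gen_mem (by simp)⟩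
  have hγ : ∀ x, φ (γ x) = planeRep (coxCos (M a b)) x := fun x => by cases x; exacts [h1, h2]
  have hcl : ∀ z : StandardParabolic M {a, b}, z ∈ Subgroup.closure (Set.range γ) := by
    intro z
    have : (Subgroup.closure (Set.range γ)).map (StandardParabolic M {a, b}).subtype =
        StandardParabolic M {a, b} := by
      rw [MonoidHom.map_closure, ← Set.range_comp]
      change _ = Subgroup.closure (gen M '' {a, b})
      congr 1
      ext y
      constructor
      · rintro ⟨x, rfl⟩
        cases x
        exacts [⟨a, by simp, rfl⟩, ⟨b, by simp, rfl⟩]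
      · rintro ⟨x, rfl | rfl, rfl⟩
        exacts [⟨false, rfl⟩, ⟨true, rfl⟩]
    have hz : (z : ArtinGroup M) ∈
        (Subgroup.closure (Set.range γ)).map (StandardParabolic M {a, b}).subtype := by
      rw [this]; exact z.2
    obtain ⟨w, hw, e⟩ := hz
    rwa [← Subtype.ext e]
  obtain ⟨x, rfl⟩ : ∃ x, s = cond x b a := by
    rcases hs with rfl | rfl
    exacts [⟨false, rfl⟩, ⟨true, rfl⟩]
  obtain ⟨y, rfl⟩ : ∃ y, t = cond y b a := by
    rcases ht with rfl | rfl
    exacts [⟨false, rfl⟩, ⟨true, rfl⟩]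
  have hx : ∀ x, gen M (cond x b a) = γ x := fun x => by cases x <;> rfl
  lift g to StandardParabolic M {a, b} using hg
  rw [hx, hx] at h ⊢
  have h' : g * γ x ^ k * g⁻¹ = γ y ^ k := Subtype.ext (by simpa using h)
  suffices hmain : g * γ x * g⁻¹ * (γ y)⁻¹ = 1 by
    have := congrArg Subtype.val (mul_inv_eq_one.1 hmain)
    simpa using this
  have hρ : φ (g * γ x * g⁻¹ * (γ y)⁻¹) = 1 := by
    have h3 := congrArg (fun z => toMat (φ z)) h'
    have hpow : ∀ x, toMat (φ (γ x) ^ k) = 1 + (k : ℝ) • (toMat (φ (γ x)) - 1) := fun x => by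
      rw [hγ, toMat_planeRep_zpow]
    simp only [map_mul, map_zpow, hpow] at h3
    have hgg : toMat (φ g) * toMat (φ g⁻¹) = 1 := by
      rw [← map_mul, ← map_mul, mul_inv_cancel, map_one, map_one]
    rw [mul_add, add_mul, mul_one, hgg, add_right_inj, mul_smul_comm, smul_mul_assoc,
      mul_sub, sub_mul, mul_one, hgg] at h3
    have h4 := smul_right_injective _ (Int.cast_ne_zero.2 hk : (k : ℝ) ≠ 0) h3
    have h5 := sub_left_injective h4
    rw [map_mul, map_inv φ (γ y), mul_inv_eq_one]
    apply toMat_injective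
    rw [← h5, map_mul, map_mul, map_mul, map_mul]
  have hlen : (lenHom M).comp (StandardParabolic M {a, b}).subtype (g * γ x * g⁻¹ * (γ y)⁻¹) =
      1 := by
    have : ∀ x, (lenHom M).comp (StandardParabolic M {a, b}).subtype (γ x) =
        Multiplicative.ofAdd 1 := fun x => by cases x <;> exact lenHom_gen (M := M) _
    rw [map_mul, map_mul, map_mul, map_inv, map_inv, this, this]
    simp
  cases hm : M a b with
  | top =>
    refine eq_one_of_planeRep_two (g := γ) (φ := φ) (fun x => ?_) (hcl _) hρ
    rw [hγ, hm]
    simp [coxCos]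
  | coe m =>
    have hm3 : 3 ≤ m := by
      have := hlarge a b hab
      rw [hm] at this
      exact_mod_cast this
    refine eq_one_of_planeRep (g := γ) (m := m) hm3 ?_ (φ := φ) (fun x => by rw [hγ, hm])
      (len := (lenHom M).comp (StandardParabolic M {a, b}).subtype)
      (fun x => by cases x <;> exact lenHom_gen (M := M) _) (hcl _) hρ hlen
    apply Subtype.ext
    have e := gen_braid (M := M) {a, b} a (by simp) b (by simp) hab m hm
    have hkey : ∀ (n : ℕ) (x y : Bool), ((altProd γ x y n : StandardParabolic M {a, b}) :
        ArtinGroup M) = altProd (gen M) (cond x b a) (cond y b a) n := by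
      intro n
      induction n with
      | zero => exact fun _ _ => rfl
      | succ n ih =>
        intro x y
        rw [altProd, altProd, ← ih, hx]
        rfl
    rw [hkey, hkey]
    exact e

end RankTwo


section Coset
variable {S G : Type u} [Group G] (P : Set S → Subgroup G)

/-- The vertices of the coset complex of type `T`: cosets of the subgroups of corank one. -/
@[ext]
structure Vtx (T : Set S) where
  /-- The type of a vertex. -/
  ty : S
  /-- The coset of a vertex. -/
  car : Set G
  ty_mem : ty ∈ T
  spec : ∃ g ∈ P T, ∀ h, h ∈ car ↔ g⁻¹ * h ∈ P (T \ {ty})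

/-- The subgroups in the family are compatible with intersections. -/
def InfCompat : Prop := ∀ X Y, P X ⊓ P Y = P (X ∩ Y)

variable {P} {T : Set S}

theorem InfCompat.mono (hP : InfCompat P) {X Y : Set S} (h : X ⊆ Y) : P X ≤ P Y := by
  have := hP X Y
  rw [Set.inter_eq_left.2 h] at this
  exact inf_eq_left.1 this

namespace Vtx

theorem mem_iff {v : Vtx P T} {g h : G} (hg : g ∈ v.car) :
    h ∈ v.car ↔ g⁻¹ * h ∈ P (T \ {v.ty}) := by
  obtain ⟨k, -, hk⟩ := v.spec
  rw [hk] at hg ⊢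
  rw [show g⁻¹ * h = (k⁻¹ * g)⁻¹ * (k⁻¹ * h) by group]
  exact (Subgroup.mul_mem_cancel_left _ (inv_mem hg)).symm

theorem exists_mem (v : Vtx P T) : ∃ g, g ∈ v.car := by
  obtain ⟨k, -, hk⟩ := v.spec
  exact ⟨k, (hk k).2 (by simp [one_mem])⟩

theorem mem_of_mem (hP : InfCompat P) {v : Vtx P T} {g : G} (hg : g ∈ v.car) : g ∈ P T := by
  obtain ⟨k, h1, hk⟩ := v.spec
  exact (Subgroup.mul_mem_cancel_left _ (inv_mem h1)).1
    (hP.mono Set.sdiff_subset ((hk g).1 hg))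

theorem eq_of_mem {v w : Vtx P T} (h : v.ty = w.ty) {g : G} (hv : g ∈ v.car) (hw : g ∈ w.car) :
    v = w := by
  refine Vtx.ext h (Set.ext fun k => ?_)
  rw [mem_iff hv, mem_iff hw, h]

variable (P) in
/-- The vertex of type `s` of the chamber `g`. -/
def mk' (s : T) (g : P T) : Vtx P T where
  ty := s
  car := {h | (g : G)⁻¹ * h ∈ P (T \ {s.1})}
  ty_mem := s.2
  spec := ⟨g, g.2, fun _ => Iff.rfl⟩

theorem mem_mk' (s : T) (g : P T) : (g : G) ∈ (mk' P s g).car := by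
  simp [mk', one_mem]

theorem mk'_eq {v : Vtx P T} {s : T} (h : v.ty = s) {g : P T} (hg : (g : G) ∈ v.car) :
    mk' P s g = v :=
  eq_of_mem h.symm (mem_mk' s g) hg

end Vtx

variable (P T) in
/-- The coset complex of type `T`. -/
def cosetComplex : TriComplex (Vtx P T) where
  Adj v w := v.ty ≠ w.ty ∧ ∃ g, g ∈ v.car ∧ g ∈ w.car
  Tri v w x := v.ty ≠ w.ty ∧ w.ty ≠ x.ty ∧ v.ty ≠ x.ty ∧ ∃ g, g ∈ v.car ∧ g ∈ w.car ∧ g ∈ x.car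
  adj_symm := by
    rintro v w ⟨h, g, h1, h2⟩
    exact ⟨h.symm, g, h2, h1⟩
  adj_ne := by
    rintro v w ⟨h, -⟩ rfl
    exact h rfl
  tri_swap := by
    rintro v w x ⟨h1, h2, h3, g, h4, h5, h6⟩
    exact ⟨h1.symm, h3, h2, g, h5, h4, h6⟩
  tri_rot := by
    rintro v w x ⟨h1, h2, h3, g, h4, h5, h6⟩
    exact ⟨h2, h3.symm, h1.symm, g, h5, h6, h4⟩
  tri_adj := by
    rintro v w x ⟨h1, -, -, g, h4, h5, -⟩
    exact ⟨h1, g, h4, h5⟩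

section Link
variable (hP : InfCompat P) {v : Vtx P T} {g : G} (hg : g ∈ v.car)

/-- The identification of the link of a vertex with a coset complex of smaller rank. -/
def linkVtx (x : Vtx P T) (hx : (cosetComplex P T).Adj v x) : Vtx P (T \ {v.ty}) where
  ty := x.ty
  car := {h | g * h ∈ v.car ∧ g * h ∈ x.car}
  ty_mem := ⟨x.ty_mem, fun e => hx.1 e.symm⟩
  spec := by
    obtain ⟨hne, k, hk, hk'⟩ := hx
    refine ⟨g⁻¹ * k, (Vtx.mem_iff hg).1 hk, fun h => ?_⟩
    rw [Set.mem_ofPred_eq, Vtx.mem_iff hk, Vtx.mem_iff hk', ← Subgroup.mem_inf, hP,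
      Set.sdiff_inter_sdiff, ← Set.sdiff_sdiff]
    simp [mul_assoc]

theorem linkVtx_injective {x y : Vtx P T} (hx : (cosetComplex P T).Adj v x)
    (hy : (cosetComplex P T).Adj v y) (h : linkVtx hP hg x hx = linkVtx hP hg y hy) : x = y := by
  obtain ⟨k, hk⟩ := (linkVtx hP hg x hx).exists_mem
  have hk' := hk
  rw [h] at hk'
  have e := congrArg Vtx.ty h
  exact Vtx.eq_of_mem e hk.2 hk'.2

theorem linkVtx_adj_iff {x y : Vtx P T} (hx : (cosetComplex P T).Adj v x)
    (hy : (cosetComplex P T).Adj v y) :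
    (cosetComplex P _).Adj (linkVtx hP hg x hx) (linkVtx hP hg y hy) ↔
      (cosetComplex P T).Tri v x y := by
  constructor
  · rintro ⟨h, k, h1, h2⟩
    exact ⟨hx.1, h, hy.1, g * k, h1.1, h1.2, h2.2⟩
  · rintro ⟨-, h, -, k, h1, h2, h3⟩
    refine ⟨h, g⁻¹ * k, ?_, ?_⟩ <;> simp [linkVtx, *]

theorem tri_of_linkVtx_tri {x y z : Vtx P T} (hx : (cosetComplex P T).Adj v x)
    (hy : (cosetComplex P T).Adj v y) (hz : (cosetComplex P T).Adj v z)
    (h : (cosetComplex P _).Tri (linkVtx hP hg x hx) (linkVtx hP hg y hy)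
      (linkVtx hP hg z hz)) : (cosetComplex P T).Tri x y z := by
  obtain ⟨h1, h2, h3, k, h4, h5, h6⟩ := h
  exact ⟨h1, h2, h3, g * k, h4.2, h5.2, h6.2⟩

end Link

/-- Largeness of the complexes of smaller rank gives local largeness. -/
theorem locallyLarge_cosetComplex (hP : InfCompat P)
    (h : ∀ s ∈ T, (cosetComplex P (T \ {s})).Large) : (cosetComplex P T).LocallyLarge := by
  have adj₂ : ∀ {v x y}, (cosetComplex P T).Tri v x y → (cosetComplex P T).Adj v y :=
    fun h => (cosetComplex P T).adj_symm ((cosetComplex P T).tri_adj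
      ((cosetComplex P T).tri_rot ((cosetComplex P T).tri_rot h)))
  have adj₁ : ∀ {v x y}, (cosetComplex P T).Tri v x y → (cosetComplex P T).Adj v x :=
    fun h => (cosetComplex P T).tri_adj h
  constructor
  · intro v x y z h1 h2 h3
    obtain ⟨g, hg⟩ := v.exists_mem
    have L := h v.ty v.ty_mem
    have hx := adj₁ h1
    have hy := adj₁ h2
    have hz := adj₂ h2
    rw [← linkVtx_adj_iff hP hg hx hy] at h1
    rw [← linkVtx_adj_iff hP hg hy hz] at h2
    rw [← linkVtx_adj_iff hP hg hx hz] at h3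
    exact tri_of_linkVtx_tri hP hg hx hy hz (L.flag h1 h2 h3)
  · intro v a b c d h1 h2 h3 h4
    obtain ⟨g, hg⟩ := v.exists_mem
    have L := h v.ty v.ty_mem
    have ha := adj₁ h1
    have hb := adj₁ h2
    have hc := adj₁ h3
    have hd := adj₁ h4
    rw [← linkVtx_adj_iff hP hg ha hb] at h1
    rw [← linkVtx_adj_iff hP hg hb hc] at h2
    rw [← linkVtx_adj_iff hP hg hc hd] at h3
    rw [← linkVtx_adj_iff hP hg hd ha] at h4
    rw [← linkVtx_adj_iff hP hg ha hc, ← linkVtx_adj_iff hP hg hb hd]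
    exact (L.four h1 h2 h3 h4).imp (linkVtx_injective hP hg _ _)
      (Or.imp_left (linkVtx_injective hP hg _ _))
  · intro v a b c d f h1 h2 h3 h4 h5
    obtain ⟨g, hg⟩ := v.exists_mem
    have L := h v.ty v.ty_mem
    have ha := adj₁ h1
    have hb := adj₁ h2
    have hc := adj₁ h3
    have hd := adj₁ h4
    have hf := adj₁ h5
    rw [← linkVtx_adj_iff hP hg ha hb] at h1
    rw [← linkVtx_adj_iff hP hg hb hc] at h2
    rw [← linkVtx_adj_iff hP hg hc hd] at h3
    rw [← linkVtx_adj_iff hP hg hd hf] at h4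
    rw [← linkVtx_adj_iff hP hg hf ha] at h5
    rw [← linkVtx_adj_iff hP hg ha hc, ← linkVtx_adj_iff hP hg hb hd,
      ← linkVtx_adj_iff hP hg hc hf, ← linkVtx_adj_iff hP hg hd ha, ← linkVtx_adj_iff hP hg hf hb]
    exact L.five h1 h2 h3 h4 h5

/-- A coset complex of rank two without short cycles is large. -/
theorem large_cosetComplex_pair {a b : S}
    (h : ∀ s t, ({s, t} : Set S) = {a, b} → s ≠ t → ∀ x ∈ P {s}, ∀ y ∈ P {t}, ∀ z ∈ P {s},
      ∀ w ∈ P {t}, x * y * z * w = 1 → x = 1 ∨ y = 1) : (cosetComplex P {a, b}).Large := by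
  have hty : ∀ v : Vtx P {a, b}, v.ty = a ∨ v.ty = b := fun v => v.ty_mem
  constructor
  · intro x y z h1 h2 h3
    have := h1.1
    have := h2.1
    have := h3.1
    grind
  · intro v₁ v₂ v₃ v₄ h1 h2 h3 h4
    obtain ⟨n1, g₁, a1, b1⟩ := h1
    obtain ⟨n2, g₂, a2, b2⟩ := h2
    obtain ⟨n3, g₃, a3, b3⟩ := h3
    obtain ⟨n4, g₄, a4, b4⟩ := h4
    have e13 : v₁.ty = v₃.ty := by grind
    have e24 : v₂.ty = v₄.ty := by grind
    have hd1 : ({a, b} : Set S) \ {v₁.ty} = {v₂.ty} := by ext x; simp; grind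
    have hd2 : ({a, b} : Set S) \ {v₂.ty} = {v₁.ty} := by ext x; simp; grind
    have m1 := (Vtx.mem_iff b1).1 a2
    have m2 := (Vtx.mem_iff b2).1 a3
    have m3 := (Vtx.mem_iff b3).1 a4
    have m4 := (Vtx.mem_iff b4).1 a1
    rw [hd2] at m1
    rw [← e13, hd1] at m2
    rw [← e24, hd2] at m3
    rw [hd1] at m4
    rcases h _ _ (by ext x; simp; grind) n1 _ m1 _ m2 _ m3 _ m4 (by group) with e | e
    · rw [inv_mul_eq_one] at e
      exact Or.inl (Vtx.eq_of_mem e13 a1 (e ▸ b2))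
    · rw [inv_mul_eq_one] at e
      exact Or.inr (Or.inl (Vtx.eq_of_mem e24 a2 (e ▸ b3)))
  · intro v₁ v₂ v₃ v₄ v₅ h1 h2 h3 h4 h5
    have := h1.1
    have := h2.1
    have := h3.1
    have := h4.1
    have := h5.1
    grind

end Coset


section Cover
variable {S : Type u} {M : S → S → ℕ∞} {T : Set S}
  {N : Type u} {e : N → Vtx (StandardParabolic M) T}
  {tr : N → Vtx (StandardParabolic M) T → N}

variable (e tr) in
/-- The chambers of a covering of the coset complex. -/
structure Chamber where
  /-- The image of a chamber. -/
  g : StandardParabolic M T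
  /-- The vertices of a chamber. -/
  f : T → N
  e_f : ∀ s, e (f s) = Vtx.mk' _ s g
  tr_f : ∀ s t, s ≠ t → tr (f s) (Vtx.mk' _ t g) = f t

theorem Chamber.ext' {z z' : Chamber e tr} (h : z.g = z'.g) {s : T} (hs : z.f s = z'.f s) :
    z = z' := by
  have hf : z.f = z'.f := by
    ext t
    by_cases hst : s = t
    · rw [← hst, hs]
    · rw [← z.tr_f s t hst, ← z'.tr_f s t hst, hs, h]
  cases z
  cases z'
  cases h
  cases hf
  rfl

variable (h1 : ∀ p w, (cosetComplex (StandardParabolic M) T).Adj (e p) w →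
    e (tr p w) = w ∧ tr (tr p w) (e p) = p)
  (h2 : ∀ p w x, (cosetComplex (StandardParabolic M) T).Tri (e p) w x → tr (tr p w) x = tr p x)

theorem adj_mk' {s t : T} (hst : s ≠ t) (g : StandardParabolic M T) :
    (cosetComplex (StandardParabolic M) T).Adj (Vtx.mk' _ s g) (Vtx.mk' _ t g) :=
  ⟨fun h => hst (Subtype.ext h), g, Vtx.mem_mk' _ _, Vtx.mem_mk' _ _⟩

theorem tri_mk' {s t r : T} (hst : s ≠ t) (htr : t ≠ r) (hsr : s ≠ r)
    (g : StandardParabolic M T) :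
    (cosetComplex (StandardParabolic M) T).Tri (Vtx.mk' _ s g) (Vtx.mk' _ t g)
      (Vtx.mk' _ r g) :=
  ⟨fun h => hst (Subtype.ext h), fun h => htr (Subtype.ext h), fun h => hsr (Subtype.ext h), g,
    Vtx.mem_mk' _ _, Vtx.mem_mk' _ _, Vtx.mem_mk' _ _⟩

include h1 h2 in
theorem exists_chamber {s : T} {p : N} (g : StandardParabolic M T) (hp : e p = Vtx.mk' _ s g) :
    ∃ z : Chamber e tr, z.g = g ∧ z.f s = p := by
  classical
  have hadj : ∀ {t}, t ≠ s → (cosetComplex (StandardParabolic M) T).Adj (e p) (Vtx.mk' _ t g) :=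
    fun ht => hp ▸ adj_mk' ht.symm g
  refine ⟨⟨g, fun t => if t = s then p else tr p (Vtx.mk' _ t g), fun t => ?_,
    fun t r htr => ?_⟩, rfl, if_pos rfl⟩
  · by_cases ht : t = s
    · rw [if_pos ht, ht, hp]
    · rw [if_neg ht]
      exact (h1 _ _ (hadj ht)).1
  · by_cases ht : t = s
    · rw [if_pos ht, if_neg (ht ▸ htr.symm)]
    · rw [if_neg ht]
      by_cases hr : r = s
      · rw [if_pos hr, hr, ← hp]
        exact (h1 _ _ (hadj ht)).2
      · rw [if_neg hr]
        exact h2 _ _ _ (hp ▸ tri_mk' (Ne.symm ht) htr (Ne.symm hr) g)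

theorem mk'_mul {s : T} (g h : StandardParabolic M T)
    (hh : (h : ArtinGroup M) ∈ StandardParabolic M (T \ {s.1})) :
    Vtx.mk' (StandardParabolic M) s (g * h) = Vtx.mk' _ s g :=
  Vtx.mk'_eq rfl (by simpa [Vtx.mk'] using hh)

include h1 h2 in
theorem exists_move [hT : Nontrivial T] (a : T) (x : StandardParabolic M T)
    (hx : (x : ArtinGroup M) ∈ StandardParabolic M {a.1}) (z : Chamber e tr) :
    ∃ z' : Chamber e tr, z'.g = z.g * x ∧ ∀ s ≠ a, z'.f s = z.f s := by
  have hx' : ∀ s ≠ a, (x : ArtinGroup M) ∈ StandardParabolic M (T \ {s.1}) := fun s hs =>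
    standardParabolic_mono (by
      rintro _ rfl
      exact ⟨a.2, fun h => hs (Subtype.ext h.symm)⟩) hx
  obtain ⟨s, hs⟩ := exists_ne a
  obtain ⟨z', h3, h4⟩ := exists_chamber h1 h2 (s := s) (p := z.f s) (z.g * x)
    (by rw [z.e_f, mk'_mul _ _ (hx' s hs)])
  refine ⟨z', h3, fun t ht => ?_⟩
  by_cases hst : s = t
  · rw [← hst, h4]
  · rw [← z'.tr_f s t hst, h4, h3, mk'_mul _ _ (hx' t ht), z.tr_f s t hst]

theorem gen_mem_T (a : T) : gen M a.1 ∈ StandardParabolic M T := gen_mem a.2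

/-- Crossing a panel of type `a` in a covering of the coset complex. -/
noncomputable def movePerm [Nontrivial T] (a : T) : Equiv.Perm (Chamber e tr) where
  toFun z := (exists_move h1 h2 a ⟨gen M a.1, gen_mem_T a⟩ (gen_mem rfl) z).choose
  invFun z := (exists_move h1 h2 a ⟨gen M a.1, gen_mem_T a⟩⁻¹
    (inv_mem (gen_mem rfl)) z).choose
  left_inv z := by
    obtain ⟨s, hs⟩ := exists_ne a
    have hz := (exists_move h1 h2 a ⟨gen M a.1, gen_mem_T a⟩ (gen_mem rfl) z).choose_spec
    have hz' := (exists_move h1 h2 a ⟨gen M a.1, gen_mem_T a⟩⁻¹ (inv_mem (gen_mem rfl))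
      (exists_move h1 h2 a ⟨gen M a.1, gen_mem_T a⟩ (gen_mem rfl) z).choose).choose_spec
    exact Chamber.ext' (by rw [hz'.1, hz.1, mul_inv_cancel_right]) (s := s)
      (by rw [hz'.2 s hs, hz.2 s hs])
  right_inv z := by
    obtain ⟨s, hs⟩ := exists_ne a
    have hz := (exists_move h1 h2 a ⟨gen M a.1, gen_mem_T a⟩⁻¹
      (inv_mem (gen_mem rfl)) z).choose_spec
    have hz' := (exists_move h1 h2 a ⟨gen M a.1, gen_mem_T a⟩ (gen_mem rfl)
      (exists_move h1 h2 a ⟨gen M a.1, gen_mem_T a⟩⁻¹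
        (inv_mem (gen_mem rfl)) z).choose).choose_spec
    exact Chamber.ext' (by rw [hz'.1, hz.1, inv_mul_cancel_right]) (s := s)
      (by rw [hz'.2 s hs, hz.2 s hs])

theorem movePerm_spec [Nontrivial T] (a : T) (z : Chamber e tr) :
    (movePerm h1 h2 a z).g = z.g * ⟨gen M a.1, gen_mem_T a⟩ ∧
      ∀ s ≠ a, (movePerm h1 h2 a z).f s = z.f s :=
  (exists_move h1 h2 a ⟨gen M a.1, gen_mem_T a⟩ (gen_mem rfl) z).choose_spec

open Classical in
/-- Crossing panels, as a family indexed by all generators. -/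
noncomputable def moveOp [Nontrivial T] (a : S) : (Equiv.Perm (Chamber e tr))ᵐᵒᵖ :=
  if ha : a ∈ T then MulOpposite.op (movePerm h1 h2 ⟨a, ha⟩) else 1

theorem moveOp_spec [Nontrivial T] {a : S} (ha : a ∈ T) (z : Chamber e tr) :
    (((moveOp h1 h2 a).unop z).g : ArtinGroup M) = z.g * gen M a ∧
      ∀ s : T, s.1 ≠ a → ((moveOp h1 h2 a).unop z).f s = z.f s := by
  rw [moveOp, dif_pos ha, MulOpposite.unop_op]
  obtain ⟨h3, h4⟩ := movePerm_spec h1 h2 ⟨a, ha⟩ z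
  exact ⟨by rw [h3]; rfl, fun s hs => h4 s fun h => hs (congrArg Subtype.val h)⟩

theorem altProd_moveOp_spec [Nontrivial T] {a b : S} (ha : a ∈ T) (hb : b ∈ T) (m : ℕ)
    (z : Chamber e tr) :
    (((altProd (moveOp h1 h2) a b m).unop z).g : ArtinGroup M) = z.g * altProd (gen M) a b m ∧
      ∀ s : T, s.1 ≠ a → s.1 ≠ b → ((altProd (moveOp h1 h2) a b m).unop z).f s = z.f s := by
  induction m generalizing a b z with
  | zero => simp [altProd]
  | succ m ih =>
    obtain ⟨h3, h4⟩ := moveOp_spec h1 h2 ha z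
    obtain ⟨h5, h6⟩ := ih hb ha ((moveOp h1 h2 a).unop z)
    rw [altProd, MulOpposite.unop_mul, Equiv.Perm.mul_apply, altProd]
    exact ⟨by rw [h5, h3, mul_assoc], fun s hs ht => by rw [h6 s ht hs, h4 s hs]⟩

theorem moveOp_braid [Nontrivial T] (hT : ∀ a b, ∃ s ∈ T, s ≠ a ∧ s ≠ b) :
    BraidOn M (moveOp h1 h2) T := by
  intro a ha b hb hab m hm
  apply MulOpposite.unop_injective
  ext1 z
  obtain ⟨s, hs, hsa, hsb⟩ := hT a b
  obtain ⟨h3, h4⟩ := altProd_moveOp_spec h1 h2 ha hb m z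
  obtain ⟨h5, h6⟩ := altProd_moveOp_spec h1 h2 hb ha m z
  refine Chamber.ext' (Subtype.ext ?_) (s := ⟨s, hs⟩) ?_
  · rw [h3, h5, gen_braid T a ha b hb hab m hm]
  · rw [h4 ⟨s, hs⟩ hsa hsb, h6 ⟨s, hs⟩ hsb hsa]

end Cover

/-- Coset complexes of rank at least three are simply connected. -/
theorem simplyConn_cosetComplex {S : Type u} {M : S → S → ℕ∞} {T : Set S}
    (hsymm : ∀ s t, M s t = M t s) (hm2 : ∀ s t, s ≠ t → 2 ≤ M s t)
    (hT : ∀ a b, ∃ s ∈ T, s ≠ a ∧ s ≠ b) :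
    (cosetComplex (StandardParabolic M) T).SimplyConn := by
  intro N e tr h1 h2 p₀
  have hinf : InfCompat (StandardParabolic M) := standardParabolic_inf hsymm hm2
  have : Nontrivial T := by
    let a : T := ⟨(e p₀).ty, (e p₀).ty_mem⟩
    obtain ⟨s, hs, hsa, -⟩ := hT a.1 a.1
    exact ⟨⟨s, hs⟩, a, fun h => hsa (congrArg Subtype.val h)⟩
  obtain ⟨φ, hφ⟩ := exists_parabolic_hom hsymm hm2 (moveOp_braid h1 h2 hT)
  have key : ∀ (U : Set S), U ⊆ T → ∀ h ∈ StandardParabolic M U,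
      ∃ hh : h ∈ StandardParabolic M T, ∀ z : Chamber e tr,
        (((φ ⟨h, hh⟩).unop z).g : ArtinGroup M) = z.g * h ∧
        ∀ s : T, s.1 ∉ U → ((φ ⟨h, hh⟩).unop z).f s = z.f s := by
    intro U hU h hh
    refine standardParabolic_induction (p := fun h => ∃ hh : h ∈ StandardParabolic M T,
      ∀ z : Chamber e tr, (((φ ⟨h, hh⟩).unop z).g : ArtinGroup M) = z.g * h ∧
        ∀ s : T, s.1 ∉ U → ((φ ⟨h, hh⟩).unop z).f s = z.f s) ?_ ?_ ?_ ?_ hh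
    · intro t ht
      refine ⟨gen_mem (hU ht), fun z => ?_⟩
      rw [hφ t (hU ht)]
      obtain ⟨h3, h4⟩ := moveOp_spec h1 h2 (hU ht) z
      exact ⟨h3, fun s hs => h4 s fun e => hs (e ▸ ht)⟩
    · refine ⟨one_mem _, fun z => ?_⟩
      have : φ ⟨1, one_mem _⟩ = 1 := map_one φ
      rw [this]
      simp
    · rintro g h ⟨hg, hg'⟩ ⟨hh, hh'⟩
      refine ⟨mul_mem hg hh, fun z => ?_⟩
      have : φ ⟨g * h, mul_mem hg hh⟩ = φ ⟨g, hg⟩ * φ ⟨h, hh⟩ := map_mul φ ⟨g, hg⟩ ⟨h, hh⟩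
      rw [this, MulOpposite.unop_mul, Equiv.Perm.mul_apply]
      exact ⟨by rw [(hh' _).1, (hg' _).1, mul_assoc],
        fun s hs => by rw [(hh' _).2 s hs, (hg' _).2 s hs]⟩
    · rintro g ⟨hg, hg'⟩
      refine ⟨inv_mem hg, fun z => ?_⟩
      have e1 : φ ⟨g⁻¹, inv_mem hg⟩ = (φ ⟨g, hg⟩)⁻¹ := map_inv φ ⟨g, hg⟩
      rw [e1, MulOpposite.unop_inv]
      obtain ⟨w, rfl⟩ := (φ ⟨g, hg⟩).unop.surjective z
      rw [← Equiv.Perm.mul_apply, inv_mul_cancel, Equiv.Perm.one_apply]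
      exact ⟨by rw [(hg' w).1, mul_inv_cancel_right], fun s hs => ((hg' w).2 s hs).symm⟩
  obtain ⟨g₀, hg₀⟩ := (e p₀).exists_mem
  lift g₀ to StandardParabolic M T using Vtx.mem_of_mem hinf hg₀
  obtain ⟨z₀, hz₀, hz₀'⟩ := exists_chamber h1 h2 (s := ⟨(e p₀).ty, (e p₀).ty_mem⟩) (p := p₀) g₀
    (Vtx.mk'_eq rfl hg₀).symm
  let Z : StandardParabolic M T → Chamber e tr := fun g => (φ (g₀⁻¹ * g)).unop z₀
  have hZg : ∀ g, (Z g).g = g := by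
    intro g
    obtain ⟨hh, h3⟩ := key T subset_rfl _ (g₀⁻¹ * g).2
    apply Subtype.ext
    change (((φ ⟨(g₀⁻¹ * g).1, hh⟩).unop z₀).g : ArtinGroup M) = g
    rw [(h3 z₀).1, hz₀]
    simp
  have hZ : ∀ g h : StandardParabolic M T, ∀ s : T,
      (g⁻¹ * h : ArtinGroup M) ∈ StandardParabolic M (T \ {s.1}) → (Z h).f s = (Z g).f s := by
    intro g h s hs
    obtain ⟨hh, h3⟩ := key _ Set.sdiff_subset _ hs
    have : Z h = (φ ⟨(g⁻¹ * h : ArtinGroup M), hh⟩).unop (Z g) := by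
      change (φ (g₀⁻¹ * h)).unop z₀ = (φ _).unop ((φ (g₀⁻¹ * g)).unop z₀)
      rw [← Equiv.Perm.mul_apply, ← MulOpposite.unop_mul, ← map_mul]
      congr 3
      apply Subtype.ext
      simp [mul_assoc]
    rw [this]
    exact (h3 _).2 s (by simp)
  have hch : ∀ v : Vtx (StandardParabolic M) T,
      ∃ g : StandardParabolic M T, (g : ArtinGroup M) ∈ v.car := by
    intro v
    obtain ⟨g, hg⟩ := v.exists_mem
    exact ⟨⟨g, Vtx.mem_of_mem hinf hg⟩, hg⟩
  choose c hc using hch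
  have hσ : ∀ v, ∀ g : StandardParabolic M T, (g : ArtinGroup M) ∈ v.car →
      (Z (c v)).f ⟨v.ty, v.ty_mem⟩ = (Z g).f ⟨v.ty, v.ty_mem⟩ := fun v g hg =>
    hZ _ _ _ ((Vtx.mem_iff hg).1 (hc v))
  refine ⟨fun v => (Z (c v)).f ⟨v.ty, v.ty_mem⟩, fun v => ?_, ?_, fun v w hvw => ?_⟩
  · rw [(Z (c v)).e_f, hZg]
    exact Vtx.mk'_eq rfl (hc v)
  · change (Z (c (e p₀))).f ⟨(e p₀).ty, (e p₀).ty_mem⟩ = p₀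
    rw [hσ _ g₀ hg₀]
    have : Z g₀ = z₀ := by simp [Z]
    rw [this, hz₀']
  · obtain ⟨hne, g, hv, hw⟩ := hvw
    lift g to StandardParabolic M T using Vtx.mem_of_mem hinf hv
    change (Z (c w)).f ⟨w.ty, w.ty_mem⟩ = tr ((Z (c v)).f ⟨v.ty, v.ty_mem⟩) w
    rw [hσ w g hw, hσ v g hv, ← (Z g).tr_f ⟨v.ty, v.ty_mem⟩ ⟨w.ty, w.ty_mem⟩
      (fun h => hne (congrArg Subtype.val h)), hZg, Vtx.mk'_eq rfl hw]



section Conj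
variable {G : Type*} [Group G]

theorem mem_conjSubgroup {g x : G} {H : Subgroup G} :
    x ∈ conjSubgroup g H ↔ g⁻¹ * x * g ∈ H := by
  constructor
  · rintro ⟨y, hy, rfl⟩
    simpa [mul_assoc] using hy
  · intro h
    exact ⟨_, h, by simp [mul_assoc]⟩

theorem conjSubgroup_conjSubgroup (g h : G) (H : Subgroup G) :
    conjSubgroup g (conjSubgroup h H) = conjSubgroup (g * h) H := by
  ext x
  simp only [mem_conjSubgroup, mul_inv_rev, mul_assoc]

theorem conjSubgroup_one (H : Subgroup G) : conjSubgroup 1 H = H := by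
  ext x
  simp [mem_conjSubgroup]

theorem conjSubgroup_inf (g : G) (H K : Subgroup G) :
    conjSubgroup g (H ⊓ K) = conjSubgroup g H ⊓ conjSubgroup g K := by
  ext x
  simp [mem_conjSubgroup]

theorem conjSubgroup_bot (g : G) : conjSubgroup g (⊥ : Subgroup G) = ⊥ := by
  simp [conjSubgroup]

theorem conjSubgroup_mono (g : G) {H K : Subgroup G} (h : H ≤ K) :
    conjSubgroup g H ≤ conjSubgroup g K := Subgroup.map_mono h

theorem conjSubgroup_of_mem {g : G} {H : Subgroup G} (h : g ∈ H) : conjSubgroup g H = H := by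
  ext x
  rw [mem_conjSubgroup, Subgroup.mul_mem_cancel_right _ h,
    Subgroup.mul_mem_cancel_left _ (inv_mem h)]

theorem conjSubgroup_conjSubgroup_inv (g : G) (H : Subgroup G) :
    conjSubgroup g (conjSubgroup g⁻¹ H) = H := by
  rw [conjSubgroup_conjSubgroup, mul_inv_cancel, conjSubgroup_one]

theorem conjSubgroup_zpowers (g x : G) :
    conjSubgroup g (Subgroup.zpowers x) = Subgroup.zpowers (g * x * g⁻¹) := by
  rw [conjSubgroup, MonoidHom.map_zpowers]
  rfl

end Conj

section Stab
variable {S G : Type u} [Group G] (P : Set S → Subgroup G)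

/-- The parabolic subgroups of a standard parabolic subgroup. -/
def ParIn (T : Set S) (Q : Subgroup G) : Prop := ∃ g ∈ P T, ∃ X ⊆ T, Q = conjSubgroup g (P X)

/-- Intersections of parabolic subgroups are parabolic. -/
def InfClosed (T : Set S) : Prop := ∀ Q Q', ParIn P T Q → ParIn P T Q' → ParIn P T (Q ⊓ Q')

/-- Parabolic subgroups contained in a standard parabolic subgroup are parabolic there. -/
def Restricts (T : Set S) : Prop := ∀ U ⊆ T, ∀ Q, ParIn P T Q → Q ≤ P U → ParIn P U Q

variable {P} {T : Set S}

theorem ParIn.mono (hP : InfCompat P) {U : Set S} (h : U ⊆ T) {Q : Subgroup G}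
    (hQ : ParIn P U Q) : ParIn P T Q := by
  obtain ⟨g, hg, X, hX, e⟩ := hQ
  exact ⟨g, hP.mono h hg, X, hX.trans h, e⟩

theorem ParIn.conj {Q : Subgroup G} (hQ : ParIn P T Q) {k : G} (hk : k ∈ P T) :
    ParIn P T (conjSubgroup k Q) := by
  obtain ⟨g, hg, X, hX, rfl⟩ := hQ
  exact ⟨k * g, mul_mem hk hg, X, hX, conjSubgroup_conjSubgroup _ _ _⟩

theorem ParIn.le (hP : InfCompat P) {Q : Subgroup G} (hQ : ParIn P T Q) : Q ≤ P T := by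
  obtain ⟨g, hg, X, hX, rfl⟩ := hQ
  exact (conjSubgroup_mono g (hP.mono hX)).trans_eq (conjSubgroup_of_mem hg)

theorem parIn_standard {X : Set S} (h : X ⊆ T) : ParIn P T (P X) :=
  ⟨1, one_mem _, X, h, (conjSubgroup_one _).symm⟩

namespace Vtx

/-- Left translation of vertices. -/
def smul (x : P T) (v : Vtx P T) : Vtx P T where
  ty := v.ty
  car := {h | (x : G)⁻¹ * h ∈ v.car}
  ty_mem := v.ty_mem
  spec := by
    obtain ⟨g, hg, h⟩ := v.spec
    exact ⟨x * g, mul_mem x.2 hg, fun k => by simp [h, mul_assoc]⟩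

/-- Left translation as a permutation. -/
def smulPerm (x : P T) : Equiv.Perm (Vtx P T) where
  toFun := smul x
  invFun := smul x⁻¹
  left_inv v := by ext <;> simp [smul]
  right_inv v := by ext <;> simp [smul]

theorem adj_smul (x : P T) {v w : Vtx P T} (h : (cosetComplex P T).Adj v w) :
    (cosetComplex P T).Adj (smul x v) (smul x w) := by
  obtain ⟨hne, g, hv, hw⟩ := h
  exact ⟨hne, x * g, by simpa [smul] using hv, by simpa [smul] using hw⟩

/-- The stabilizer of a vertex. -/
noncomputable def stab (v : Vtx P T) : Subgroup G :=
  conjSubgroup v.exists_mem.choose (P (T \ {v.ty}))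

theorem stab_eq {v : Vtx P T} {k : G} (hk : k ∈ v.car) :
    v.stab = conjSubgroup k (P (T \ {v.ty})) := by
  have h := (mem_iff hk).1 v.exists_mem.choose_spec
  conv_rhs => rw [← conjSubgroup_of_mem h, conjSubgroup_conjSubgroup, mul_inv_cancel_left]
  rfl

theorem stab_le (hP : InfCompat P) (v : Vtx P T) : v.stab ≤ P T := by
  obtain ⟨k, hk⟩ := v.exists_mem
  rw [stab_eq hk]
  exact (conjSubgroup_mono k (hP.mono Set.sdiff_subset)).trans_eq
    (conjSubgroup_of_mem (mem_of_mem hP hk))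

theorem smul_eq_iff {v : Vtx P T} {x : P T} : smul x v = v ↔ (x : G) ∈ v.stab := by
  obtain ⟨k, hk⟩ := v.exists_mem
  rw [stab_eq hk, mem_conjSubgroup, mul_assoc, ← mem_iff hk]
  constructor
  · intro h
    rw [← h]
    simpa [smul] using hk
  · intro h
    exact eq_of_mem rfl (g := x * k) (by simpa [smul] using hk) h

/-- Parabolic subgroups of the stabilizer of a vertex. -/
def Above (v : Vtx P T) (Q : Subgroup G) : Prop :=
  ∃ k ∈ v.car, ParIn P (T \ {v.ty}) (conjSubgroup k⁻¹ Q)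

theorem above_iff {v : Vtx P T} {Q : Subgroup G} {k : G} (hk : k ∈ v.car) :
    v.Above Q ↔ ParIn P (T \ {v.ty}) (conjSubgroup k⁻¹ Q) := by
  refine ⟨?_, fun h => ⟨k, hk, h⟩⟩
  rintro ⟨l, hl, h⟩
  have := h.conj ((mem_iff hk).1 hl)
  rwa [conjSubgroup_conjSubgroup, mul_assoc, mul_inv_cancel, mul_one] at this

theorem Above.le_stab (hP : InfCompat P) {v : Vtx P T} {Q : Subgroup G} (h : v.Above Q) :
    Q ≤ v.stab := by
  obtain ⟨k, hk, h⟩ := h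
  rw [stab_eq hk, ← conjSubgroup_conjSubgroup_inv k Q]
  exact conjSubgroup_mono k (h.le hP)

theorem Above.parIn (hP : InfCompat P) {v : Vtx P T} {Q : Subgroup G} (h : v.Above Q) :
    ParIn P T Q := by
  obtain ⟨k, hk, h⟩ := h
  rw [← conjSubgroup_conjSubgroup_inv k Q]
  exact (h.mono hP Set.sdiff_subset).conj (mem_of_mem hP hk)

theorem Above.inf {v : Vtx P T} {Q Q' : Subgroup G} (hA : InfClosed P (T \ {v.ty}))
    (h : v.Above Q) (h' : v.Above Q') : v.Above (Q ⊓ Q') := by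
  obtain ⟨k, hk⟩ := v.exists_mem
  rw [above_iff hk] at *
  rw [conjSubgroup_inf]
  exact hA _ _ h h'

theorem Above.inf_stab (hP : InfCompat P) {v w : Vtx P T} {Q : Subgroup G}
    (hA : InfClosed P (T \ {v.ty})) (hB : Restricts P (T \ {v.ty})) (h : v.Above Q)
    (hvw : (cosetComplex P T).Adj v w) : w.Above (Q ⊓ w.stab) := by
  obtain ⟨hne, k, hv, hw⟩ := hvw
  have e : Q ⊓ w.stab = Q ⊓ conjSubgroup k (P ((T \ {v.ty}) \ {w.ty})) := by
    rw [Set.sdiff_sdiff, ← Set.sdiff_inter_sdiff, ← hP, conjSubgroup_inf, ← stab_eq hv,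
      ← stab_eq hw, ← inf_assoc, inf_eq_left.2 (h.le_stab hP)]
  rw [above_iff hv] at h
  rw [above_iff hw, e, conjSubgroup_inf, conjSubgroup_conjSubgroup, inv_mul_cancel,
    conjSubgroup_one]
  refine (hB _ Set.sdiff_subset _ (hA _ _ h (parIn_standard Set.sdiff_subset))
    inf_le_right).mono hP ?_
  intro x hx
  exact ⟨hx.1.1, hx.2⟩

/-- Parabolic subgroups of a stabilizer intersect other stabilizers in parabolic subgroups. -/
theorem Above.inf_stab_of_simplyConn (hP : InfCompat P)
    (hA : ∀ s ∈ T, InfClosed P (T \ {s})) (hB : ∀ s ∈ T, Restricts P (T \ {s}))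
    (hX : (cosetComplex P T).LocallyLarge) (hS : (cosetComplex P T).SimplyConn)
    {v : Vtx P T} {Q : Subgroup G} (h : v.Above Q) (o : Vtx P T) : o.Above (Q ⊓ o.stab) := by
  obtain ⟨lev, l1, l2, l3, l4⟩ := TriComplex.exists_level hX hS o
  induction hn : lev v generalizing v Q with
  | zero =>
    obtain rfl := l1 v hn
    rwa [inf_eq_left.2 (h.le_stab hP)]
  | succ n ih =>
    obtain ⟨w, hvw, hw⟩ := l2 v (by omega)
    have hle : Q ⊓ o.stab ≤ w.stab := by
      rintro x ⟨hx, hxo⟩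
      have hxT := stab_le hP _ hxo
      lift x to P T using hxT
      have hlev := l4 (smulPerm x) (fun _ _ => adj_smul x) (fun _ _ => adj_smul x⁻¹)
        (smul_eq_iff.2 hxo)
      have hxv : smul x v = v := smul_eq_iff.2 (h.le_stab hP hx)
      rw [← smul_eq_iff]
      by_contra hne
      exact (l3 v w (smul x w) hvw (hxv ▸ adj_smul x hvw) hw
        (by rw [← hw]; exact congrArg (· + 1) (hlev w)) (Ne.symm hne)).1 rfl
    have e : Q ⊓ o.stab = Q ⊓ w.stab ⊓ o.stab := by
      rw [inf_right_comm, inf_eq_left.2 hle]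
    rw [e]
    exact ih (h.inf_stab hP (hA _ v.ty_mem) (hB _ v.ty_mem) hvw) (by omega)

end Vtx

theorem parIn_cases {Q : Subgroup G} (hQ : ParIn P T Q) :
    Q = P T ∨ ∃ v : Vtx P T, v.Above Q := by
  obtain ⟨g, hg, X, hX, rfl⟩ := hQ
  by_cases h : T ⊆ X
  · rw [hX.antisymm h, conjSubgroup_of_mem hg]
    exact Or.inl rfl
  · obtain ⟨s, hs, hsX⟩ := Set.not_subset.1 h
    refine Or.inr ⟨Vtx.mk' P ⟨s, hs⟩ ⟨g, hg⟩, g, Vtx.mem_mk' _ _, ?_⟩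
    rw [conjSubgroup_conjSubgroup, inv_mul_cancel, conjSubgroup_one]
    exact parIn_standard fun x hx => ⟨hX hx, by rintro rfl; exact hsX hx⟩

theorem infClosed_of_simplyConn (hP : InfCompat P)
    (hA : ∀ s ∈ T, InfClosed P (T \ {s})) (hB : ∀ s ∈ T, Restricts P (T \ {s}))
    (hX : (cosetComplex P T).LocallyLarge) (hS : (cosetComplex P T).SimplyConn) :
    InfClosed P T := by
  intro Q Q' hQ hQ'
  rcases parIn_cases hQ with rfl | ⟨v, hv⟩
  · rwa [inf_eq_right.2 (hQ'.le hP)]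
  rcases parIn_cases hQ' with rfl | ⟨v', hv'⟩
  · rwa [inf_eq_left.2 (hQ.le hP)]
  have := (hv.inf_stab_of_simplyConn hP hA hB hX hS v').inf (hA _ v'.ty_mem) hv'
  rw [inf_assoc, inf_eq_right.2 (hv'.le_stab hP)] at this
  exact this.parIn hP

theorem restricts_of_simplyConn (hP : InfCompat P)
    (hA : ∀ s ∈ T, InfClosed P (T \ {s})) (hB : ∀ s ∈ T, Restricts P (T \ {s}))
    (hX : (cosetComplex P T).LocallyLarge) (hS : (cosetComplex P T).SimplyConn) :
    Restricts P T := by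
  intro U hU Q hQ hle
  by_cases h : T ⊆ U
  · rwa [hU.antisymm h]
  obtain ⟨s, hs, hsU⟩ := Set.not_subset.1 h
  have hUs : U ⊆ T \ {s} := fun x hx => ⟨hU hx, fun e => hsU (e ▸ hx)⟩
  rcases parIn_cases hQ with rfl | ⟨v, hv⟩
  · rw [hle.antisymm (hP.mono hU)]
    exact parIn_standard subset_rfl
  have h1 : (1 : G) ∈ (Vtx.mk' P ⟨s, hs⟩ 1).car := Vtx.mem_mk' _ _
  have := hv.inf_stab_of_simplyConn hP hA hB hX hS (Vtx.mk' P ⟨s, hs⟩ 1)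
  rw [Vtx.above_iff h1, Vtx.stab_eq h1, conjSubgroup_one, inv_one, conjSubgroup_one] at this
  change ParIn P (T \ {s}) (Q ⊓ P (T \ {s})) at this
  rw [inf_eq_left.2 (hle.trans (hP.mono hUs))] at this
  exact hB s hs U hUs Q this hle

end Stab



section Final
variable {S : Type u} {M : S → S → ℕ∞}

theorem standardParabolic_singleton (s : S) :
    StandardParabolic M {s} = Subgroup.zpowers (gen M s) := by
  rw [standardParabolic_eq, Set.image_singleton, Subgroup.zpowers_eq_closure]

/-- Parabolic subgroups in rank two that are neither trivial nor everything are cyclic. -/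
theorem parIn_pair_cases {a b : S} {Q : Subgroup (ArtinGroup M)}
    (hQ : ParIn (StandardParabolic M) {a, b} Q) :
    Q = ⊥ ∨ Q = StandardParabolic M {a, b} ∨ ∃ g ∈ StandardParabolic M {a, b},
      ∃ s ∈ ({a, b} : Set S), Q = Subgroup.zpowers (g * gen M s * g⁻¹) := by
  obtain ⟨g, hg, X, hX, rfl⟩ := hQ
  rcases Set.subset_pair_iff_eq.1 hX with rfl | rfl | rfl | rfl
  · exact Or.inl (by rw [standardParabolic_empty, conjSubgroup_bot])
  · exact Or.inr (Or.inr ⟨g, hg, a, by simp, by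
      rw [standardParabolic_singleton, conjSubgroup_zpowers]⟩)
  · exact Or.inr (Or.inr ⟨g, hg, b, by simp, by
      rw [standardParabolic_singleton, conjSubgroup_zpowers]⟩)
  · exact Or.inr (Or.inl (conjSubgroup_of_mem hg))

theorem parIn_bot (T : Set S) : ParIn (StandardParabolic M) T ⊥ := by
  rw [← standardParabolic_empty]
  exact parIn_standard (Set.empty_subset T)

theorem restricts_pair (hP : InfCompat (StandardParabolic M)) (a b : S) :
    Restricts (StandardParabolic M) {a, b} := by
  intro U hU Q hQ hle
  rcases parIn_pair_cases hQ with rfl | rfl | ⟨g, hg, s, hs, rfl⟩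
  · exact parIn_bot U
  · rw [hle.antisymm (hP.mono hU)]
    exact parIn_standard subset_rfl
  by_cases hU' : U = {a, b}
  · rwa [hU']
  have hx := hle (Subgroup.mem_zpowers _)
  have main : ∀ c, g * gen M s * g⁻¹ ∈ StandardParabolic M {c} →
      ParIn (StandardParabolic M) {c} (Subgroup.zpowers (g * gen M s * g⁻¹)) := by
    intro c hc
    rw [standardParabolic_singleton] at hc
    obtain ⟨k, hk⟩ := hc
    have hk1 : 1 = k :=
      exponent_eq_of_conj (a := s) (b := c) (g := g) (by rw [zpow_one]; exact hk.symm)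
    subst hk1
    simp only [zpow_one] at hk
    rw [← hk, ← standardParabolic_singleton]
    exact parIn_standard subset_rfl
  rcases Set.subset_pair_iff_eq.1 hU with rfl | rfl | rfl | rfl
  · have h1 := main s (standardParabolic_mono (Set.empty_subset _) hx)
    have h2 : Subgroup.zpowers (g * gen M s * g⁻¹) = ⊥ := by
      rwa [standardParabolic_empty, le_bot_iff] at hle
    rw [h2]
    exact parIn_bot _
  · exact main _ hx
  · exact main _ hx
  · exact absurd rfl hU'

variable (hsymm : ∀ s t, M s t = M t s) (hlarge : ∀ s t, s ≠ t → 3 ≤ M s t)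
include hsymm hlarge

theorem infClosed_pair (a b : S) : InfClosed (StandardParabolic M) {a, b} := by
  have hP : InfCompat (StandardParabolic M) := standardParabolic_inf hsymm
    fun s t h => le_trans (by norm_num) (hlarge s t h)
  intro Q Q' hQ hQ'
  rcases parIn_pair_cases hQ with rfl | rfl | ⟨g, hg, s, hs, rfl⟩
  · rw [bot_inf_eq]
    exact parIn_bot _
  · rwa [inf_eq_right.2 (hQ'.le hP)]
  rcases eq_or_ne a b with rfl | hab
  · obtain rfl : s = a := by simpa using hs
    rw [Set.pair_eq_singleton] at *
    rw [← conjSubgroup_zpowers, ← standardParabolic_singleton, conjSubgroup_of_mem hg,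
      inf_eq_right.2 (hQ'.le hP)]
    exact hQ'
  rcases parIn_pair_cases hQ' with rfl | rfl | ⟨g', hg', s', hs', rfl⟩
  · rw [inf_bot_eq]
    exact parIn_bot _
  · rwa [inf_eq_left.2 (hQ.le hP)]
  rcases Subgroup.bot_or_exists_ne_one (Subgroup.zpowers (g * gen M s * g⁻¹) ⊓
    Subgroup.zpowers (g' * gen M s' * g'⁻¹)) with h | ⟨x, ⟨⟨k, hk⟩, ⟨l, hl⟩⟩, hx⟩
  · rw [h]
    exact parIn_bot _
  · simp only [conj_zpow] at hk hl
    have e : g'⁻¹ * g * gen M s ^ k * (g'⁻¹ * g)⁻¹ = gen M s' ^ l := by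
      rw [← hl] at hk
      calc _ = g'⁻¹ * (g * gen M s ^ k * g⁻¹) * g' := by group
        _ = _ := by rw [hk]; group
    obtain rfl := exponent_eq_of_conj e
    have hk0 : k ≠ 0 := by
      rintro rfl
      exact hx (by simp [← hk])
    have e' := conj_gen_of_conj_zpow hsymm hlarge hab hs hs' (mul_mem (inv_mem hg') hg) hk0 e
    have e'' : g' * gen M s' * g'⁻¹ = g * gen M s * g⁻¹ := by
      rw [← e']
      group
    rwa [e'', inf_idem]

theorem simplyConn_of_ncard {T : Set S} (h3 : 2 < T.ncard) :
    (cosetComplex (StandardParabolic M) T).SimplyConn := by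
  refine simplyConn_cosetComplex hsymm (fun s t h => le_trans (by norm_num) (hlarge s t h))
    fun a b => ?_
  have hab : ({a, b} : Set S).ncard < T.ncard := by
    have h1 := Set.ncard_insert_le a {b}
    rw [Set.ncard_singleton] at h1
    omega
  obtain ⟨s, hs, hs'⟩ := Set.exists_mem_notMem_of_ncard_lt_ncard hab
  exact ⟨s, hs, by simpa using hs'⟩

theorem locallyLarge_large_of_ncard {n : ℕ} {T : Set S} (hn : T.ncard = n + 2) :
    (1 ≤ n → (cosetComplex (StandardParabolic M) T).LocallyLarge) ∧
      (cosetComplex (StandardParabolic M) T).Large := by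
  have hm2 : ∀ s t, s ≠ t → 2 ≤ M s t := fun s t h => le_trans (by norm_num) (hlarge s t h)
  have hP : InfCompat (StandardParabolic M) := standardParabolic_inf hsymm hm2
  induction n generalizing T with
  | zero =>
    refine ⟨fun h => absurd h (by omega), ?_⟩
    obtain ⟨a, b, hab, rfl⟩ := Set.ncard_eq_two.1 hn
    refine large_cosetComplex_pair fun s t _ hst x hx y hy z hz w hw e => ?_
    rw [standardParabolic_singleton] at hx hy hz hw
    obtain ⟨i, rfl⟩ := hx
    obtain ⟨j, rfl⟩ := hy
    obtain ⟨k, rfl⟩ := hz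
    obtain ⟨l, rfl⟩ := hw
    refine (girth_rank_two hsymm hlarge hst e).imp ?_ ?_ <;> rintro rfl <;> exact zpow_zero _
  | succ n ih =>
    have hl : (cosetComplex (StandardParabolic M) T).LocallyLarge :=
      locallyLarge_cosetComplex hP fun s hs =>
        (ih (by rw [Set.ncard_sdiff_singleton_of_mem hs, hn]; omega)).2
    exact ⟨fun _ => hl,
      TriComplex.large_of_locallyLarge hl (simplyConn_of_ncard hsymm hlarge (by omega))⟩

theorem infClosed_and_restricts {T : Set S} (hT : T.Finite) :
    InfClosed (StandardParabolic M) T ∧ Restricts (StandardParabolic M) T := by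
  have hm2 : ∀ s t, s ≠ t → 2 ≤ M s t := fun s t h => le_trans (by norm_num) (hlarge s t h)
  have hP : InfCompat (StandardParabolic M) := standardParabolic_inf hsymm hm2
  induction hn : T.ncard generalizing T with
  | zero =>
    obtain rfl := (Set.ncard_eq_zero hT).1 hn
    have hbot : ∀ Q, ParIn (StandardParabolic M) (∅ : Set S) Q → Q = ⊥ := fun Q hQ => by
      have := hQ.le hP
      rwa [standardParabolic_empty, le_bot_iff] at this
    refine ⟨fun Q Q' hQ hQ' => ?_, fun U hU Q hQ _ => ?_⟩
    · rwa [hbot Q' hQ', inf_bot_eq, ← hbot Q' hQ']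
    · rw [hbot Q hQ]
      exact parIn_bot U
  | succ n ih =>
    have ih' : ∀ s ∈ T, _ := fun s hs =>
      ih (T := T \ {s}) hT.sdiff (by rw [Set.ncard_sdiff_singleton_of_mem hs, hn]; omega)
    rcases lt_or_ge n 2 with h | h
    · obtain ⟨a, b, hab⟩ : ∃ a b, T = {a, b} ∧ (a = b ∨ a ≠ b) := by
        interval_cases n
        · obtain ⟨a, rfl⟩ := Set.ncard_eq_one.1 hn
          exact ⟨a, a, by simp, Or.inl rfl⟩
        · obtain ⟨a, b, hab, rfl⟩ := Set.ncard_eq_two.1 hn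
          exact ⟨a, b, rfl, Or.inr hab⟩
      obtain ⟨rfl, hab⟩ := hab
      exact ⟨infClosed_pair hsymm hlarge a b, restricts_pair hP a b⟩
    · obtain ⟨m, rfl⟩ := Nat.exists_eq_add_of_le' h
      have hl := (locallyLarge_large_of_ncard hsymm hlarge (n := m + 1) (T := T)
        (by omega)).1 (by omega)
      have hs := simplyConn_of_ncard hsymm hlarge (T := T) (by omega)
      exact ⟨infClosed_of_simplyConn hP (fun s h => (ih' s h).1) (fun s h => (ih' s h).2) hl hs,
        restricts_of_simplyConn hP (fun s h => (ih' s h).1) (fun s h => (ih' s h).2) hl hs⟩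

omit hsymm hlarge in
theorem isParabolic_iff {Q : Subgroup (ArtinGroup M)} :
    IsParabolic M Q ↔ ParIn (StandardParabolic M) Set.univ Q := by
  simp [IsParabolic, ParIn, standardParabolic_univ]

theorem isParabolic_inf [Finite S] {Q Q' : Subgroup (ArtinGroup M)} (hQ : IsParabolic M Q)
    (hQ' : IsParabolic M Q') : IsParabolic M (Q ⊓ Q') := by
  rw [isParabolic_iff] at *
  exact (infClosed_and_restricts hsymm hlarge Set.finite_univ).1 _ _ hQ hQ'

theorem exists_least_isParabolic [Finite S] (P : Subgroup (ArtinGroup M)) :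
    ∃ R, IsParabolic M R ∧ P ≤ R ∧ ∀ Q, IsParabolic M Q → P ≤ Q → R ≤ Q := by
  have hex : ∃ n, ∃ (g : ArtinGroup M) (Y : Set S),
      Y.ncard = n ∧ P ≤ conjSubgroup g (StandardParabolic M Y) :=
    ⟨_, 1, Set.univ, rfl, by rw [conjSubgroup_one, standardParabolic_univ]; exact le_top⟩
  classical
  obtain ⟨g, Y, hY, hPY⟩ := Nat.find_spec hex
  refine ⟨_, ⟨g, Y, rfl⟩, hPY, fun Q hQ hPQ => ?_⟩
  have h1 := isParabolic_inf hsymm hlarge ⟨g, Y, rfl⟩ hQ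
  have h2 : ParIn (StandardParabolic M) Y
      (conjSubgroup g⁻¹ (conjSubgroup g (StandardParabolic M Y) ⊓ Q)) := by
    refine (infClosed_and_restricts hsymm hlarge Set.finite_univ).2 _ (Set.subset_univ _) _
      ((isParabolic_iff.1 h1).conj (by rw [standardParabolic_univ]; exact Subgroup.mem_top _)) ?_
    rw [conjSubgroup_inf, conjSubgroup_conjSubgroup, inv_mul_cancel, conjSubgroup_one]
    exact inf_le_left
  obtain ⟨h, hh, X, hX, e⟩ := h2
  have e' : conjSubgroup g (StandardParabolic M Y) ⊓ Q =
      conjSubgroup (g * h) (StandardParabolic M X) := by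
    rw [← conjSubgroup_conjSubgroup, ← e, conjSubgroup_conjSubgroup_inv]
  have h3 := Nat.find_min' hex ⟨g * h, X, rfl, e' ▸ le_inf hPY hPQ⟩
  obtain rfl := Set.eq_of_subset_of_ncard_le hX (hY ▸ h3)
  rw [← conjSubgroup_conjSubgroup, conjSubgroup_of_mem hh] at e'
  exact inf_eq_left.1 e'

end Final

end LargeArtin

/-- In a large-type Artin group, the set of parabolic subgroups ordered by inclusion
is a lattice: the intersection of two parabolic subgroups is a parabolic subgroup (their
meet), and any two parabolic subgroups admit a join among parabolic subgroups. -/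
theorem parabolics_form_lattice {S : Type*} [Finite S] (M : S → S → ℕ∞)
    (hsymm : ∀ s t : S, M s t = M t s)
    (hlarge : ∀ s t : S, s ≠ t → 3 ≤ M s t)
    (P₁ P₂ : Subgroup (ArtinGroup M))
    (h₁ : IsParabolic M P₁) (h₂ : IsParabolic M P₂) :
    (IsParabolic M (P₁ ⊓ P₂) ∧ P₁ ⊓ P₂ ≤ P₁ ∧ P₁ ⊓ P₂ ≤ P₂ ∧
      ∀ Q : Subgroup (ArtinGroup M), IsParabolic M Q → Q ≤ P₁ → Q ≤ P₂ → Q ≤ P₁ ⊓ P₂) ∧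
    ∃ R : Subgroup (ArtinGroup M), IsParabolic M R ∧ P₁ ≤ R ∧ P₂ ≤ R ∧
      ∀ Q : Subgroup (ArtinGroup M), IsParabolic M Q → P₁ ≤ Q → P₂ ≤ Q → R ≤ Q := by
  refine ⟨⟨LargeArtin.isParabolic_inf hsymm hlarge h₁ h₂, inf_le_left, inf_le_right,
    fun Q _ hQ₁ hQ₂ => le_inf hQ₁ hQ₂⟩, ?_⟩
  obtain ⟨R, hR, hle, hmin⟩ := LargeArtin.exists_least_isParabolic hsymm hlarge (P₁ ⊔ P₂)
  exact ⟨R, hR, le_sup_left.trans hle, le_sup_right.trans hle,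
    fun Q hQ hQ₁ hQ₂ => hmin Q hQ (sup_le hQ₁ hQ₂)⟩
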